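/- Let N=2, p ∈ [1,+∞), |Ω| = 1 and let (α_λ,ψ_λ) be a solution of (P)_λ with α_λ ≤ 0. Then λ ≥ λ₀(Ω,p), and equality holds if and only if: (i) α_λ = 0; (ii) either p = 1, or p > 1 and Ω is a disk of unit area; and (iii) in both situations of (ii), ξ_λ := λψ_λ is a minimizer of the Sobolev quotient R_{p+1}(w) = ∫_Ω|∇w|² / (∫_Ω|w|^{p+1})^{2/(p+1)} on H¹₀(Ω)\{0}. -/

import Mathlib

open MeasureTheory Metric Filter Real Set
noncomputable section

/-- The Laplacian of `f : ℝᴺ → ℝ` as the sum of second partial derivatives. -/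
def lap {N : ℕ} (f : EuclideanSpace ℝ (Fin N) → ℝ) (x : EuclideanSpace ℝ (Fin N)) : ℝ :=
  ∑ i : Fin N, fderiv ℝ (fun y => fderiv ℝ f y (EuclideanSpace.single i 1)) x
    (EuclideanSpace.single i 1)

/-- `(α, ψ)` is a solution of the problem `(P)_λ` on `Ω`. -/
structure IsSol {N : ℕ} (Ω : Set (EuclideanSpace ℝ (Fin N))) (p lam α : ℝ)
    (ψ : EuclideanSpace ℝ (Fin N) → ℝ) : Prop where
  contOn : ContinuousOn ψ (closure Ω)
  smooth : ContDiffOn ℝ 2 ψ Ω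
  pde : ∀ x ∈ Ω, -lap ψ x = max (α + lam * ψ x) 0 ^ p
  bdry : ∀ x ∈ frontier Ω, ψ x = 0
  constr : ∫ x in Ω, max (α + lam * ψ x) 0 ^ p = 1

/-- The Rayleigh/Sobolev quotient. -/
def Ray {N : ℕ} (Ω : Set (EuclideanSpace ℝ (Fin N))) (q : ℝ)
    (w : EuclideanSpace ℝ (Fin N) → ℝ) : ℝ :=
  (∫ x in Ω, ‖gradient w x‖ ^ 2) / (∫ x in Ω, |w x| ^ q) ^ (2 / q)

/-- The best Sobolev constant `Λ(Ω,q)`. -/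
def Lam {N : ℕ} (Ω : Set (EuclideanSpace ℝ (Fin N))) (q : ℝ) : ℝ :=
  sInf {r | ∃ w, ContDiff ℝ (⊤ : ℕ∞) w ∧ HasCompactSupport w ∧ tsupport w ⊆ Ω ∧
    w ≠ 0 ∧ r = Ray Ω q w}

/-- `λ₀(Ω,p)`. -/
def lam0 (Ω : Set (EuclideanSpace ℝ (Fin 2))) (p : ℝ) : ℝ :=
  (8 * π / (p + 1)) ^ ((p - 1) / (2 * p)) * Lam Ω (p + 1) ^ ((p + 1) / (2 * p))

/-- `Ω` is a disk of unit area in the plane. -/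
def IsUnitDisk (Ω : Set (EuclideanSpace ℝ (Fin 2))) : Prop :=
  ∃ c, Ω = ball c (Real.sqrt π⁻¹)

open scoped Pointwise ENNReal NNReal Topology

lemma volume_add_le_volume_add_of_isCompact {K L : Set ℝ} (hK : IsCompact K) (hL : IsCompact L)
    (hK' : K.Nonempty) (hL' : L.Nonempty) : volume K + volume L ≤ volume (K + L) := by
  obtain ⟨a, ha, hamax⟩ := hK.exists_isMaxOn hK' continuousOn_id
  obtain ⟨b, hb, hbmin⟩ := hL.exists_isMinOn hL' continuousOn_id
  have h1 : ((fun x => x + b) '' K) ∪ ((fun x => a + x) '' L) ⊆ K + L := by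
    rintro z (⟨x, hx, rfl⟩ | ⟨x, hx, rfl⟩)
    · exact Set.add_mem_add hx hb
    · exact Set.add_mem_add ha hx
  have h2 : volume ((fun x => x + b) '' K) = volume K := by
    simp
  have h3 : volume ((fun x => a + x) '' L) = volume L := by
    simp
  have h4 : ((fun x => x + b) '' K) ∩ ((fun x => a + x) '' L) ⊆ {a + b} := by
    rintro z ⟨⟨x, hx, rfl⟩, ⟨y, hy, hxy⟩⟩
    have e1 : x ≤ a := hamax hx
    have e2 : b ≤ y := hbmin hy
    simp only at hxy
    simp only [mem_singleton_iff]
    linarith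
  have h5 : volume (((fun x => x + b) '' K) ∩ ((fun x => a + x) '' L)) = 0 :=
    measure_mono_null h4 (by simp)
  have hm : MeasurableSet ((fun x => a + x) '' L) := (hL.image (by fun_prop)).measurableSet
  calc volume K + volume L
      = volume (((fun x => x + b) '' K) ∪ ((fun x => a + x) '' L)) := by
        have := measure_union_add_inter (μ := (volume : Measure ℝ)) ((fun x => x + b) '' K) hm
        rw [h5, h2, h3, add_zero] at this
        exact this.symm
    _ ≤ _ := measure_mono h1

/-- The one-dimensional Brunn–Minkowski inequality. -/
lemma volume_add_le_volume_add {X Y : Set ℝ} (hX : MeasurableSet X) (hY : MeasurableSet Y)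
    (hX' : X.Nonempty) (hY' : Y.Nonempty) : volume X + volume Y ≤ volume (X + Y) := by
  refine le_of_forall_lt fun c hc => ?_
  obtain ⟨x, hx⟩ := hX'
  obtain ⟨y, hy⟩ := hY'
  have key : ∀ r < volume X, ∀ s < volume Y, r + s ≤ volume (X + Y) := by
    intro r hr s hs
    obtain ⟨K, hKX, hK, hrK⟩ := hX.exists_lt_isCompact hr
    obtain ⟨L, hLY, hL, hsL⟩ := hY.exists_lt_isCompact hs
    have hKn : (insert x K).Nonempty := ⟨x, mem_insert _ _⟩
    have hLn : (insert y L).Nonempty := ⟨y, mem_insert _ _⟩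
    calc r + s ≤ volume (insert x K) + volume (insert y L) :=
          add_le_add (hrK.le.trans (measure_mono (subset_insert _ _)))
            (hsL.le.trans (measure_mono (subset_insert _ _)))
      _ ≤ volume (insert x K + insert y L) :=
          volume_add_le_volume_add_of_isCompact (hK.insert x) (hL.insert y) hKn hLn
      _ ≤ _ := measure_mono (Set.add_subset_add (insert_subset hx hKX) (insert_subset hy hLY))
  have hXle : volume X ≤ volume (X + Y) := by
    calc volume X = volume ((fun z => z + y) '' X) := by simp
      _ ≤ _ := measure_mono (by rintro z ⟨w, hw, rfl⟩; exact Set.add_mem_add hw hy)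
  have hYle : volume Y ≤ volume (X + Y) := by
    calc volume Y = volume ((fun z => x + z) '' Y) := by simp
      _ ≤ _ := measure_mono (by rintro z ⟨w, hw, rfl⟩; exact Set.add_mem_add hx hw)
  refine hc.trans_le ?_
  rcases eq_or_ne (volume X) 0 with h0 | h0
  · rw [h0, zero_add]; exact hYle
  rcases eq_or_ne (volume Y) 0 with h0' | h0'
  · rw [h0', add_zero]; exact hXle
  refine ENNReal.le_of_forall_pos_le_add ?_ |>.trans le_rfl
  intro ε hε htop
  have hXt : volume X ≠ ⊤ := (hXle.trans_lt htop).ne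
  have hYt : volume Y ≠ ⊤ := (hYle.trans_lt htop).ne
  have hε2 : ((ε / 2 : ℝ≥0) : ℝ≥0∞) ≠ 0 := by simpa using hε.ne'
  have e1 := key _ (ENNReal.sub_lt_self hXt h0 hε2) _ (ENNReal.sub_lt_self hYt h0' hε2)
  calc volume X + volume Y
      ≤ (volume X - (ε / 2 : ℝ≥0) + (ε / 2 : ℝ≥0)) + (volume Y - (ε / 2 : ℝ≥0) + (ε / 2 : ℝ≥0)) :=
        add_le_add le_tsub_add le_tsub_add
    _ = (volume X - (ε / 2 : ℝ≥0) + (volume Y - (ε / 2 : ℝ≥0))) + ε := by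
        have : (ε : ℝ≥0∞) = (ε / 2 : ℝ≥0) + (ε / 2 : ℝ≥0) := by
          rw [← ENNReal.coe_add, add_halves]
        rw [this]; ring
    _ ≤ _ := by gcongr

lemma lintegral_add_le_of_normalized {f g h : ℝ → ℝ} (hf : Measurable f) (hg : Measurable g)
    (hh : Measurable h) (hf0 : ∀ x, 0 ≤ f x) (hg0 : ∀ x, 0 ≤ g x) (hh0 : ∀ x, 0 ≤ h x)
    (hf1 : ∀ x, f x ≤ 1) (hg1 : ∀ x, g x ≤ 1)
    (hfs : ∀ s < 1, ∃ x, s < f x) (hgs : ∀ s < 1, ∃ x, s < g x)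
    (hfgh : ∀ s, 0 < s → ∀ x y, s < f x → s < g y → s < h (x + y)) :
    (∫⁻ x, ENNReal.ofReal (f x)) + ∫⁻ x, ENNReal.ofReal (g x) ≤
      ∫⁻ x, ENNReal.ofReal (h x) := by
  rw [lintegral_eq_lintegral_meas_lt _ (ae_of_all _ hf0) hf.aemeasurable,
    lintegral_eq_lintegral_meas_lt _ (ae_of_all _ hg0) hg.aemeasurable,
    lintegral_eq_lintegral_meas_lt _ (ae_of_all _ hh0) hh.aemeasurable]
  have hanti : ∀ F : ℝ → ℝ, Measurable fun t : ℝ => volume {a : ℝ | t < F a} := fun F =>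
    Antitone.measurable (fun s t hst => measure_mono fun a ha => lt_of_le_of_lt hst ha)
  rw [← lintegral_add_left (hanti f)]
  refine setLIntegral_mono (hanti h) fun s hs => ?_
  rcases lt_or_ge s 1 with h1 | h1
  · have : {a | s < f a} + {a | s < g a} ⊆ {a | s < h a} := by
      rintro z ⟨x, hx, y, hy, rfl⟩
      exact hfgh s hs x y hx hy
    exact (volume_add_le_volume_add (measurableSet_lt measurable_const hf)
      (measurableSet_lt measurable_const hg) (hfs s h1) (hgs s h1)).trans (measure_mono this)
  · have e1 : {a | s < f a} = ∅ := by
      ext a; simpa using (hf1 a).trans h1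
    have e2 : {a | s < g a} = ∅ := by
      ext a; simpa using (hg1 a).trans h1
    simp [e1, e2]

lemma exists_section_le {A : Set (ℝ × ℝ)} (hAb : Bornology.IsBounded A) :
    ∃ L : ℝ, ∀ x, volume (Prod.mk x ⁻¹' A) ≤ ENNReal.ofReal L := by
  obtain ⟨r, hr⟩ := hAb.subset_closedBall 0
  refine ⟨2 * r, fun x => ?_⟩
  rw [← Real.volume_closedBall (0 : ℝ) r]
  refine measure_mono fun y hy => ?_
  have h := hr hy
  rw [mem_closedBall, Prod.dist_eq] at h
  exact (le_max_right _ _).trans h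

lemma ofReal_mul_lintegral_section {A : Set (ℝ × ℝ)} (hA : MeasurableSet A)
    (hAb : Bornology.IsBounded A) {c : ℝ} (hc : 0 < c) :
    ∫⁻ x, ENNReal.ofReal ((volume (Prod.mk x ⁻¹' A)).toReal / c) =
      ENNReal.ofReal ((volume A).toReal / c) := by
  obtain ⟨L, hL⟩ := exists_section_le hAb
  have hAfin : volume A ≠ ⊤ := hAb.measure_lt_top.ne
  have : ∀ x, ENNReal.ofReal ((volume (Prod.mk x ⁻¹' A)).toReal / c) =
      volume (Prod.mk x ⁻¹' A) / ENNReal.ofReal c := by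
    intro x
    rw [ENNReal.ofReal_div_of_pos hc, ENNReal.ofReal_toReal]
    exact ((hL x).trans_lt ENNReal.ofReal_lt_top).ne
  simp_rw [this, div_eq_mul_inv]
  rw [lintegral_mul_const _ (measurable_measure_prodMk_left hA), ← Measure.prod_apply hA,
    ← div_eq_mul_inv, ← Measure.volume_eq_prod, ← div_eq_mul_inv, ENNReal.ofReal_div_of_pos hc,
    ENNReal.ofReal_toReal hAfin]

lemma exists_section_sup {A : Set (ℝ × ℝ)} (hA : MeasurableSet A)
    (hAb : Bornology.IsBounded A) (hpos : 0 < (volume A).toReal) :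
    ∃ F : ℝ, 0 < F ∧ (∀ x, (volume (Prod.mk x ⁻¹' A)).toReal / F ≤ 1) ∧
      ∀ s < 1, ∃ x, s < (volume (Prod.mk x ⁻¹' A)).toReal / F := by
  obtain ⟨L, hL⟩ := exists_section_le hAb
  have hbdd : BddAbove (range fun x => (volume (Prod.mk x ⁻¹' A)).toReal) := by
    refine ⟨(ENNReal.ofReal L).toReal, ?_⟩
    rintro _ ⟨x, rfl⟩
    exact ENNReal.toReal_mono ENNReal.ofReal_ne_top (hL x)
  have hF : 0 < ⨆ x, (volume (Prod.mk x ⁻¹' A)).toReal := by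
    by_contra hcon
    have h0 : ∀ x, (volume (Prod.mk x ⁻¹' A)).toReal ≤ 0 := fun x =>
      (le_ciSup hbdd x).trans (not_lt.mp hcon)
    have := ofReal_mul_lintegral_section hA hAb one_pos
    simp only [div_one] at this
    rw [lintegral_congr (fun x => ENNReal.ofReal_of_nonpos (h0 x)), lintegral_zero] at this
    have h1 := ENNReal.ofReal_eq_zero.mp this.symm
    linarith
  refine ⟨_, hF, fun x => ?_, fun s hs => ?_⟩
  · rw [div_le_one hF]; exact le_ciSup hbdd x
  · obtain ⟨x, hx⟩ := exists_lt_of_lt_ciSup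
      (show s * (⨆ x, (volume (Prod.mk x ⁻¹' A)).toReal) < ⨆ x, _ by nlinarith)
    exact ⟨x, by rwa [lt_div_iff₀ hF]⟩

/-- The Brunn–Minkowski inequality in the plane. -/
lemma brunnMinkowski_plane {A B C : Set (ℝ × ℝ)} (hA : MeasurableSet A) (hB : MeasurableSet B)
    (hC : MeasurableSet C) (hAb : Bornology.IsBounded A) (hBb : Bornology.IsBounded B)
    (hCb : Bornology.IsBounded C) (hABC : A + B ⊆ C) (hA0 : 0 < (volume A).toReal)
    (hB0 : 0 < (volume B).toReal) :
    (volume A).toReal + (volume B).toReal + 2 * √((volume A).toReal * (volume B).toReal) ≤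
      (volume C).toReal := by
  obtain ⟨F, hF, hF1, hFs⟩ := exists_section_sup hA hAb hA0
  obtain ⟨G, hG, hG1, hGs⟩ := exists_section_sup hB hBb hB0
  obtain ⟨L, hL⟩ := exists_section_le hCb
  have hmeas : ∀ {D : Set (ℝ × ℝ)} (c : ℝ), MeasurableSet D →
      Measurable fun x => (volume (Prod.mk x ⁻¹' D)).toReal / c := fun c hD =>
    ((measurable_measure_prodMk_left hD).ennreal_toReal).div_const c
  have key := lintegral_add_le_of_normalized (hmeas F hA) (hmeas G hB) (hmeas (F + G) hC)
    (fun x => by positivity) (fun x => by positivity) (fun x => by positivity) hF1 hG1 hFs hGs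
    (by
      intro s hs x y hx hy
      have hAx : 0 < (volume (Prod.mk x ⁻¹' A)).toReal := by
        have := hs.trans hx
        exact (div_pos_iff_of_pos_right hF).mp this
      have hBy : 0 < (volume (Prod.mk y ⁻¹' B)).toReal := by
        have := hs.trans hy
        exact (div_pos_iff_of_pos_right hG).mp this
      have hsub : (Prod.mk x ⁻¹' A) + (Prod.mk y ⁻¹' B) ⊆ Prod.mk (x + y) ⁻¹' C := by
        rintro _ ⟨a, ha, b, hb, rfl⟩
        exact hABC (Set.add_mem_add (a := (x, a)) (b := (y, b)) ha hb)
      have hCfin : volume (Prod.mk (x + y) ⁻¹' C) ≠ ⊤ :=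
        ((hL (x + y)).trans_lt ENNReal.ofReal_lt_top).ne
      have h1 := (volume_add_le_volume_add (measurable_prodMk_left hA)
        (measurable_prodMk_left hB)
        (nonempty_of_measure_ne_zero (ENNReal.toReal_pos_iff.mp hAx).1.ne')
        (nonempty_of_measure_ne_zero (ENNReal.toReal_pos_iff.mp hBy).1.ne')).trans
        (measure_mono hsub)
      have h2 := ENNReal.toReal_mono hCfin h1
      rw [ENNReal.toReal_add (ENNReal.toReal_pos_iff.mp hAx).2.ne
        (ENNReal.toReal_pos_iff.mp hBy).2.ne] at h2
      rw [lt_div_iff₀ hF] at hx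
      rw [lt_div_iff₀ hG] at hy
      rw [lt_div_iff₀ (by positivity)]
      linarith)
  rw [ofReal_mul_lintegral_section hA hAb hF, ofReal_mul_lintegral_section hB hBb hG,
    ofReal_mul_lintegral_section hC hCb (by positivity), ← ENNReal.ofReal_add (by positivity)
    (by positivity), ENNReal.ofReal_le_ofReal_iff (by positivity),
    le_div_iff₀ (by positivity)] at key
  refine le_trans ?_ key
  set a := (volume A).toReal
  set b := (volume B).toReal
  have e : (a / F + b / G) * (F + G) = a + b + (a * G / F + b * F / G) := by
    field_simp; ring
  rw [e]
  have h3 : √(a * b) ^ 2 = a * b := Real.sq_sqrt (by positivity)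
  have h4 : √(a * b) ^ 2 = (a * G / F) * (b * F / G) := by rw [h3]; field_simp
  have hu : 0 ≤ a * G / F := by positivity
  have hv : 0 ≤ b * F / G := by positivity
  nlinarith [abs_le_of_sq_le_sq' (show (2 * √(a * b)) ^ 2 ≤ (a * G / F + b * F / G) ^ 2 by
    nlinarith [sq_nonneg (a * G / F - b * F / G)]) (by positivity)]

/-- First-order form of the Brunn–Minkowski inequality for neighbourhoods of a planar set. -/
lemma volume_add_le_volume_thickening {A : Set (EuclideanSpace ℝ (Fin 2))} (hA : MeasurableSet A)
    (hAb : Bornology.IsBounded A) {ε : ℝ} (hε : 0 < ε) :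
    (volume A).toReal + ε * √(4 * π * (volume A).toReal) ≤ (volume (thickening ε A)).toReal := by
  have hTb : Bornology.IsBounded (thickening ε A) := hAb.thickening
  have hTfin : volume (thickening ε A) ≠ ⊤ := hTb.measure_lt_top.ne
  rcases (ENNReal.toReal_nonneg (a := volume A)).eq_or_lt with h0 | h0
  · rw [← h0]; simp
  let T : EuclideanSpace ℝ (Fin 2) ≃ᵐ ℝ × ℝ :=
    (MeasurableEquiv.toLp 2 (Fin 2 → ℝ)).symm.trans (MeasurableEquiv.finTwoArrow (α := ℝ))
  have hT : MeasurePreserving T volume volume :=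
    (EuclideanSpace.volume_preserving_symm_measurableEquiv_toLp (Fin 2)).trans
      (volume_preserving_finTwoArrow ℝ)
  have hTapp : ∀ x, T x = (x 0, x 1) := fun x => rfl
  have hvol : ∀ D : Set (EuclideanSpace ℝ (Fin 2)), volume (T '' D) = volume D := by
    intro D
    rw [T.image_eq_preimage_symm]
    exact (hT.symm T).measure_preimage_equiv D
  have hbd : ∀ D : Set (EuclideanSpace ℝ (Fin 2)), Bornology.IsBounded D →
      Bornology.IsBounded (T '' D) := by
    intro D hD
    obtain ⟨r, hr⟩ := hD.subset_closedBall 0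
    refine (isBounded_closedBall (x := (0 : ℝ × ℝ)) (r := r)).subset ?_
    rintro _ ⟨x, hx, rfl⟩
    have h := hr hx
    rw [mem_closedBall_zero_iff] at h ⊢
    rw [hTapp, Prod.norm_def]
    exact max_le ((PiLp.norm_apply_le x 0).trans h) ((PiLp.norm_apply_le x 1).trans h)
  have hms : ∀ D : Set (EuclideanSpace ℝ (Fin 2)), MeasurableSet D → MeasurableSet (T '' D) :=
    fun D hD => T.measurableSet_image.mpr hD
  have hsub : T '' A + T '' (ball 0 ε) ⊆ T '' (thickening ε A) := by
    rintro _ ⟨_, ⟨a, ha, rfl⟩, _, ⟨b, hb, rfl⟩, rfl⟩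
    refine ⟨a + b, ?_, by simp [hTapp]⟩
    rw [mem_thickening_iff]
    exact ⟨a, ha, by simpa using hb⟩
  have hball : (volume (ball (0 : EuclideanSpace ℝ (Fin 2)) ε)).toReal = π * ε ^ 2 := by
    rw [EuclideanSpace.volume_ball_fin_two]
    simp [ENNReal.toReal_mul, hε.le, mul_comm, Real.pi_pos.le]
  have := brunnMinkowski_plane (hms _ hA) (hms _ measurableSet_ball)
    (hms _ isOpen_thickening.measurableSet) (hbd _ hAb) (hbd _ isBounded_ball) (hbd _ hTb) hsub
    (by rwa [hvol]) (by rw [hvol, hball]; positivity)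
  rw [hvol, hvol, hvol, hball] at this
  have e : ε * √(4 * π * (volume A).toReal) = 2 * √((volume A).toReal * (π * ε ^ 2)) := by
    generalize (volume A).toReal = m
    have e1 : √(m * (π * ε ^ 2)) = √(π * m) * ε := by
      rw [show m * (π * ε ^ 2) = (π * m) * ε ^ 2 by ring, Real.sqrt_mul' _ (sq_nonneg ε),
        Real.sqrt_sq hε.le]
    have e2 : √(4 * π * m) = √(π * m) * 2 := by
      rw [show 4 * π * m = (π * m) * 2 ^ 2 by ring, Real.sqrt_mul' _ (sq_nonneg 2),
        Real.sqrt_sq (by norm_num)]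
    rw [e1, e2]
    ring
  rw [e]
  nlinarith [show 0 ≤ π * ε ^ 2 by positivity]

/-- An isoperimetric inequality in functional form, for `C¹` functions with compact support. -/
lemma lintegral_sqrt_superlevel_le {g : EuclideanSpace ℝ (Fin 2) → ℝ} (hg : ContDiff ℝ 1 g)
    (hgc : HasCompactSupport g) (hg0 : ∀ x, 0 ≤ g x) :
    ∫⁻ t in Ioi (0 : ℝ), ENNReal.ofReal √(4 * π * (volume {x | t < g x}).toReal) ≤
      ∫⁻ x, ENNReal.ofReal ‖fderiv ℝ g x‖ := by
  set S := ∫⁻ t in Ioi (0 : ℝ), ENNReal.ofReal √(4 * π * (volume {x | t < g x}).toReal) with hS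
  set K := cthickening 1 (tsupport g) with hK
  have hKc : IsCompact K := hgc.cthickening
  have hKfin : volume K ≠ ⊤ := hKc.measure_lt_top.ne
  have hgi : ∫⁻ x, ENNReal.ofReal (g x) ≠ ⊤ := by
    have := (hg.continuous.integrable_of_hasCompactSupport hgc (μ := volume)).hasFiniteIntegral
    rw [hasFiniteIntegral_iff_ofReal (ae_of_all _ hg0)] at this
    exact this.ne
  have hDc : Continuous (fderiv ℝ g) := hg.continuous_fderiv one_ne_zero
  have hDu : UniformContinuous (fderiv ℝ g) :=
    (hgc.fderiv ℝ).uniformContinuous_of_continuous hDc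
  have hsb : ∀ t > 0, {x | t < g x} ⊆ tsupport g := fun t ht x hx =>
    subset_tsupport g (ne_of_gt (ht.trans hx))
  have hfin : ∀ t > 0, volume {x | t < g x} ≠ ⊤ := fun t ht =>
    ((measure_mono (hsb t ht)).trans_lt hgc.measure_lt_top).ne
  have hbdd : ∀ t > 0, Bornology.IsBounded {x | t < g x} := fun t ht =>
    hgc.isBounded.subset (hsb t ht)
  have key : ∀ δ : ℝ≥0, 0 < δ → S ≤ (∫⁻ x, ENNReal.ofReal ‖fderiv ℝ g x‖) + δ * volume K := by
    intro δ hδ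
    obtain ⟨ε₀, hε₀, hu⟩ := Metric.uniformContinuous_iff.mp hDu δ (by exact_mod_cast hδ)
    set ε := min ε₀ 1 with hεdef
    have hε : 0 < ε := lt_min hε₀ one_pos
    let G : EuclideanSpace ℝ (Fin 2) → ℝ := fun x =>
      g x + ε * (‖fderiv ℝ g x‖ + K.indicator (fun _ => (δ : ℝ)) x)
    have hind0 : ∀ x, 0 ≤ K.indicator (fun _ => (δ : ℝ)) x := fun x =>
      indicator_nonneg (fun _ _ => δ.2) x
    have hindm : Measurable (K.indicator (fun _ => (δ : ℝ))) :=
      measurable_const.indicator hKc.isClosed.measurableSet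
    have hGm : Measurable G :=
      hg.continuous.measurable.add ((hDc.norm.measurable.add hindm).const_mul _)
    have hG0 : ∀ x, 0 ≤ G x := fun x =>
      add_nonneg (hg0 x) (mul_nonneg hε.le (add_nonneg (norm_nonneg _) (hind0 x)))
    have hsub : ∀ t > 0, thickening ε {x | t < g x} ⊆ {x | t < G x} := by
      intro t ht x hx
      obtain ⟨y, hy, hxy⟩ := mem_thickening_iff.mp hx
      have hxK : x ∈ K := by
        refine mem_cthickening_of_dist_le x y 1 _ (hsb t ht hy) ?_
        exact hxy.le.trans (min_le_right _ _)
      have hmv : ‖g y - g x‖ ≤ (‖fderiv ℝ g x‖ + δ) * ‖y - x‖ := by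
        refine (convex_ball x ε).norm_image_sub_le_of_norm_fderiv_le (𝕜 := ℝ)
          (fun z _ => (hg.differentiable one_ne_zero) z) (fun z hz => ?_) (mem_ball_self hε)
          (by rwa [mem_ball, dist_comm])
        have h1 := hu (lt_of_lt_of_le (mem_ball.mp hz) (min_le_left _ _))
        rw [dist_eq_norm] at h1
        have h2 := norm_sub_norm_le (fderiv ℝ g z) (fderiv ℝ g x)
        linarith
      have h3 : g y - g x ≤ (‖fderiv ℝ g x‖ + δ) * ε := by
        have h4 : ‖y - x‖ ≤ ε := by rw [← dist_eq_norm, dist_comm]; exact hxy.le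
        refine (le_abs_self _).trans (hmv.trans ?_)
        gcongr
      have hy' : t < g y := hy
      have e : K.indicator (fun _ => (δ : ℝ)) x = δ := indicator_of_mem hxK _
      change t < g x + ε * (‖fderiv ℝ g x‖ + K.indicator (fun _ => (δ : ℝ)) x)
      rw [e]
      linarith
    have h1 : (∫⁻ x, ENNReal.ofReal (g x)) + ENNReal.ofReal ε * S ≤
        ∫⁻ x, ENNReal.ofReal (G x) := by
      rw [lintegral_eq_lintegral_meas_lt _ (ae_of_all _ hg0) hg.continuous.measurable.aemeasurable,
        lintegral_eq_lintegral_meas_lt _ (ae_of_all _ hG0) hGm.aemeasurable, hS,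
        ← lintegral_const_mul' _ _ ENNReal.ofReal_ne_top, ← lintegral_add_left]
      · have hm : Measurable fun t : ℝ => volume {a | t < G a} :=
          Antitone.measurable (fun s t hst => measure_mono fun a ha => lt_of_le_of_lt hst ha)
        refine setLIntegral_mono hm fun t ht => ?_
        have ht : 0 < t := ht
        refine le_trans ?_ (measure_mono (hsub t ht))
        have := volume_add_le_volume_thickening
          (measurableSet_lt measurable_const hg.continuous.measurable) (hbdd t ht) hε
        rw [← ENNReal.ofReal_mul hε.le, ← ENNReal.ofReal_toReal (hfin t ht),
          ← ENNReal.ofReal_add ENNReal.toReal_nonneg (by positivity), ENNReal.toReal_ofReal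
          ENNReal.toReal_nonneg]
        exact ENNReal.ofReal_le_of_le_toReal this
      · exact Antitone.measurable (fun s t hst => measure_mono fun a ha => lt_of_le_of_lt hst ha)
    have h2 : ∫⁻ x, ENNReal.ofReal (G x) = (∫⁻ x, ENNReal.ofReal (g x)) +
        ENNReal.ofReal ε * ((∫⁻ x, ENNReal.ofReal ‖fderiv ℝ g x‖) + δ * volume K) := by
      have e : ∀ x, ENNReal.ofReal (G x) = ENNReal.ofReal (g x) + ENNReal.ofReal ε *
          (ENNReal.ofReal ‖fderiv ℝ g x‖ + K.indicator (fun _ => (δ : ℝ≥0∞)) x) := by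
        intro x
        simp only [G]
        rw [ENNReal.ofReal_add (hg0 x) (mul_nonneg hε.le (add_nonneg (norm_nonneg _) (hind0 x))),
          ENNReal.ofReal_mul hε.le, ENNReal.ofReal_add (norm_nonneg _) (hind0 x)]
        congr 3
        by_cases hx : x ∈ K <;> simp [hx]
      simp_rw [e]
      rw [lintegral_add_left hg.continuous.measurable.ennreal_ofReal,
        lintegral_const_mul' _ _ ENNReal.ofReal_ne_top,
        lintegral_add_left hDc.norm.measurable.ennreal_ofReal,
        lintegral_indicator_const hKc.isClosed.measurableSet]
    rw [h2] at h1
    have h3 := (ENNReal.add_le_add_iff_left hgi).mp h1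
    exact (ENNReal.mul_le_mul_iff_right (ENNReal.ofReal_pos.mpr hε).ne' ENNReal.ofReal_ne_top).mp h3
  refine ENNReal.le_of_forall_pos_le_add fun η hη hlt => ?_
  have hKt : volume K = ((volume K).toNNReal : ℝ≥0∞) := (ENNReal.coe_toNNReal hKfin).symm
  refine (key (η / ((volume K).toNNReal + 1)) (by positivity)).trans ?_
  gcongr
  rw [hKt, ENNReal.toNNReal_coe, ← ENNReal.coe_mul]
  norm_cast
  rw [div_mul_eq_mul_div, div_le_iff₀ (by positivity)]
  gcongr
  exact le_self_add

abbrev Plane := EuclideanSpace ℝ (Fin 2)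

/-- Extension by zero of a function vanishing off a compact subset of an open set. -/
lemma contDiff_indicator {F : Type*} [NormedAddCommGroup F] [NormedSpace ℝ F]
    {Ω K : Set Plane} {n : WithTop ℕ∞} {f : Plane → F} (hΩ : IsOpen Ω) (hK : IsCompact K)
    (hKΩ : K ⊆ Ω) (hf : ContDiffOn ℝ n f Ω) (h0 : ∀ x ∈ Ω, x ∉ K → f x = 0) :
    ContDiff ℝ n (Ω.indicator f) ∧ HasCompactSupport (Ω.indicator f) ∧
      tsupport (Ω.indicator f) ⊆ K := by
  have hz : ∀ x, x ∉ K → Ω.indicator f x = 0 := fun x hx => by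
    by_cases hxΩ : x ∈ Ω
    · rw [indicator_of_mem hxΩ, h0 x hxΩ hx]
    · exact indicator_of_notMem hxΩ _
  have hsupp : tsupport (Ω.indicator f) ⊆ K :=
    closure_minimal (fun x hx => by_contra fun h => hx (hz x h)) hK.isClosed
  refine ⟨contDiff_iff_contDiffAt.mpr fun x => ?_, HasCompactSupport.intro hK hz, hsupp⟩
  by_cases hx : x ∈ Ω
  · refine (hf.contDiffAt (hΩ.mem_nhds hx)).congr_of_eventuallyEq ?_
    filter_upwards [hΩ.mem_nhds hx] with y hy using indicator_of_mem hy _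
  · have : Kᶜ ∈ 𝓝 x := hK.isClosed.isOpen_compl.mem_nhds fun h => hx (hKΩ h)
    refine contDiffAt_const (c := (0 : F)) |>.congr_of_eventuallyEq ?_
    filter_upwards [this] with y hy using hz y hy

/-- Divergence theorem, one component, for compactly supported functions. -/
lemma integral_fderiv_eq_zero {g : Plane → ℝ} (hg : ContDiff ℝ 1 g) (hgc : HasCompactSupport g)
    (e : Plane) : ∫ x, fderiv ℝ g x e = 0 := by
  have hi : Integrable (fun x => fderiv ℝ g x e) :=
    ((hg.continuous_fderiv one_ne_zero).clm_apply continuous_const).integrable_of_hasCompactSupport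
      (hgc.fderiv_apply ℝ e)
  have := integral_mul_fderiv_eq_neg_fderiv_mul_of_integrable (𝕜 := ℝ) (μ := (volume : Measure Plane))
    (f := fun _ => (1 : ℝ)) (g := g) (v := e) (by simp) (by simpa using hi)
    (by simpa using hg.continuous.integrable_of_hasCompactSupport hgc) (by fun_prop)
    (fun x _ => (hg.differentiable one_ne_zero) x)
  simpa using this

/-- Superlevel sets of a function which is nonpositive on the frontier are compact. -/
lemma isCompact_superlevel {Ω : Set Plane} {u : Plane → ℝ} (hΩ : IsOpen Ω)
    (hb : Bornology.IsBounded Ω) (hu : ContinuousOn u (closure Ω))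
    (hf : ∀ x ∈ frontier Ω, u x ≤ 0) {s : ℝ} (hs : 0 < s) : IsCompact (Ω ∩ {x | s ≤ u x}) := by
  have e : Ω ∩ {x | s ≤ u x} = closure Ω ∩ u ⁻¹' (Ici s) := by
    ext x
    refine ⟨fun h => ⟨subset_closure h.1, h.2⟩, fun h => ⟨?_, h.2⟩⟩
    by_contra hx
    have h1 := hf x ⟨h.1, by rwa [hΩ.interior_eq]⟩
    have h2 : s ≤ u x := h.2
    linarith
  rw [e]
  exact (isCompact_of_isClosed_isBounded isClosed_closure hb.closure).of_isClosed_subset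
    (hu.preimage_isClosed_of_isClosed isClosed_closure isClosed_Ici) inter_subset_left

/-- The squared norm of the differential in coordinates. -/
lemma norm_sq_clm (L : Plane →L[ℝ] ℝ) :
    ‖L‖ ^ 2 = ∑ i : Fin 2, L (EuclideanSpace.single i 1) ^ 2 := by
  obtain ⟨y, rfl⟩ := (InnerProductSpace.toDual ℝ Plane).surjective L
  rw [LinearIsometryEquiv.norm_map, EuclideanSpace.norm_sq_eq]
  simp [EuclideanSpace.inner_single_right]

/-- A function on an open bounded set which is continuous up to the boundary, nonpositive there,
twice continuously differentiable and superharmonic inside. -/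
structure SuperH (Ω : Set Plane) (u : Plane → ℝ) : Prop where
  isOpen : IsOpen Ω
  meas : Measurable u
  bdd : Bornology.IsBounded Ω
  contOn : ContinuousOn u (closure Ω)
  smooth : ContDiffOn ℝ 2 u Ω
  bdry : ∀ x ∈ frontier Ω, u x ≤ 0
  super : ∀ x ∈ Ω, 0 ≤ -lap u x

namespace SuperH
variable {Ω : Set Plane} {u : Plane → ℝ}

lemma isCompact_superlevel (h : SuperH Ω u) {s : ℝ} (hs : 0 < s) :
    IsCompact (Ω ∩ {x | s ≤ u x}) :=
  _root_.isCompact_superlevel h.isOpen h.bdd h.contOn h.bdry hs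

lemma contDiffOn_fderiv (h : SuperH Ω u) : ContDiffOn ℝ 1 (fderiv ℝ u) Ω :=
  h.smooth.fderiv_of_isOpen h.isOpen (by norm_num)

lemma continuousOn_lap (h : SuperH Ω u) : ContinuousOn (lap u) Ω := by
  unfold lap
  refine continuousOn_finsetSum _ fun i _ => ?_
  have : ContDiffOn ℝ 1 (fun y => fderiv ℝ u y (EuclideanSpace.single i 1)) Ω :=
    h.contDiffOn_fderiv.clm_apply contDiffOn_const
  exact (this.continuousOn_fderiv_of_isOpen h.isOpen le_rfl).clm_apply continuousOn_const

lemma integral_energy (h : SuperH Ω u) {φ : ℝ → ℝ} (hφ : ContDiff ℝ 1 φ) {s : ℝ} (hs : 0 < s)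
    (h0 : ∀ t ≤ s, φ t = 0) :
    ∫ x in Ω, deriv φ (u x) * ‖fderiv ℝ u x‖ ^ 2 = ∫ x in Ω, φ (u x) * (-lap u x) := by
  set K := Ω ∩ {x | s ≤ u x} with hK
  have hKc : IsCompact K := h.isCompact_superlevel hs
  have hz : ∀ x ∈ Ω, x ∉ K → φ (u x) = 0 := fun x hx hxK => by
    refine h0 _ (le_of_lt ?_)
    by_contra hc
    exact hxK ⟨hx, not_lt.mp hc⟩
  have hd0 : ∀ t < s, deriv φ t = 0 := fun t ht => by
    have : φ =ᶠ[𝓝 t] fun _ => 0 := by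
      filter_upwards [Iio_mem_nhds ht] with r hr using h0 r (le_of_lt hr)
    rw [this.deriv_eq, deriv_const]
  have hdz : ∀ x ∈ Ω, x ∉ K → deriv φ (u x) = 0 := fun x hx hxK => by
    refine hd0 _ ?_
    by_contra hc
    exact hxK ⟨hx, not_lt.mp hc⟩
  let e : Fin 2 → Plane := fun i => EuclideanSpace.single i 1
  let X : Fin 2 → Plane → ℝ := fun i x => φ (u x) * fderiv ℝ u x (e i)
  have hX : ∀ i, ContDiffOn ℝ 1 (X i) Ω := fun i =>
    (hφ.comp_contDiffOn (h.smooth.of_le (by norm_num))).mul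
      (h.contDiffOn_fderiv.clm_apply contDiffOn_const)
  have hXi := fun i => contDiff_indicator h.isOpen hKc inter_subset_left (hX i)
    (fun x hx hxK => by simp [X, hz x hx hxK])
  have hsum : ∑ i, ∫ x, fderiv ℝ (Ω.indicator (X i)) x (e i) = 0 :=
    Finset.sum_eq_zero fun i _ => integral_fderiv_eq_zero (hXi i).1 (hXi i).2.1 _
  rw [← integral_finsetSum] at hsum
  swap
  · exact fun i _ => (((hXi i).1.continuous_fderiv one_ne_zero).clm_apply
      continuous_const).integrable_of_hasCompactSupport ((hXi i).2.1.fderiv_apply ℝ _)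
  have hpt : (fun x => ∑ i, fderiv ℝ (Ω.indicator (X i)) x (e i)) =
      Ω.indicator (fun x => deriv φ (u x) * ‖fderiv ℝ u x‖ ^ 2 + φ (u x) * lap u x) := by
    ext x
    by_cases hx : x ∈ Ω
    · rw [indicator_of_mem hx]
      have hnh := h.isOpen.mem_nhds hx
      have hux : DifferentiableAt ℝ u x := (h.smooth.contDiffAt hnh).differentiableAt (by norm_num)
      have hdx : DifferentiableAt ℝ (fderiv ℝ u) x :=
        (h.contDiffOn_fderiv.contDiffAt hnh).differentiableAt (by norm_num)
      have hφx : DifferentiableAt ℝ φ (u x) := hφ.differentiable one_ne_zero _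
      have h1 : ∀ i, fderiv ℝ (Ω.indicator (X i)) x (e i) =
          deriv φ (u x) * fderiv ℝ u x (e i) ^ 2 +
            φ (u x) * fderiv ℝ (fun y => fderiv ℝ u y (e i)) x (e i) := by
        intro i
        have : Ω.indicator (X i) =ᶠ[𝓝 x] X i := by
          filter_upwards [hnh] with y hy using indicator_of_mem hy _
        rw [this.fderiv_eq]
        have h2 : HasFDerivAt (fun y => φ (u y)) (deriv φ (u x) • fderiv ℝ u x) x :=
          hφx.hasDerivAt.comp_hasFDerivAt x hux.hasFDerivAt
        have h3 : HasFDerivAt (fun y => fderiv ℝ u y (e i))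
            (fderiv ℝ (fun y => fderiv ℝ u y (e i)) x) x :=
          (hdx.clm_apply (differentiableAt_const _)).hasFDerivAt
        have h4 : HasFDerivAt (X i) _ x := h2.mul h3
        rw [h4.fderiv]
        simp
        ring
      simp_rw [h1]
      rw [Finset.sum_add_distrib, ← Finset.mul_sum, ← Finset.mul_sum, norm_sq_clm]
      rfl
    · rw [indicator_of_notMem hx]
      refine Finset.sum_eq_zero fun i _ => ?_
      have : x ∉ tsupport (fderiv ℝ (Ω.indicator (X i))) := fun hc =>
        hx (((hXi i).2.2 (tsupport_fderiv_subset ℝ hc)).1)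
      rw [image_eq_zero_of_notMem_tsupport this]
      simp
  rw [hpt, integral_indicator h.isOpen.measurableSet, integral_add] at hsum
  · have : ∫ x in Ω, φ (u x) * (-lap u x) = -∫ x in Ω, φ (u x) * lap u x := by
      rw [← integral_neg]; simp
    rw [this]; linarith
  · refine IntegrableOn.of_forall_sdiff_eq_zero (s := K) ?_ h.isOpen.measurableSet ?_
    · refine ContinuousOn.integrableOn_compact hKc ?_
      have := (h.smooth.continuousOn).mono (inter_subset_left : K ⊆ Ω)
      exact ((hφ.continuous_deriv le_rfl).comp_continuousOn this).mul
        ((h.contDiffOn_fderiv.continuousOn.mono inter_subset_left).norm.pow 2)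
    · intro x hx
      simp [hdz x hx.1 hx.2]
  · refine IntegrableOn.of_forall_sdiff_eq_zero (s := K) ?_ h.isOpen.measurableSet ?_
    · refine ContinuousOn.integrableOn_compact hKc ?_
      have := (h.smooth.continuousOn).mono (inter_subset_left : K ⊆ Ω)
      exact (hφ.continuous.comp_continuousOn this).mul (h.continuousOn_lap.mono inter_subset_left)
    · intro x hx
      simp [hz x hx.1 hx.2]

end SuperH

/-- The primitive, vanishing on `(-∞, s]`, of a continuous function vanishing there. -/
lemma primitive_facts {χ : ℝ → ℝ} (hχ : Continuous χ) {s : ℝ} (h0 : ∀ t ≤ s, χ t = 0) :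
    ContDiff ℝ 1 (fun t => ∫ r in s..t, χ r) ∧ (∀ t, deriv (fun t => ∫ r in s..t, χ r) t = χ t) ∧
      ∀ t ≤ s, ∫ r in s..t, χ r = 0 := by
  have hd : ∀ t, deriv (fun t => ∫ r in s..t, χ r) t = χ t := fun t =>
    hχ.deriv_integral χ s t
  refine ⟨contDiff_one_iff_deriv.mpr ⟨fun t => ?_, ?_⟩, hd, fun t ht => ?_⟩
  · exact (hχ.integral_hasStrictDerivAt s t).hasDerivAt.differentiableAt
  · rw [funext hd]; exact hχ
  · rw [intervalIntegral.integral_symm, intervalIntegral.integral_of_le ht, neg_eq_zero]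
    exact setIntegral_eq_zero_of_forall_eq_zero fun x hx => h0 x hx.2

lemma ofReal_primitive {χ : ℝ → ℝ} (hχ : Continuous χ) {s : ℝ} (hs : 0 < s)
    (h0 : ∀ t ≤ s, χ t = 0) (hn : ∀ t, 0 ≤ χ t) (y : ℝ) :
    ENNReal.ofReal (∫ r in s..y, χ r) =
      ∫⁻ t in Ioi (0 : ℝ), (Iio y).indicator (fun t => ENNReal.ofReal (χ t)) t := by
  have e : ∫⁻ t in Ioi (0 : ℝ), (Iio y).indicator (fun t => ENNReal.ofReal (χ t)) t =
      ∫⁻ t in Ioc s y, ENNReal.ofReal (χ t) := by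
    rw [← lintegral_indicator measurableSet_Ioi, restrict_Ioo_eq_restrict_Ioc.symm,
      ← lintegral_indicator measurableSet_Ioo]
    congr 1
    ext t
    by_cases h1 : s < t
    · have h2 : 0 < t := hs.trans h1
      by_cases h3 : t < y <;> simp [indicator, h1, h2, h3]
    · simp [indicator, h1, h0 t (not_lt.mp h1)]
  rw [e]
  rcases le_total s y with hy | hy
  · rw [intervalIntegral.integral_of_le hy]
    exact ofReal_integral_eq_lintegral_ofReal
      ((hχ.integrableOn_Icc (a := s) (b := y)).mono_set Ioc_subset_Icc_self) (ae_of_all _ hn)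
  · rw [(primitive_facts hχ h0).2.2 y hy, Ioc_eq_empty (not_lt.mpr hy)]
    simp

/-- Continuous approximation from below of the indicator of `(s, ∞)`. -/
def ramp (s : ℝ) (n : ℕ) (t : ℝ) : ℝ := min 1 (max 0 (n * (t - s)))

lemma continuous_ramp (s : ℝ) (n : ℕ) : Continuous (ramp s n) := by
  unfold ramp; fun_prop

lemma ramp_nonneg (s : ℝ) (n : ℕ) (t : ℝ) : 0 ≤ ramp s n t :=
  le_min zero_le_one (le_max_left _ _)

lemma ramp_le_one (s : ℝ) (n : ℕ) (t : ℝ) : ramp s n t ≤ 1 := min_le_left _ _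

lemma ramp_of_le {s t : ℝ} (n : ℕ) (h : t ≤ s) : ramp s n t = 0 := by
  unfold ramp
  rw [max_eq_left (mul_nonpos_of_nonneg_of_nonpos n.cast_nonneg (sub_nonpos.mpr h))]
  simp

lemma ramp_mono (s t : ℝ) : Monotone fun n => ramp s n t := by
  intro m n hmn
  rcases le_total t s with h | h
  · simp [ramp_of_le _ h]
  · change ramp s m t ≤ ramp s n t
    unfold ramp
    have := sub_nonneg.mpr h
    gcongr

lemma tendsto_ramp (s t : ℝ) : Tendsto (fun n => ramp s n t) atTop
    (𝓝 ((Ioi s).indicator (fun _ => (1 : ℝ)) t)) := by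
  by_cases h : s < t
  · rw [indicator_of_mem (show t ∈ Ioi s from h)]
    obtain ⟨N, hN⟩ := exists_nat_gt (1 / (t - s))
    refine tendsto_const_nhds.congr' ?_
    filter_upwards [eventually_ge_atTop N] with n hn
    have h1 : 1 ≤ (n : ℝ) * (t - s) := by
      rw [div_lt_iff₀ (sub_pos.mpr h)] at hN
      have : (N : ℝ) ≤ n := by exact_mod_cast hn
      nlinarith [sub_pos.mpr h]
    unfold ramp
    rw [min_eq_left (h1.trans (le_max_right _ _))]
  · rw [indicator_of_notMem (show t ∉ Ioi s from h)]
    simp [ramp_of_le _ (not_lt.mp h)]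

lemma tendsto_lintegral_ramp (ν : Measure ℝ) (s : ℝ) :
    Tendsto (fun n => ∫⁻ t, ENNReal.ofReal (ramp s n t) ∂ν) atTop (𝓝 (ν (Ioi s))) := by
  have e : ν (Ioi s) = ∫⁻ t, ENNReal.ofReal ((Ioi s).indicator (fun _ => (1 : ℝ)) t) ∂ν := by
    rw [← lintegral_indicator_one measurableSet_Ioi]
    congr 1
    ext t
    by_cases h : s < t <;> simp [h]
  rw [e]
  refine lintegral_tendsto_of_tendsto_of_monotone
    (fun n => (continuous_ramp s n).measurable.ennreal_ofReal.aemeasurable)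
    (ae_of_all _ fun t m n hmn => ENNReal.ofReal_le_ofReal (ramp_mono s t hmn))
    (ae_of_all _ fun t => (ENNReal.continuous_ofReal.tendsto _).comp (tendsto_ramp s t))

/-- Finite measures on `ℝ` concentrated on `(0, ∞)` are determined by the values on `(s, ∞)`. -/
lemma measure_eq_of_Ioi {ν κ : Measure ℝ} [IsFiniteMeasure ν]
    (h : ∀ s > 0, ν (Ioi s) = κ (Ioi s)) (hν : ν (Iic 0) = 0) (hκ : κ (Iic 0) = 0) : ν = κ := by
  have hlim : ∀ ρ : Measure ℝ, Tendsto (fun n : ℕ => ρ (Ioi (1 / ((n : ℝ) + 1)))) atTop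
      (𝓝 (ρ (Ioi 0))) := by
    intro ρ
    have : Ioi (0 : ℝ) = ⋃ n : ℕ, Ioi (1 / ((n : ℝ) + 1)) := by
      ext t
      simp only [mem_Ioi, mem_iUnion]
      exact ⟨fun ht => exists_nat_one_div_lt ht, fun ⟨n, hn⟩ => lt_trans (by positivity) hn⟩
    rw [this]
    refine tendsto_measure_iUnion_atTop fun m n hmn => Ioi_subset_Ioi ?_
    gcongr
  have h00 : ν (Ioi 0) = κ (Ioi 0) := tendsto_nhds_unique (hlim ν)
    ((hlim κ).congr fun n => (h _ (by positivity)).symm)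
  have huniv : ∀ ρ : Measure ℝ, ρ (Iic 0) = 0 → ∀ a ≤ 0, ρ (Ioi a) = ρ (Ioi 0) := by
    intro ρ hρ a ha
    refine le_antisymm ?_ (measure_mono (Ioi_subset_Ioi ha))
    calc ρ (Ioi a) ≤ ρ (Iic 0 ∪ Ioi 0) := measure_mono (by simp)
      _ ≤ _ := measure_union_le _ _
      _ = _ := by rw [hρ, zero_add]
  have hall : ∀ a, ν (Ioi a) = κ (Ioi a) := fun a => by
    rcases le_or_gt a 0 with ha | ha
    · rw [huniv ν hν a ha, huniv κ hκ a ha, h00]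
    · exact h a ha
  have hu : ∀ ρ : Measure ℝ, ρ (Iic 0) = 0 → ρ univ = ρ (Ioi 0) := by
    intro ρ hρ
    refine le_antisymm ?_ (measure_mono (subset_univ _))
    calc ρ univ ≤ ρ (Iic 0 ∪ Ioi 0) := measure_mono (by simp)
      _ ≤ _ := measure_union_le _ _
      _ = _ := by rw [hρ, zero_add]
  have hun : ν univ = κ univ := by rw [hu ν hν, hu κ hκ, h00]
  have : IsFiniteMeasure κ := ⟨by rw [← hun]; exact measure_lt_top ν univ⟩
  refine Measure.ext_of_Iic _ _ fun a => ?_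
  rw [← compl_Ioi, measure_compl measurableSet_Ioi (measure_ne_top _ _),
    measure_compl measurableSet_Ioi (measure_ne_top _ _), hun, hall]

namespace SuperH
variable {Ω : Set Plane} {u : Plane → ℝ}

/-- The mass of the Laplacian on superlevel sets. -/
def H (Ω : Set Plane) (u : Plane → ℝ) (t : ℝ) : ℝ≥0∞ :=
  ∫⁻ x in Ω ∩ {x | t < u x}, ENNReal.ofReal (-lap u x)

lemma measurable_lap (u : Plane → ℝ) : Measurable (lap u) := by
  unfold lap
  exact Finset.measurable_sum _ fun i _ => measurable_fderiv_apply_const ℝ _ _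

lemma integrableOn_of_continuousOn (h : SuperH Ω u) {s : ℝ} (hs : 0 < s) {f : Plane → ℝ}
    (hf : ContinuousOn f Ω) (h0 : ∀ x ∈ Ω, u x < s → f x = 0) : IntegrableOn f Ω := by
  refine IntegrableOn.of_forall_sdiff_eq_zero (s := Ω ∩ {x | s ≤ u x})
    ((hf.mono inter_subset_left).integrableOn_compact (h.isCompact_superlevel hs))
    h.isOpen.measurableSet fun x hx => h0 x hx.1 ?_
  by_contra hc
  exact hx.2 ⟨hx.1, not_lt.mp hc⟩

lemma lintegral_energy (h : SuperH Ω u) {χ : ℝ → ℝ} (hχ : Continuous χ) {s : ℝ} (hs : 0 < s)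
    (h0 : ∀ t ≤ s, χ t = 0) (hn : ∀ t, 0 ≤ χ t) :
    ∫⁻ x in Ω, ENNReal.ofReal (χ (u x)) * ENNReal.ofReal (‖fderiv ℝ u x‖ ^ 2) =
      ∫⁻ t in Ioi (0 : ℝ), ENNReal.ofReal (χ t) * H Ω u t := by
  obtain ⟨hφ, hd, hφ0⟩ := primitive_facts hχ h0
  have h1 := h.integral_energy hφ hs hφ0
  simp_rw [hd] at h1
  have huc : ContinuousOn u Ω := h.smooth.continuousOn
  have hφn : ∀ y, 0 ≤ ∫ r in s..y, χ r := fun y => by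
    rcases le_total s y with hy | hy
    · exact intervalIntegral.integral_nonneg hy fun t _ => hn t
    · exact (hφ0 y hy).ge
  have h2 : ∫⁻ x in Ω, ENNReal.ofReal (χ (u x)) * ENNReal.ofReal (‖fderiv ℝ u x‖ ^ 2) =
      ENNReal.ofReal (∫ x in Ω, χ (u x) * ‖fderiv ℝ u x‖ ^ 2) := by
    rw [ofReal_integral_eq_lintegral_ofReal]
    · simp_rw [ENNReal.ofReal_mul (hn _)]
    · exact h.integrableOn_of_continuousOn hs
        ((hχ.comp_continuousOn huc).mul (h.contDiffOn_fderiv.continuousOn.norm.pow 2))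
        fun x _ hx => by simp [h0 _ hx.le]
    · exact ae_of_all _ fun x => mul_nonneg (hn _) (sq_nonneg _)
  have h3 : ∫⁻ x in Ω, ENNReal.ofReal (∫ r in s..(u x), χ r) * ENNReal.ofReal (-lap u x) =
      ENNReal.ofReal (∫ x in Ω, (∫ r in s..(u x), χ r) * -lap u x) := by
    rw [ofReal_integral_eq_lintegral_ofReal]
    · simp_rw [ENNReal.ofReal_mul (hφn _)]
    · exact h.integrableOn_of_continuousOn hs
        ((hφ.continuous.comp_continuousOn huc).mul h.continuousOn_lap.neg)
        fun x _ hx => by simp [hφ0 _ hx.le]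
    · filter_upwards [self_mem_ae_restrict h.isOpen.measurableSet] with x hx using
        mul_nonneg (hφn _) (h.super x hx)
  rw [h2, h1, ← h3]
  have hlm : Measurable fun x => ENNReal.ofReal (-lap u x) := (measurable_lap u).neg.ennreal_ofReal
  have hmeas : Measurable fun z : Plane × ℝ =>
      (Iio (u z.1)).indicator (fun t => ENNReal.ofReal (χ t)) z.2 := by
    have : (fun z : Plane × ℝ => (Iio (u z.1)).indicator (fun t => ENNReal.ofReal (χ t)) z.2) =
        {z : Plane × ℝ | z.2 < u z.1}.indicator (fun z => ENNReal.ofReal (χ z.2)) := by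
      ext z; simp [indicator]
    rw [this]
    exact (hχ.measurable.comp measurable_snd).ennreal_ofReal.indicator
      (measurableSet_lt measurable_snd (h.meas.comp measurable_fst))
  calc _ = ∫⁻ x in Ω, ∫⁻ t in Ioi (0 : ℝ),
        (Iio (u x)).indicator (fun t => ENNReal.ofReal (χ t)) t * ENNReal.ofReal (-lap u x) := by
        refine lintegral_congr fun x => ?_
        rw [ofReal_primitive hχ hs h0 hn, lintegral_mul_const]
        exact hχ.measurable.ennreal_ofReal.indicator measurableSet_Iio
    _ = ∫⁻ t in Ioi (0 : ℝ), ∫⁻ x in Ω,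
        (Iio (u x)).indicator (fun t => ENNReal.ofReal (χ t)) t * ENNReal.ofReal (-lap u x) :=
        lintegral_lintegral_swap (hmeas.mul (hlm.comp measurable_fst)).aemeasurable
    _ = _ := by
        refine lintegral_congr fun t => ?_
        have hms : MeasurableSet {x | t < u x} := measurableSet_lt measurable_const h.meas
        rw [H, inter_comm, ← Measure.restrict_restrict hms, ← lintegral_indicator hms,
          ← lintegral_const_mul _ (hlm.indicator hms)]
        refine lintegral_congr fun x => ?_
        by_cases hx : t < u x <;> simp [hx]

/-- The coarea-type identity for superharmonic functions. -/
lemma lintegral_sq_fderiv (h : SuperH Ω u)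
    (hfin : ∫⁻ x in Ω ∩ {x | 0 < u x}, ENNReal.ofReal (-lap u x) ≠ ⊤)
    {a : ℝ → ℝ≥0∞} (ha : Measurable a) :
    ∫⁻ x in Ω ∩ {x | 0 < u x}, a (u x) * ENNReal.ofReal (‖fderiv ℝ u x‖ ^ 2) =
      ∫⁻ t in Ioi (0 : ℝ), a t * H Ω u t := by
  have hdm : Measurable fun x => ENNReal.ofReal (‖fderiv ℝ u x‖ ^ 2) :=
    ((measurable_fderiv ℝ u).norm.pow_const 2).ennreal_ofReal
  have hHm : Measurable (H Ω u) := Antitone.measurable fun s t hst =>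
    lintegral_mono_set (inter_subset_inter_right _ fun x hx => lt_of_le_of_lt hst hx)
  set V := Ω ∩ {x | 0 < u x} with hV
  have hVm : MeasurableSet V := h.isOpen.measurableSet.inter
    (measurableSet_lt measurable_const h.meas)
  set ν : Measure ℝ := (((volume : Measure Plane).restrict V).withDensity
    fun x => ENNReal.ofReal (‖fderiv ℝ u x‖ ^ 2)).map u with hν
  set κ : Measure ℝ := ((volume : Measure ℝ).restrict (Ioi 0)).withDensity (H Ω u) with hκ
  have eν : ∀ b : ℝ → ℝ≥0∞, Measurable b → ∫⁻ t, b t ∂ν =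
      ∫⁻ x in V, b (u x) * ENNReal.ofReal (‖fderiv ℝ u x‖ ^ 2) := by
    intro b hb
    have hbu : Measurable fun x => b (u x) := hb.comp h.meas
    rw [hν, lintegral_map hb h.meas, lintegral_withDensity_eq_lintegral_mul _ hdm hbu]
    exact lintegral_congr fun x => mul_comm _ _
  have eκ : ∀ b : ℝ → ℝ≥0∞, Measurable b → ∫⁻ t, b t ∂κ = ∫⁻ t in Ioi (0 : ℝ), b t * H Ω u t := by
    intro b hb
    rw [hκ, lintegral_withDensity_eq_lintegral_mul _ hHm hb]
    exact lintegral_congr fun x => mul_comm _ _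
  have hIoi : ∀ s > 0, ν (Ioi s) = κ (Ioi s) := by
    intro s hs
    refine tendsto_nhds_unique (tendsto_lintegral_ramp ν s)
      ((tendsto_lintegral_ramp κ s).congr fun n => ?_)
    rw [eν _ (continuous_ramp s n).measurable.ennreal_ofReal,
      eκ _ (continuous_ramp s n).measurable.ennreal_ofReal,
      ← h.lintegral_energy (continuous_ramp s n) hs (fun t ht => ramp_of_le n ht) (ramp_nonneg s n),
      ← lintegral_indicator h.isOpen.measurableSet, ← lintegral_indicator hVm]
    refine lintegral_congr fun x => ?_
    by_cases hx : x ∈ Ω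
    · by_cases hx2 : 0 < u x
      · rw [indicator_of_mem hx, indicator_of_mem (show x ∈ V from ⟨hx, hx2⟩)]
      · rw [indicator_of_mem hx, indicator_of_notMem fun hc => hx2 hc.2,
          ramp_of_le n ((not_lt.mp hx2).trans hs.le)]
        simp
    · rw [indicator_of_notMem hx, indicator_of_notMem fun hc => hx hc.1]
  have hκfin : IsFiniteMeasure κ := by
    obtain ⟨B, hB⟩ : ∃ B, ∀ x ∈ Ω, u x ≤ B := by
      obtain ⟨B, hB⟩ := (isCompact_of_isClosed_isBounded isClosed_closure
        h.bdd.closure).bddAbove_image h.contOn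
      exact ⟨B, fun x hx => hB ⟨x, subset_closure hx, rfl⟩⟩
    refine ⟨?_⟩
    rw [hκ, withDensity_apply _ MeasurableSet.univ, Measure.restrict_univ]
    calc ∫⁻ t in Ioi (0 : ℝ), H Ω u t ≤ ∫⁻ t in Ioi (0 : ℝ),
          (Ioc 0 B).indicator (fun _ => ∫⁻ x in V, ENNReal.ofReal (-lap u x)) t := by
          refine setLIntegral_mono (measurable_const.indicator measurableSet_Ioc) fun t ht => ?_
          have ht : 0 < t := ht
          by_cases htB : t ≤ B
          · rw [indicator_of_mem (show t ∈ Ioc 0 B from ⟨ht, htB⟩)]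
            exact lintegral_mono_set (inter_subset_inter_right _ fun x hx => ht.trans hx)
          · have : Ω ∩ {x | t < u x} = ∅ := by
              ext x
              simp only [mem_inter_iff, mem_ofPred_eq, mem_empty_iff_false, iff_false, not_and]
              exact fun hx hc => htB (hc.le.trans (hB x hx))
            simp [H, this]
      _ ≤ ∫⁻ t, (Ioc 0 B).indicator (fun _ => ∫⁻ x in V, ENNReal.ofReal (-lap u x)) t :=
          setLIntegral_le_lintegral _ _
      _ < ⊤ := by
          rw [lintegral_indicator_const measurableSet_Ioc]
          exact ENNReal.mul_lt_top (lt_top_iff_ne_top.mpr hfin) measure_Ioc_lt_top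
  have key : κ = ν := by
    refine measure_eq_of_Ioi (fun s hs => (hIoi s hs).symm) ?_ ?_
    · rw [hκ, withDensity_apply _ measurableSet_Iic, Measure.restrict_restrict measurableSet_Iic,
        Iic_inter_Ioi, Ioc_self, Measure.restrict_empty, lintegral_zero_measure]
    · rw [hν, Measure.map_apply h.meas measurableSet_Iic,
        withDensity_apply _ (h.meas measurableSet_Iic),
        Measure.restrict_restrict (h.meas measurableSet_Iic)]
      have : u ⁻¹' Iic 0 ∩ V = ∅ := by
        ext x
        simp only [mem_inter_iff, mem_preimage, mem_Iic, mem_empty_iff_false, iff_false, not_and]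
        exact fun hx hc => absurd hc.2 (not_lt.mpr hx)
      simp [this]
  rw [← eν a ha, ← eκ a ha, key]

end SuperH

/-- Comparison of finite Borel measures on the line through half-open intervals. -/
lemma measure_le_of_Ioc {κ ν : Measure ℝ} [IsFiniteMeasure κ] [IsFiniteMeasure ν]
    (h : ∀ a b, a < b → κ (Ioc a b) ≤ ν (Ioc a b)) : κ ≤ ν := by
  have hd : ∀ (ρ : Measure ℝ) [IsFiniteMeasure ρ] (a b : ℝ), a ≤ b →
      ρ.real (Iic b) = ρ.real (Iic a) + ρ.real (Ioc a b) := by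
    intro ρ _ a b hab
    rw [← measureReal_union (Iic_disjoint_Ioc le_rfl) measurableSet_Ioc, Iic_union_Ioc_eq_Iic hab]
  have hc : ∀ (ρ : Measure ℝ) [IsFiniteMeasure ρ] (a : ℝ),
      ContinuousWithinAt (fun t => ρ.real (Iic t)) (Ici a) a := by
    intro ρ _ a
    rw [← continuousWithinAt_Ioi_iff_Ici]
    have h1 := tendsto_measure_biInter_gt (μ := ρ) (s := fun t => Iic t) (a := a)
      (fun r _ => measurableSet_Iic.nullMeasurableSet) (fun i j _ hij => Iic_subset_Iic.mpr hij)
      ⟨a + 1, by simp, measure_ne_top _ _⟩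
    have h2 : ⋂ r, ⋂ (_ : r > a), Iic r = Iic a := by
      ext t
      simp only [mem_iInter, mem_Iic]
      exact ⟨fun ht => le_of_forall_gt_imp_ge_of_dense ht, fun ht r hr => ht.trans hr.le⟩
    rw [h2] at h1
    exact (ENNReal.tendsto_toReal (measure_ne_top _ _)).comp h1
  let F : StieltjesFunction ℝ :=
    { toFun := fun t => ν.real (Iic t) - κ.real (Iic t)
      mono' := fun a b hab => by
        rcases hab.eq_or_lt with rfl | hab'
        · exact le_rfl
        · have := ENNReal.toReal_mono (measure_ne_top _ _) (h a b hab')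
          change κ.real _ ≤ ν.real _ at this
          simp only
          rw [hd ν a b hab, hd κ a b hab]
          linarith
      right_continuous' := fun a => (hc ν a).sub (hc κ a) }
  have e : ν = κ + F.measure := by
    refine Measure.ext_of_Ioc _ _ fun a b hab => ?_
    have h1 : F b - F a = ν.real (Ioc a b) - κ.real (Ioc a b) := by
      change (ν.real (Iic b) - κ.real (Iic b)) - (ν.real (Iic a) - κ.real (Iic a)) = _
      rw [hd ν a b hab.le, hd κ a b hab.le]
      ring
    rw [Measure.add_apply, F.measure_Ioc, h1, ENNReal.ofReal_sub _ measureReal_nonneg,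
      ofReal_measureReal, ofReal_measureReal, add_tsub_cancel_of_le (h a b hab)]
  rw [e]
  exact Measure.le_add_right le_rfl

namespace SuperH
variable {Ω : Set Plane} {u : Plane → ℝ}

/-- The distribution function. -/
def mu (Ω : Set Plane) (u : Plane → ℝ) (t : ℝ) : ℝ := (volume (Ω ∩ {x | t < u x})).toReal

/-- The density coming from the isoperimetric inequality. -/
def iso (Ω : Set Plane) (u : Plane → ℝ) (t : ℝ) : ℝ≥0∞ := ENNReal.ofReal √(4 * π * mu Ω u t)

lemma volume_ne_top (h : SuperH Ω u) (S : Set Plane) : volume (Ω ∩ S) ≠ ⊤ :=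
  ((measure_mono inter_subset_left).trans_lt h.bdd.measure_lt_top).ne

lemma mu_nonneg (Ω : Set Plane) (u : Plane → ℝ) (t : ℝ) : 0 ≤ mu Ω u t := ENNReal.toReal_nonneg

lemma mu_antitone (h : SuperH Ω u) : Antitone (mu Ω u) := fun _ _ hst =>
  ENNReal.toReal_mono (h.volume_ne_top _)
    (measure_mono (inter_subset_inter_right _ fun _ hx => lt_of_le_of_lt hst hx))

lemma measurable_iso (h : SuperH Ω u) : Measurable (iso Ω u) :=
  (Real.continuous_sqrt.measurable.comp (h.mu_antitone.measurable.const_mul _)).ennreal_ofReal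

lemma exists_bound (h : SuperH Ω u) : ∃ B, ∀ x ∈ Ω, u x ≤ B := by
  obtain ⟨B, hB⟩ := (isCompact_of_isClosed_isBounded isClosed_closure
    h.bdd.closure).bddAbove_image h.contOn
  exact ⟨B, fun x hx => hB ⟨x, subset_closure hx, rfl⟩⟩

lemma measurableSet_superlevel (h : SuperH Ω u) (t : ℝ) : MeasurableSet (Ω ∩ {x | t < u x}) :=
  h.isOpen.measurableSet.inter (measurableSet_lt measurable_const h.meas)

lemma lintegral_iso_Ioo_le (h : SuperH Ω u) {s s' t' t : ℝ} (hs : 0 < s) (hs' : s < s')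
    (ht' : t' < t) (hst : s' < t') :
    ∫⁻ r in Ioo s' t', iso Ω u r ≤
      ∫⁻ x in Ω ∩ {x | s < u x ∧ u x < t}, ENNReal.ofReal ‖fderiv ℝ u x‖ := by
  obtain ⟨f, hf0, hf1, hf⟩ := exists_continuous_zero_one_of_isClosed
    (isOpen_Ioo (a := s) (b := t)).isClosed_compl (isClosed_Icc (a := s') (b := t'))
    (disjoint_left.mpr fun r hr hr' => hr ⟨hs'.trans_le hr'.1, hr'.2.trans_lt ht'⟩)
  have hχ : Continuous f := f.continuous
  have h0 : ∀ r ≤ s, f r = 0 := fun r hr => hf0 (show r ∈ (Ioo s t)ᶜ from fun hc => absurd hc.1 (not_lt.mpr hr))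
  obtain ⟨hφ, hd, hφ0⟩ := primitive_facts hχ h0
  set φ : ℝ → ℝ := fun y => ∫ r in s..y, f r with hφdef
  have hmono : Monotone φ := monotone_of_deriv_nonneg (hφ.differentiable one_ne_zero) fun r => by
    rw [hd]; exact (hf r).1
  have hφlow : ∀ r ∈ Icc s' t', r - s' ≤ φ r := by
    intro r hr
    have h1 : φ r = φ s' + ∫ y in s'..r, f y :=
      (intervalIntegral.integral_add_adjacent_intervals (hχ.intervalIntegrable _ _)
        (hχ.intervalIntegrable _ _)).symm
    have h2 : ∫ y in s'..r, f y = r - s' := by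
      rw [intervalIntegral.integral_congr (g := fun _ => (1 : ℝ))]
      · simp
      · intro y hy
        rw [uIcc_of_le hr.1] at hy
        exact hf1 ⟨hy.1, hy.2.trans hr.2⟩
    have h3 : φ s ≤ φ s' := hmono hs'.le
    rw [show φ s = 0 from hφ0 s le_rfl] at h3
    linarith
  have hφn : ∀ y, 0 ≤ φ y := fun y => by
    rcases le_total y s with hy | hy
    · exact (hφ0 y hy).ge
    · rw [← hφ0 s le_rfl]; exact hmono hy
  have hF : ContDiffOn ℝ 1 (fun x => φ (u x)) Ω :=
    hφ.comp_contDiffOn (h.smooth.of_le (by norm_num))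
  obtain ⟨hg, hgc, hgs⟩ := contDiff_indicator h.isOpen (h.isCompact_superlevel hs) inter_subset_left
    hF (fun x hx hxK => hφ0 _ (le_of_lt (not_le.mp fun hc => hxK ⟨hx, hc⟩)))
  set g := Ω.indicator fun x => φ (u x) with hgdef
  have hmain := lintegral_sqrt_superlevel_le hg hgc (indicator_nonneg fun x _ => hφn _)
  have hright : ∫⁻ x, ENNReal.ofReal ‖fderiv ℝ g x‖ ≤
      ∫⁻ x in Ω ∩ {x | s < u x ∧ u x < t}, ENNReal.ofReal ‖fderiv ℝ u x‖ := by
    have hm : MeasurableSet (Ω ∩ {x | s < u x ∧ u x < t}) :=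
      h.isOpen.measurableSet.inter ((measurableSet_lt measurable_const h.meas).inter
        (measurableSet_lt h.meas measurable_const))
    rw [← lintegral_indicator hm]
    refine lintegral_mono fun x => ?_
    by_cases hx : x ∈ Ω
    · have hnh := h.isOpen.mem_nhds hx
      have he : g =ᶠ[𝓝 x] fun x => φ (u x) := by
        filter_upwards [hnh] with y hy using indicator_of_mem hy _
      have hux : DifferentiableAt ℝ u x := (h.smooth.contDiffAt hnh).differentiableAt (by norm_num)
      have h2 : HasFDerivAt (fun y => φ (u y)) (f (u x) • fderiv ℝ u x) x := by
        rw [← hd]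
        exact (hφ.differentiable one_ne_zero _).hasDerivAt.comp_hasFDerivAt x hux.hasFDerivAt
      rw [he.fderiv_eq, h2.fderiv]
      by_cases hx2 : s < u x ∧ u x < t
      · rw [indicator_of_mem (show x ∈ Ω ∩ {x | s < u x ∧ u x < t} from ⟨hx, hx2⟩), norm_smul]
        refine ENNReal.ofReal_le_ofReal (mul_le_of_le_one_left (norm_nonneg _) ?_)
        rw [norm_of_nonneg (hf _).1]
        exact (hf _).2
      · have : f (u x) = 0 := hf0 (show u x ∈ (Ioo s t)ᶜ from hx2)
        simp [this]
    · have : x ∉ tsupport (fderiv ℝ g) := fun hc => hx ((hgs (tsupport_fderiv_subset ℝ hc)).1)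
      rw [image_eq_zero_of_notMem_tsupport this]
      simp
  refine le_trans ?_ (hmain.trans hright)
  have hsh : ∫⁻ r in Ioo s' t', iso Ω u r = ∫⁻ τ in Ioo 0 (t' - s'), iso Ω u (τ + s') := by
    rw [← lintegral_indicator measurableSet_Ioo, ← lintegral_indicator measurableSet_Ioo,
      ← lintegral_add_right_eq_self _ s']
    refine lintegral_congr fun τ => ?_
    simp only [indicator, mem_Ioo]
    congr 1
    exact propext ⟨fun hc => ⟨by linarith [hc.1], by linarith [hc.2]⟩,
      fun hc => ⟨by linarith [hc.1], by linarith [hc.2]⟩⟩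
  rw [hsh]
  have hgfin : ∀ τ > 0, volume {x | τ < g x} ≠ ⊤ := fun τ hτ =>
    ((measure_mono fun x hx => subset_tsupport g (ne_of_gt (hτ.trans hx))).trans_lt
      hgc.measure_lt_top).ne
  have hmeas : Measurable fun τ : ℝ => ENNReal.ofReal √(4 * π * (volume {x | τ < g x}).toReal) := by
    have : Measurable fun τ : ℝ => volume {x | τ < g x} :=
      Antitone.measurable fun a b hab => measure_mono fun x hx => lt_of_le_of_lt hab hx
    exact (Real.continuous_sqrt.measurable.comp (this.ennreal_toReal.const_mul _)).ennreal_ofReal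
  calc ∫⁻ τ in Ioo 0 (t' - s'), iso Ω u (τ + s')
      ≤ ∫⁻ τ in Ioo 0 (t' - s'), ENNReal.ofReal √(4 * π * (volume {x | τ < g x}).toReal) := by
        refine setLIntegral_mono hmeas fun τ hτ => ?_
        unfold iso mu
        have hsub : Ω ∩ {x | τ + s' < u x} ⊆ {x | τ < g x} := by
          intro x hx
          have h1 : τ + s' < u x := hx.2
          rw [mem_ofPred_eq, hgdef, indicator_of_mem hx.1]
          have h2 : min (u x) t' - s' ≤ φ (min (u x) t') := hφlow _
            ⟨le_min (by linarith [hτ.1]) hst.le, min_le_right _ _⟩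
          have h3 : φ (min (u x) t') ≤ φ (u x) := hmono (min_le_left _ _)
          have h4 : τ + s' < min (u x) t' := lt_min h1 (by linarith [hτ.2])
          linarith
        gcongr
        exact hgfin τ hτ.1
    _ ≤ _ := lintegral_mono_set Ioo_subset_Ioi_self

/-- The isoperimetric inequality for level sets with arbitrary weights. -/
lemma lintegral_iso_le (h : SuperH Ω u)
    (hfin : ∫⁻ x in Ω ∩ {x | 0 < u x}, ENNReal.ofReal ‖fderiv ℝ u x‖ ≠ ⊤)
    {w : ℝ → ℝ≥0∞} (hw : Measurable w) :
    ∫⁻ t in Ioi (0 : ℝ), w t * iso Ω u t ≤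
      ∫⁻ x in Ω ∩ {x | 0 < u x}, w (u x) * ENNReal.ofReal ‖fderiv ℝ u x‖ := by
  have hdm : Measurable fun x => ENNReal.ofReal ‖fderiv ℝ u x‖ :=
    (measurable_fderiv ℝ u).norm.ennreal_ofReal
  have hHm := h.measurable_iso
  set V := Ω ∩ {x | 0 < u x} with hV
  have hVm : MeasurableSet V := h.measurableSet_superlevel 0
  set ν : Measure ℝ := (((volume : Measure Plane).restrict V).withDensity
    fun x => ENNReal.ofReal ‖fderiv ℝ u x‖).map u with hν
  set κ : Measure ℝ := ((volume : Measure ℝ).restrict (Ioi 0)).withDensity (iso Ω u) with hκ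
  have eν : ∀ b : ℝ → ℝ≥0∞, Measurable b → ∫⁻ t, b t ∂ν =
      ∫⁻ x in V, b (u x) * ENNReal.ofReal ‖fderiv ℝ u x‖ := by
    intro b hb
    have hbu : Measurable fun x => b (u x) := hb.comp h.meas
    rw [hν, lintegral_map hb h.meas, lintegral_withDensity_eq_lintegral_mul _ hdm hbu]
    exact lintegral_congr fun x => mul_comm _ _
  have eκ : ∀ b : ℝ → ℝ≥0∞, Measurable b → ∫⁻ t, b t ∂κ = ∫⁻ t in Ioi (0 : ℝ), b t * iso Ω u t := by
    intro b hb
    rw [hκ, lintegral_withDensity_eq_lintegral_mul _ hHm hb]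
    exact lintegral_congr fun x => mul_comm _ _
  have hνfin : IsFiniteMeasure ν := by
    refine ⟨?_⟩
    rw [← lintegral_one, eν _ measurable_const]
    simpa using lt_top_iff_ne_top.mpr hfin
  obtain ⟨B, hB⟩ := h.exists_bound
  have hiso0 : ∀ t, B ≤ t → iso Ω u t = 0 := fun t ht => by
    have : Ω ∩ {x | t < u x} = ∅ := by
      ext x
      simp only [mem_inter_iff, mem_ofPred_eq, mem_empty_iff_false, iff_false, not_and]
      exact fun hx hc => absurd (ht.trans_lt hc) (not_lt.mpr (hB x hx))
    simp [iso, mu, this]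
  have hκfin : IsFiniteMeasure κ := by
    refine ⟨?_⟩
    rw [← lintegral_one, eκ _ measurable_const]
    calc ∫⁻ t in Ioi (0 : ℝ), 1 * iso Ω u t
        ≤ ∫⁻ t in Ioi (0 : ℝ), (Ioc 0 B).indicator (fun _ => iso Ω u 0) t := by
          refine setLIntegral_mono (measurable_const.indicator measurableSet_Ioc) fun t ht => ?_
          have ht : 0 < t := ht
          rw [one_mul]
          by_cases htB : t ≤ B
          · rw [indicator_of_mem (show t ∈ Ioc 0 B from ⟨ht, htB⟩)]
            unfold iso
            have := h.mu_antitone ht.le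
            gcongr
          · rw [hiso0 t (not_le.mp htB).le]
            exact zero_le
      _ ≤ ∫⁻ t, (Ioc 0 B).indicator (fun _ => iso Ω u 0) t := setLIntegral_le_lintegral _ _
      _ < ⊤ := by
          rw [lintegral_indicator_const measurableSet_Ioc]
          exact ENNReal.mul_lt_top ENNReal.ofReal_lt_top measure_Ioc_lt_top
  have hκ0 : κ (Iic 0) = 0 := by
    rw [hκ, withDensity_apply _ measurableSet_Iic, Measure.restrict_restrict measurableSet_Iic,
        Iic_inter_Ioi, Ioc_self, Measure.restrict_empty, lintegral_zero_measure]
  have hκs : ∀ S, MeasurableSet S → κ S = ∫⁻ t in S ∩ Ioi 0, iso Ω u t := fun S hS => by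
    rw [hκ, withDensity_apply _ hS, Measure.restrict_restrict hS]
  have hIoo : ∀ s t, 0 < s → s < t → κ (Ioo s t) ≤ ν (Ioo s t) := by
    intro s t hs hst
    have hνe : ν (Ioo s t) = ∫⁻ x in Ω ∩ {x | s < u x ∧ u x < t}, ENNReal.ofReal ‖fderiv ℝ u x‖ := by
      rw [hν, Measure.map_apply h.meas measurableSet_Ioo,
        withDensity_apply _ (h.meas measurableSet_Ioo),
        Measure.restrict_restrict (h.meas measurableSet_Ioo)]
      congr 2
      ext x
      simp only [hV, mem_inter_iff, mem_preimage, mem_Ioo, mem_ofPred_eq]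
      exact ⟨fun hx => ⟨hx.2.1, hx.1⟩, fun hx => ⟨hx.2, hx.1, hs.trans hx.2.1⟩⟩
    set δ : ℕ → ℝ := fun n => (t - s) / 3 / (n + 1) with hδ
    have hδ0 : ∀ n, 0 < δ n := fun n => by
      have := sub_pos.mpr hst
      positivity
    have hδ1 : ∀ n, δ n ≤ (t - s) / 3 := fun n =>
      div_le_self (by linarith) (by linarith [(Nat.cast_nonneg n : (0 : ℝ) ≤ n)])
    have hun : Ioo s t = ⋃ n, Ioo (s + δ n) (t - δ n) := by
      ext r
      simp only [mem_Ioo, mem_iUnion]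
      refine ⟨fun hr => ?_, fun ⟨n, hn⟩ => ⟨by linarith [hδ0 n, hn.1], by linarith [hδ0 n, hn.2]⟩⟩
      have hl : Tendsto δ atTop (𝓝 0) := by
        have := (tendsto_one_div_add_atTop_nhds_zero_nat (𝕜 := ℝ)).const_mul ((t - s) / 3)
        simpa [hδ, div_eq_mul_inv] using this
      obtain ⟨n, hn⟩ := (hl.eventually (gt_mem_nhds (lt_min (sub_pos.mpr hr.1)
        (sub_pos.mpr hr.2)))).exists
      exact ⟨n, by linarith [lt_of_lt_of_le hn (min_le_left _ _)],
        by linarith [lt_of_lt_of_le hn (min_le_right _ _)]⟩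
    have hmon : Monotone fun n => Ioo (s + δ n) (t - δ n) := fun m n hmn => by
      have : δ n ≤ δ m := by
        have h1 := sub_pos.mpr hst
        simp only [hδ]
        gcongr
      exact Ioo_subset_Ioo (by linarith) (by linarith)
    have hlim := tendsto_measure_iUnion_atTop (μ := κ) hmon
    rw [← hun] at hlim
    refine le_of_tendsto' hlim fun n => ?_
    rw [hνe, Function.comp_apply, hκs _ measurableSet_Ioo]
    refine le_trans (lintegral_mono_set inter_subset_left) (h.lintegral_iso_Ioo_le hs
      (by linarith [hδ0 n]) (by linarith [hδ0 n]) (by linarith [hδ1 n]))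
  have hatom : ∀ b, κ {b} = 0 := fun b => by
    rw [hκs _ (measurableSet_singleton b)]
    exact setLIntegral_measure_zero _ _ (measure_mono_null inter_subset_left (by simp))
  have hle : κ ≤ ν := by
    refine measure_le_of_Ioc fun a b hab => ?_
    have h1 : ∀ s, 0 < s → a ≤ s → κ (Ioc s b) ≤ ν (Ioc a b) := by
      intro s hs has
      rcases lt_or_ge s b with hsb | hsb
      · rw [← Ioo_union_right hsb]
        calc _ ≤ _ := measure_union_le _ _
          _ = κ (Ioo s b) := by rw [hatom, add_zero]
          _ ≤ _ := hIoo s b hs hsb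
          _ ≤ ν (Ioc a b) :=
            measure_mono fun r (hr : r ∈ Ioo s b) => ⟨has.trans_lt hr.1, hr.2.le⟩
      · simp [Ioc_eq_empty (not_lt.mpr hsb)]
    rcases lt_or_ge 0 a with ha | ha
    · exact h1 a ha le_rfl
    · have h2 : κ (Ioc a b) ≤ κ (Ioc 0 b) := by
        calc κ (Ioc a b) ≤ κ (Iic 0 ∪ Ioc 0 b) := measure_mono fun r hr => by
              rcases le_or_gt r 0 with h3 | h3
              · exact Or.inl h3
              · exact Or.inr ⟨h3, hr.2⟩
          _ ≤ _ := measure_union_le _ _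
          _ = _ := by rw [hκ0, zero_add]
      refine h2.trans ?_
      have hun : Ioc 0 b = ⋃ n : ℕ, Ioc (1 / ((n : ℝ) + 1)) b := by
        ext r
        simp only [mem_Ioc, mem_iUnion]
        refine ⟨fun hr => ?_, fun ⟨n, hn⟩ => ⟨lt_trans (by positivity) hn.1, hn.2⟩⟩
        obtain ⟨n, hn⟩ := exists_nat_one_div_lt hr.1
        exact ⟨n, hn, hr.2⟩
      have hlim := tendsto_measure_iUnion_atTop (μ := κ) (s := fun n : ℕ => Ioc (1 / ((n : ℝ) + 1)) b)
        fun m n hmn => Ioc_subset_Ioc_left (by gcongr)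
      rw [← hun] at hlim
      exact le_of_tendsto' hlim fun n => h1 _ (by positivity) (ha.trans (by positivity))
  rw [← eκ w hw, ← eν w hw]
  exact lintegral_mono' hle le_rfl

end SuperH

/-- Solutions of the (shifted) plasma equation with unit mass. -/
structure Sol (Ω : Set Plane) (u : Plane → ℝ) (p lam : ℝ) : Prop extends SuperH Ω u where
  one_le : 1 ≤ p
  lam_pos : 0 < lam
  pde : ∀ x ∈ Ω, -lap u x = lam * max (u x) 0 ^ p
  constr : ∫⁻ x in Ω, ENNReal.ofReal (max (u x) 0 ^ p) = 1

namespace Sol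
open SuperH
variable {Ω : Set Plane} {u : Plane → ℝ} {p lam : ℝ}

/-- The probability measure with density `u₊ᵖ`. -/
def Pm (Ω : Set Plane) (u : Plane → ℝ) (p : ℝ) : Measure Plane :=
  ((volume : Measure Plane).restrict Ω).withDensity fun x => ENNReal.ofReal (max (u x) 0 ^ p)

/-- The mass of superlevel sets. -/
def mass (Ω : Set Plane) (u : Plane → ℝ) (p t : ℝ) : ℝ := (Pm Ω u p {x | t < u x}).toReal

/-- The energy integral. -/
def En (Ω : Set Plane) (u : Plane → ℝ) (p : ℝ) : ℝ := ∫ x in Ω, max (u x) 0 ^ (p + 1)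

lemma measurable_pow (h : Sol Ω u p lam) (q : ℝ) : Measurable fun x => max (u x) 0 ^ q :=
  (h.meas.max measurable_const).pow_const q

lemma pow_nonneg (u : Plane → ℝ) (q : ℝ) (x : Plane) : 0 ≤ max (u x) 0 ^ q :=
  rpow_nonneg (le_max_right _ _) q

lemma isProb (h : Sol Ω u p lam) : IsProbabilityMeasure (Pm Ω u p) :=
  ⟨by rw [Pm, withDensity_apply _ MeasurableSet.univ, Measure.restrict_univ, h.constr]⟩

lemma Pm_apply (Ω : Set Plane) (u : Plane → ℝ) (p : ℝ) {S : Set Plane} (hS : MeasurableSet S) :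
    Pm Ω u p S = ∫⁻ x in Ω ∩ S, ENNReal.ofReal (max (u x) 0 ^ p) := by
  rw [Pm, withDensity_apply _ hS, Measure.restrict_restrict hS, inter_comm]

lemma msl (h : Sol Ω u p lam) (t : ℝ) : MeasurableSet {x | t < u x} :=
  measurableSet_lt measurable_const h.meas

lemma mass_nonneg (Ω : Set Plane) (u : Plane → ℝ) (p t : ℝ) : 0 ≤ mass Ω u p t :=
  ENNReal.toReal_nonneg

lemma ofReal_mass (h : Sol Ω u p lam) (t : ℝ) :
    ENNReal.ofReal (mass Ω u p t) = Pm Ω u p {x | t < u x} := by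
  have := h.isProb
  exact ENNReal.ofReal_toReal (measure_ne_top _ _)

lemma mass_antitone (h : Sol Ω u p lam) : Antitone (mass Ω u p) := fun _ _ hst => by
  have := h.isProb
  exact ENNReal.toReal_mono (measure_ne_top _ _) (measure_mono fun _ hx => lt_of_le_of_lt hst hx)

lemma H_eq (h : Sol Ω u p lam) (t : ℝ) : H Ω u t = ENNReal.ofReal (lam * mass Ω u p t) := by
  rw [ENNReal.ofReal_mul h.lam_pos.le, h.ofReal_mass, Pm_apply Ω u p (h.msl t),
    ← lintegral_const_mul _ (h.measurable_pow p).ennreal_ofReal, H]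
  refine setLIntegral_congr_fun (h.measurableSet_superlevel t) fun x hx => ?_
  rw [h.pde x hx.1, ENNReal.ofReal_mul h.lam_pos.le]

lemma mul_mu_le_mass (h : Sol Ω u p lam) {t : ℝ} (ht : 0 < t) :
    t ^ p * mu Ω u t ≤ mass Ω u p t := by
  have := h.isProb
  have h1 : ENNReal.ofReal (t ^ p) * volume (Ω ∩ {x | t < u x}) ≤ Pm Ω u p {x | t < u x} := by
    rw [Pm_apply Ω u p (h.msl t), ← setLIntegral_const]
    refine setLIntegral_mono (h.measurable_pow p).ennreal_ofReal fun x hx => ?_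
    have hx2 : t < u x := hx.2
    have := h.one_le
    refine ENNReal.ofReal_le_ofReal (rpow_le_rpow ht.le (le_max_of_le_left hx2.le) (by linarith))
  have h2 := ENNReal.toReal_mono (measure_ne_top _ _) h1
  rwa [ENNReal.toReal_mul, ENNReal.toReal_ofReal (by positivity)] at h2

lemma mu_eq_zero (h : Sol Ω u p lam) {t : ℝ} (ht : 0 < t) (hm : mass Ω u p t = 0) :
    mu Ω u t = 0 := by
  have h1 := h.mul_mu_le_mass ht
  rw [hm] at h1
  have h2 : 0 < t ^ p := by positivity
  exact le_antisymm (nonpos_of_mul_nonpos_right h1 h2) (mu_nonneg _ _ _)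

lemma integrableOn_pow (h : Sol Ω u p lam) {q : ℝ} (hq : 0 ≤ q) :
    IntegrableOn (fun x => max (u x) 0 ^ q) Ω := by
  have hK := isCompact_of_isClosed_isBounded isClosed_closure h.bdd.closure
  refine (ContinuousOn.integrableOn_compact hK ?_).mono_set subset_closure
  exact (h.contOn.sup continuousOn_const).rpow_const fun x _ => Or.inr hq

lemma ofReal_En (h : Sol Ω u p lam) :
    ENNReal.ofReal (En Ω u p) = ∫⁻ x in Ω, ENNReal.ofReal (max (u x) 0 ^ (p + 1)) := by
  have := h.one_le
  exact ofReal_integral_eq_lintegral_ofReal (h.integrableOn_pow (by linarith))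
    (ae_of_all _ fun x => pow_nonneg u _ x)

lemma En_nonneg (Ω : Set Plane) (u : Plane → ℝ) (p : ℝ) : 0 ≤ En Ω u p :=
  integral_nonneg fun x => pow_nonneg u _ x

lemma layer (h : Sol Ω u p lam) :
    ∫⁻ t in Ioi (0 : ℝ), ENNReal.ofReal (mu Ω u t * t ^ p) =
      ENNReal.ofReal (En Ω u p / (p + 1)) := by
  have hp := h.one_le
  have h1 := lintegral_rpow_eq_lintegral_meas_lt_mul ((volume : Measure Plane).restrict Ω)
    (f := fun x => max (u x) 0) (ae_of_all _ fun x => le_max_right _ _)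
    (h.meas.max measurable_const).aemeasurable (p := p + 1) (by linarith)
  have h2 : ∫⁻ t in Ioi (0 : ℝ), ENNReal.ofReal (mu Ω u t * t ^ p) =
      ∫⁻ t in Ioi (0 : ℝ), (volume.restrict Ω) {a | t < max (u a) 0} *
        ENNReal.ofReal (t ^ (p + 1 - 1)) := by
    refine setLIntegral_congr_fun measurableSet_Ioi fun t (ht : 0 < t) => ?_
    have e : {a | t < max (u a) 0} = {a | t < u a} := by
      ext a; simp [ht.not_gt]
    rw [e, Measure.restrict_apply (h.msl t), inter_comm, ENNReal.ofReal_mul (mu_nonneg _ _ _), mu,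
      ENNReal.ofReal_toReal (h.volume_ne_top _), add_sub_cancel_right]
  rw [h2, ENNReal.ofReal_div_of_pos (by linarith), h.ofReal_En, h1, mul_comm,
    ENNReal.mul_div_cancel_right]
  · simpa using by linarith
  · exact ENNReal.ofReal_ne_top

lemma prod_facts (h : Sol Ω u p lam) :
    2 * ∫⁻ x, Pm Ω u p {y | u x < u y} ∂(Pm Ω u p) +
      ((Pm Ω u p).prod (Pm Ω u p)) {z | u z.1 = u z.2} = 1 := by
  have := h.isProb
  have m1 : Measurable fun z : Plane × Plane => u z.1 := h.meas.comp measurable_fst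
  have m2 : Measurable fun z : Plane × Plane => u z.2 := h.meas.comp measurable_snd
  have hS : MeasurableSet {z : Plane × Plane | u z.1 < u z.2} := measurableSet_lt m1 m2
  have hS' : MeasurableSet {z : Plane × Plane | u z.2 < u z.1} := measurableSet_lt m2 m1
  have e1 : ∫⁻ x, Pm Ω u p {y | u x < u y} ∂(Pm Ω u p) =
      ((Pm Ω u p).prod (Pm Ω u p)) {z | u z.1 < u z.2} := by
    rw [Measure.prod_apply hS]; rfl
  have e2 : ((Pm Ω u p).prod (Pm Ω u p)) {z | u z.2 < u z.1} =
      ((Pm Ω u p).prod (Pm Ω u p)) {z | u z.1 < u z.2} := by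
    rw [← Measure.prod_swap, Measure.map_apply measurable_swap hS', Measure.prod_swap]
    rfl
  have hu : (univ : Set (Plane × Plane)) =
      ({z | u z.1 < u z.2} ∪ {z | u z.2 < u z.1}) ∪ {z | u z.1 = u z.2} := by
    ext z
    simp only [mem_univ, mem_union, mem_ofPred_eq, true_iff]
    rcases lt_trichotomy (u z.1) (u z.2) with h1 | h1 | h1 <;> simp [h1]
  have : ((Pm Ω u p).prod (Pm Ω u p)) univ = 1 := measure_univ
  rw [hu, measure_union, measure_union, e2, ← two_mul, ← e1] at this
  · exact this
  · exact disjoint_left.mpr fun z (h1 : u z.1 < u z.2) (h2 : u z.2 < u z.1) => lt_asymm h1 h2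
  · exact hS'
  · refine disjoint_left.mpr fun z h1 (h2 : u z.1 = u z.2) => ?_
    rcases h1 with h1 | h1
    · exact absurd (show u z.1 < u z.2 from h1) (by rw [h2]; exact lt_irrefl _)
    · exact absurd (show u z.2 < u z.1 from h1) (by rw [h2]; exact lt_irrefl _)
  · exact measurableSet_eq_fun m1 m2

lemma A3_eq (h : Sol Ω u p lam) :
    ∫⁻ x, Pm Ω u p {y | u x < u y} ∂(Pm Ω u p) =
      ∫⁻ x in Ω ∩ {x | 0 < u x}, ENNReal.ofReal (u x ^ p * mass Ω u p (u x)) := by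
  have hp := h.one_le
  have hm : Measurable fun x => Pm Ω u p {y | u x < u y} := by
    have h1 : Measurable fun t => Pm Ω u p {y | t < u y} :=
      Antitone.measurable fun _ _ hst => measure_mono fun _ hx => lt_of_le_of_lt hst hx
    exact h1.comp h.meas
  rw [show ∫⁻ x, Pm Ω u p {y | u x < u y} ∂(Pm Ω u p) = ∫⁻ x, Pm Ω u p {y | u x < u y}
      ∂(((volume : Measure Plane).restrict Ω).withDensity
        fun x => ENNReal.ofReal (max (u x) 0 ^ p)) from rfl,
    lintegral_withDensity_eq_lintegral_mul _ (h.measurable_pow p).ennreal_ofReal hm,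
    ← lintegral_indicator h.isOpen.measurableSet,
    ← lintegral_indicator (h.measurableSet_superlevel 0)]
  refine lintegral_congr fun x => ?_
  by_cases hx : x ∈ Ω
  · by_cases hx2 : 0 < u x
    · rw [indicator_of_mem hx, indicator_of_mem (show x ∈ Ω ∩ {x | 0 < u x} from ⟨hx, hx2⟩),
        ENNReal.ofReal_mul (by positivity), h.ofReal_mass]
      simp [max_eq_left hx2.le]
    · rw [indicator_of_mem hx, indicator_of_notMem fun hc => hx2 hc.2]
      simp [max_eq_right (not_lt.mp hx2), zero_rpow (by linarith : p ≠ 0)]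
  · rw [indicator_of_notMem hx, indicator_of_notMem fun hc => hx hc.1]

lemma lintegral_lap (h : Sol Ω u p lam) :
    ∫⁻ x in Ω ∩ {x | 0 < u x}, ENNReal.ofReal (-lap u x) ≠ ⊤ := by
  have := h.H_eq 0
  rw [H] at this
  rw [this]
  exact ENNReal.ofReal_ne_top

lemma energy_shift (h : Sol Ω u p lam) {δ : ℝ} (hδ : 0 ≤ δ) (h' : SuperH Ω fun x => u x + δ) :
    ∫⁻ x in Ω ∩ {x | 0 < u x + δ}, ENNReal.ofReal (‖fderiv ℝ u x‖ ^ 2) =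
      ENNReal.ofReal (lam * (En Ω u p + δ)) := by
  have hp := h.one_le
  have := h.isProb
  have hl : lap (fun x => u x + δ) = lap u := by
    ext x; simp [lap, fderiv_add_const]
  have hH : ∀ t, H Ω (fun x => u x + δ) t = ENNReal.ofReal lam * Pm Ω u p {x | t < u x + δ} := by
    intro t
    have hm : MeasurableSet {x | t < u x + δ} :=
      measurableSet_lt measurable_const (h.meas.add_const δ)
    rw [Pm_apply Ω u p hm, ← lintegral_const_mul _ (h.measurable_pow p).ennreal_ofReal, H, hl]
    refine setLIntegral_congr_fun (h.isOpen.measurableSet.inter hm) fun x hx => ?_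
    rw [h.pde x hx.1, ENNReal.ofReal_mul h.lam_pos.le]
  have hfin : ∫⁻ x in Ω ∩ {x | 0 < u x + δ}, ENNReal.ofReal (-lap (fun x => u x + δ) x) ≠ ⊤ := by
    have := hH 0
    rw [H] at this
    rw [this]
    exact ENNReal.mul_ne_top ENNReal.ofReal_ne_top (measure_ne_top _ _)
  have h1 := h'.lintegral_sq_fderiv hfin (a := fun _ => 1) measurable_const
  simp only [one_mul, fderiv_add_const] at h1
  have hmx : Measurable fun x => max (u x + δ) 0 := (h.meas.add_const δ).max measurable_const
  have h2 := lintegral_eq_lintegral_meas_lt (Pm Ω u p) (f := fun x => max (u x + δ) 0)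
    (ae_of_all _ fun x => le_max_right _ _) hmx.aemeasurable
  have h3 : ∫⁻ t in Ioi (0 : ℝ), H Ω (fun x => u x + δ) t =
      ENNReal.ofReal lam * ∫⁻ x, ENNReal.ofReal (max (u x + δ) 0) ∂(Pm Ω u p) := by
    rw [h2, ← lintegral_const_mul' _ _ ENNReal.ofReal_ne_top]
    refine setLIntegral_congr_fun measurableSet_Ioi fun t (ht : 0 < t) => ?_
    have e : {a | t < max (u a + δ) 0} = {a | t < u a + δ} := by
      ext a; simp [ht.not_gt]
    rw [e, hH]
  have h4 : ∫⁻ x, ENNReal.ofReal (max (u x + δ) 0) ∂(Pm Ω u p) =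
      ENNReal.ofReal (En Ω u p + δ) := by
    rw [Pm, lintegral_withDensity_eq_lintegral_mul _ (h.measurable_pow p).ennreal_ofReal
      hmx.ennreal_ofReal, ENNReal.ofReal_add (En_nonneg _ _ _) hδ, h.ofReal_En,
      ← mul_one (ENNReal.ofReal δ), ← h.constr,
      ← lintegral_const_mul _ (h.measurable_pow p).ennreal_ofReal,
      ← lintegral_add_left (h.measurable_pow _).ennreal_ofReal]
    refine lintegral_congr fun x => ?_
    simp only [Pi.mul_apply]
    rw [← ENNReal.ofReal_mul (pow_nonneg u p x), ← ENNReal.ofReal_mul hδ,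
      ← ENNReal.ofReal_add (pow_nonneg u _ x) (mul_nonneg hδ (pow_nonneg u p x))]
    congr 1
    by_cases hx : 0 < u x
    · rw [max_eq_left hx.le, max_eq_left (by linarith), rpow_add_one hx.ne']
      ring
    · rw [max_eq_right (not_lt.mp hx), zero_rpow (by linarith), zero_rpow (by linarith)]
      ring
  rw [h1, h3, h4, ENNReal.ofReal_mul h.lam_pos.le]

lemma energy (h : Sol Ω u p lam) :
    ∫⁻ x in Ω ∩ {x | 0 < u x}, ENNReal.ofReal (‖fderiv ℝ u x‖ ^ 2) =
      ENNReal.ofReal (lam * En Ω u p) := by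
  simpa using h.energy_shift le_rfl (by simpa using h.toSuperH)

lemma lintegral_norm_fderiv (h : Sol Ω u p lam) :
    ∫⁻ x in Ω ∩ {x | 0 < u x}, ENNReal.ofReal ‖fderiv ℝ u x‖ ≠ ⊤ := by
  have h1 : ∫⁻ x in Ω ∩ {x | 0 < u x}, ENNReal.ofReal ‖fderiv ℝ u x‖ ≤
      ∫⁻ x in Ω ∩ {x | 0 < u x}, (1 + ENNReal.ofReal (‖fderiv ℝ u x‖ ^ 2)) := by
    refine lintegral_mono fun x => ?_
    rw [← ENNReal.ofReal_one, ← ENNReal.ofReal_add zero_le_one (sq_nonneg _)]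
    exact ENNReal.ofReal_le_ofReal (by nlinarith [sq_nonneg (‖fderiv ℝ u x‖ - 1)])
  refine ne_top_of_le_ne_top ?_ h1
  rw [lintegral_add_left measurable_const, h.energy, lintegral_one, Measure.restrict_apply_univ]
  exact ENNReal.add_ne_top.mpr ⟨h.volume_ne_top _, ENNReal.ofReal_ne_top⟩

end Sol

namespace Sol
open SuperH
variable {Ω : Set Plane} {u : Plane → ℝ} {p lam : ℝ}

/-- The pointwise deficit in the isoperimetric argument. -/
def deficit (Ω : Set Plane) (u : Plane → ℝ) (p lam : ℝ) (x : Plane) : ℝ :=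
  u x ^ p / (lam ^ 2 * mass Ω u p (u x)) *
    (√(4 * π * mu Ω u (u x)) * ‖fderiv ℝ u x‖ - lam * mass Ω u p (u x)) ^ 2

lemma measurable_mu (h : Sol Ω u p lam) : Measurable (mu Ω u) := h.mu_antitone.measurable

lemma measurable_mass (h : Sol Ω u p lam) : Measurable (mass Ω u p) := h.mass_antitone.measurable

lemma measurable_deficit (h : Sol Ω u p lam) : Measurable (deficit Ω u p lam) := by
  have h1 := h.measurable_mu.comp h.meas
  have h2 := h.measurable_mass.comp h.meas
  have h3 : Measurable fun x => ‖fderiv ℝ u x‖ := (measurable_fderiv ℝ u).norm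
  have h4 : Measurable fun x => u x ^ p := h.meas.pow_const p
  exact (h4.div (h2.const_mul _)).mul
    ((((h1.const_mul (4 * π)).sqrt.mul h3).sub (h2.const_mul lam)).pow_const 2)

lemma deficit_identity (h : Sol Ω u p lam) {x : Plane} (hx : 0 < u x) :
    4 * π * mu Ω u (u x) * u x ^ p / (lam ^ 2 * mass Ω u p (u x)) * ‖fderiv ℝ u x‖ ^ 2 +
      u x ^ p * mass Ω u p (u x) =
    2 * (√(4 * π * mu Ω u (u x)) * u x ^ p / lam * ‖fderiv ℝ u x‖) + deficit Ω u p lam x := by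
  have hl := h.lam_pos
  have hm0 := mass_nonneg Ω u p (u x)
  have hμ0 := mu_nonneg Ω u (u x)
  rcases hm0.eq_or_lt with hm | hm
  · simp [deficit, ← hm, h.mu_eq_zero hx hm.symm]
  · have hs : √(4 * π * mu Ω u (u x)) ^ 2 = 4 * π * mu Ω u (u x) := Real.sq_sqrt (by positivity)
    rw [deficit]
    generalize √(4 * π * mu Ω u (u x)) = r at hs ⊢
    rw [← hs]
    field_simp
    ring

lemma two_mul_ofReal (r : ℝ) : 2 * ENNReal.ofReal r = ENNReal.ofReal (2 * r) := by
  rw [ENNReal.ofReal_mul zero_le_two, ENNReal.ofReal_ofNat]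

lemma main_ineq (h : Sol Ω u p lam) :
    2 * ENNReal.ofReal (4 * π * En Ω u p / (lam * (p + 1))) +
      2 * (∫⁻ x in Ω ∩ {x | 0 < u x}, ENNReal.ofReal (deficit Ω u p lam x)) +
      ((Pm Ω u p).prod (Pm Ω u p)) {z | u z.1 = u z.2} ≤ 1 := by
  have hl := h.lam_pos
  have hp := h.one_le
  have hμ := h.measurable_mu
  have hm := h.measurable_mass
  set V := Ω ∩ {x | 0 < u x} with hV
  set B := ENNReal.ofReal (4 * π * En Ω u p / (lam * (p + 1))) with hB
  have hBt : ∫⁻ t in Ioi (0 : ℝ), ENNReal.ofReal (4 * π * mu Ω u t * t ^ p / lam) = B := by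
    have e : B = ENNReal.ofReal (4 * π / lam) * ENNReal.ofReal (En Ω u p / (p + 1)) := by
      rw [← ENNReal.ofReal_mul (by positivity), hB]
      congr 1
      field_simp
    rw [e, ← h.layer, ← lintegral_const_mul' _ _ ENNReal.ofReal_ne_top]
    refine setLIntegral_congr_fun measurableSet_Ioi fun t (ht : 0 < t) => ?_
    rw [← ENNReal.ofReal_mul (by positivity)]
    congr 1
    ring
  have hpow : Measurable fun t : ℝ => t ^ p := measurable_id.pow_const p
  let w : ℝ → ℝ := fun t => √(4 * π * mu Ω u t) * t ^ p / lam
  let a : ℝ → ℝ := fun t => 4 * π * mu Ω u t * t ^ p / (lam ^ 2 * mass Ω u p t)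
  have hw : Measurable w := ((hμ.const_mul _).sqrt.mul hpow).div_const _
  have ha : Measurable a := ((hμ.const_mul _).mul hpow).div (hm.const_mul _)
  have A1 : B ≤ ∫⁻ x in V, ENNReal.ofReal (w (u x)) * ENNReal.ofReal ‖fderiv ℝ u x‖ := by
    refine le_trans (le_of_eq ?_) (h.lintegral_iso_le h.lintegral_norm_fderiv hw.ennreal_ofReal)
    rw [← hBt]
    refine setLIntegral_congr_fun measurableSet_Ioi fun t (ht : 0 < t) => ?_
    have hμ0 := mu_nonneg Ω u t
    have hs : √(4 * π * mu Ω u t) * √(4 * π * mu Ω u t) = 4 * π * mu Ω u t :=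
      Real.mul_self_sqrt (by positivity)
    rw [iso, ← ENNReal.ofReal_mul (by positivity)]
    congr 1
    simp only [w]
    generalize √(4 * π * mu Ω u t) = r at hs ⊢
    rw [← hs]
    ring
  have A2 : ∫⁻ x in V, ENNReal.ofReal (a (u x)) * ENNReal.ofReal (‖fderiv ℝ u x‖ ^ 2) = B := by
    rw [h.lintegral_sq_fderiv h.lintegral_lap ha.ennreal_ofReal, ← hBt]
    refine setLIntegral_congr_fun measurableSet_Ioi fun t (ht : 0 < t) => ?_
    have hμ0 := mu_nonneg Ω u t
    have hm0 := mass_nonneg Ω u p t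
    rw [h.H_eq, ← ENNReal.ofReal_mul (by positivity)]
    congr 1
    rcases hm0.eq_or_lt with hmz | hmz
    · simp [a, ← hmz, h.mu_eq_zero ht hmz.symm]
    · simp only [a]
      field_simp
  have hG : Measurable fun x => ‖fderiv ℝ u x‖ := (measurable_fderiv ℝ u).norm
  have key : B + ∫⁻ x in V, ENNReal.ofReal (u x ^ p * mass Ω u p (u x)) =
      2 * (∫⁻ x in V, ENNReal.ofReal (w (u x)) * ENNReal.ofReal ‖fderiv ℝ u x‖) +
        ∫⁻ x in V, ENNReal.ofReal (deficit Ω u p lam x) := by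
    have hpm : Measurable fun x => u x ^ p * mass Ω u p (u x) :=
      (hpow.comp h.meas).mul (hm.comp h.meas)
    rw [← A2, ← lintegral_add_right _ hpm.ennreal_ofReal,
      ← lintegral_const_mul' _ _ (by simp),
      ← lintegral_add_right _ h.measurable_deficit.ennreal_ofReal]
    refine setLIntegral_congr_fun (h.measurableSet_superlevel 0) fun x hx => ?_
    have hx2 : 0 < u x := hx.2
    have hμ0 := mu_nonneg Ω u (u x)
    have hm0 := mass_nonneg Ω u p (u x)
    have hd : 0 ≤ deficit Ω u p lam x := by unfold deficit; positivity
    rw [← ENNReal.ofReal_mul (by positivity), ← ENNReal.ofReal_mul (by positivity),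
      ← ENNReal.ofReal_add (by positivity) (by positivity), two_mul_ofReal, ← ENNReal.ofReal_add (by positivity) hd]
    congr 1
    exact h.deficit_identity hx2
  have key2 : B + ∫⁻ x in V, ENNReal.ofReal (deficit Ω u p lam x) ≤
      ∫⁻ x in V, ENNReal.ofReal (u x ^ p * mass Ω u p (u x)) := by
    refine (ENNReal.add_le_add_iff_left (a := B) ENNReal.ofReal_ne_top).mp ?_
    rw [key, ← add_assoc, ← two_mul]
    gcongr
  rw [← mul_add, ← h.prod_facts, h.A3_eq]
  gcongr

lemma eight_pi_le (h : Sol Ω u p lam) : 8 * π * En Ω u p ≤ (p + 1) * lam := by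
  have hl := h.lam_pos
  have hp := h.one_le
  have h1 := (le_add_right (le_add_right le_rfl)).trans h.main_ineq
  have hE := En_nonneg Ω u p
  rw [two_mul_ofReal, ENNReal.ofReal_le_one,
    mul_div_assoc', div_le_one (by positivity)] at h1
  linarith

lemma eq_case (h : Sol Ω u p lam) (he : 8 * π * En Ω u p = (p + 1) * lam) :
    (∫⁻ x in Ω ∩ {x | 0 < u x}, ENNReal.ofReal (deficit Ω u p lam x)) = 0 ∧
      ((Pm Ω u p).prod (Pm Ω u p)) {z | u z.1 = u z.2} = 0 := by
  have hl := h.lam_pos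
  have hp := h.one_le
  have h1 := h.main_ineq
  have e : 2 * ENNReal.ofReal (4 * π * En Ω u p / (lam * (p + 1))) = 1 := by
    rw [two_mul_ofReal, ← ENNReal.ofReal_one]
    congr 1
    field_simp
    linarith
  rw [e, add_assoc] at h1
  have h2 : (1 : ℝ≥0∞) + (2 * (∫⁻ x in Ω ∩ {x | 0 < u x}, ENNReal.ofReal (deficit Ω u p lam x)) +
      ((Pm Ω u p).prod (Pm Ω u p)) {z | u z.1 = u z.2}) ≤ 1 + 0 := by simpa using h1
  have h3 := (ENNReal.add_le_add_iff_left ENNReal.one_ne_top).mp h2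
  have h4 := add_eq_zero.mp (le_antisymm h3 zero_le)
  exact ⟨by simpa using h4.1, h4.2⟩

end Sol

lemma norm_gradient (w : Plane → ℝ) (x : Plane) : ‖gradient w x‖ = ‖fderiv ℝ w x‖ := by
  rw [gradient, LinearIsometryEquiv.norm_map]

/-- Mollification of a compactly supported `C¹` function. -/
lemma exists_mollify {Ω : Set Plane} (hΩ : IsOpen Ω) {g : Plane → ℝ} (hg : ContDiff ℝ 1 g)
    (hgc : HasCompactSupport g) (hgΩ : tsupport g ⊆ Ω) :
    ∃ G : ℕ → Plane → ℝ, (∀ᶠ n in atTop, ContDiff ℝ (⊤ : ℕ∞) (G n) ∧ HasCompactSupport (G n) ∧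
      tsupport (G n) ⊆ Ω) ∧ (∃ C, ∀ n x, |G n x| ≤ C ∧ ‖fderiv ℝ (G n) x‖ ≤ C) ∧
      ∀ x, Tendsto (fun n => G n x) atTop (𝓝 (g x)) ∧
        Tendsto (fun n => fderiv ℝ (G n) x) atTop (𝓝 (fderiv ℝ g x)) := by
  let φ : ℕ → ContDiffBump (0 : Plane) := fun n =>
    ⟨1 / (2 * ((n : ℝ) + 1)), 1 / ((n : ℝ) + 1), by positivity, by
      apply one_div_lt_one_div_of_lt <;> linarith [show (0 : ℝ) ≤ n from n.cast_nonneg]⟩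
  have hφ : Tendsto (fun n => (φ n).rOut) atTop (𝓝 0) := tendsto_one_div_add_atTop_nhds_zero_nat
  let G : ℕ → Plane → ℝ := fun n =>
    convolution ((φ n).normed volume) g (ContinuousLinearMap.lsmul ℝ ℝ) volume
  have hli : ∀ n, LocallyIntegrable ((φ n).normed (volume : Measure Plane)) volume := fun n =>
    (φ n).continuous_normed.locallyIntegrable
  have hdg : Continuous (fderiv ℝ g) := hg.continuous_fderiv one_ne_zero
  have hfd : ∀ n x, fderiv ℝ (G n) x = convolution ((φ n).normed volume) (fderiv ℝ g)
      (ContinuousLinearMap.lsmul ℝ ℝ) volume x := by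
    intro n x
    rw [(hgc.hasFDerivAt_convolution_right (ContinuousLinearMap.lsmul ℝ ℝ) (hli n) hg x).fderiv]
    rfl
  obtain ⟨C1, hC1⟩ := hgc.exists_bound_of_continuous hg.continuous
  obtain ⟨C2, hC2⟩ := (hgc.fderiv ℝ).exists_bound_of_continuous hdg
  refine ⟨G, ?_, ⟨max (3 * C1) (3 * C2), fun n x => ⟨?_, ?_⟩⟩, fun x => ⟨?_, ?_⟩⟩
  · obtain ⟨δ, hδ, hδΩ⟩ := hgc.isCompact.exists_cthickening_subset_open hΩ hgΩ
    filter_upwards [hφ.eventually (gt_mem_nhds hδ)] with n hn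
    have hz : ∀ x, x ∉ cthickening δ (tsupport g) → G n x = 0 := by
      intro x hx
      have hx0 : ∀ y ∈ ball x (φ n).rOut, g y = 0 := by
        intro y hy
        by_contra hc
        refine hx (mem_cthickening_of_dist_le x y δ _ (subset_closure hc) ?_)
        rw [dist_comm]
        exact (mem_ball.mp hy).le.trans hn.le
      have h0 := hx0 x (mem_ball_self (φ n).rOut_pos)
      have := (φ n).dist_normed_convolution_le (μ := (volume : Measure Plane)) (ε := 0)
        hg.continuous.aestronglyMeasurable
        (fun y hy => by rw [hx0 y hy, h0, dist_self])
      rw [h0] at this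
      exact dist_le_zero.mp this
    have hK : IsCompact (cthickening δ (tsupport g)) := hgc.isCompact.cthickening
    refine ⟨?_, HasCompactSupport.intro hK hz, ?_⟩
    · exact (φ n).hasCompactSupport_normed.contDiff_convolution_left _ (φ n).contDiff_normed
        hg.continuous.locallyIntegrable
    · exact (closure_minimal (s := Function.support (G n))
        (fun x hx => by_contra fun h => hx (hz x h)) hK.isClosed).trans hδΩ
  · have := (φ n).dist_normed_convolution_le (x₀ := x) (μ := (volume : Measure Plane)) (ε := 2 * C1)
      hg.continuous.aestronglyMeasurable (fun y _ => (dist_le_norm_add_norm _ _).trans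
        (by linarith [hC1 y, hC1 x]))
    refine le_max_of_le_left ?_
    have h1 := hC1 x
    rw [Real.dist_eq] at this
    have h2 := abs_sub_abs_le_abs_sub (G n x) (g x)
    rw [Real.norm_eq_abs] at h1
    have h3 : |G n x - g x| ≤ 2 * C1 := this
    linarith
  · have := (φ n).dist_normed_convolution_le (x₀ := x) (μ := (volume : Measure Plane)) (ε := 2 * C2)
      hdg.aestronglyMeasurable (fun y _ => (dist_le_norm_add_norm _ _).trans
        (by linarith [hC2 y, hC2 x]))
    refine le_max_of_le_right ?_
    have h1 := hC2 x
    rw [hfd, dist_eq_norm] at *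
    have h2 := norm_sub_norm_le (convolution ((φ n).normed volume) (fderiv ℝ g)
      (ContinuousLinearMap.lsmul ℝ ℝ) volume x) (fderiv ℝ g x)
    linarith
  · exact ContDiffBump.convolution_tendsto_right_of_continuous hφ hg.continuous x
  · simp_rw [hfd]
    exact ContDiffBump.convolution_tendsto_right_of_continuous hφ hdg x

lemma Lam_nonneg {N : ℕ} (Ω : Set (EuclideanSpace ℝ (Fin N))) (q : ℝ) : 0 ≤ Lam Ω q := by
  refine Real.sInf_nonneg ?_
  rintro r ⟨w, -, -, -, -, rfl⟩
  unfold Ray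
  have h1 : 0 ≤ ∫ x in Ω, ‖gradient w x‖ ^ 2 := integral_nonneg fun x => sq_nonneg _
  have h2 : 0 ≤ ∫ x in Ω, |w x| ^ q := integral_nonneg fun x => rpow_nonneg (abs_nonneg _) _
  positivity

lemma Lam_le_smooth {Ω : Set Plane} {q : ℝ} {w : Plane → ℝ} (hw : ContDiff ℝ (⊤ : ℕ∞) w)
    (hwc : HasCompactSupport w) (hwΩ : tsupport w ⊆ Ω) (hq : 0 < q) :
    Lam Ω q * (∫ x in Ω, |w x| ^ q) ^ (2 / q) ≤ ∫ x in Ω, ‖fderiv ℝ w x‖ ^ 2 := by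
  have h1 : 0 ≤ ∫ x in Ω, ‖fderiv ℝ w x‖ ^ 2 := integral_nonneg fun x => sq_nonneg _
  have h2 : 0 ≤ ∫ x in Ω, |w x| ^ q := integral_nonneg fun x => rpow_nonneg (abs_nonneg _) _
  rcases h2.eq_or_lt with h3 | h3
  · rw [← h3, zero_rpow (by positivity), mul_zero]
    exact h1
  · have hne : w ≠ 0 := by
      rintro rfl
      simp [zero_rpow hq.ne'] at h3
    rw [← le_div_iff₀ (by positivity)]
    have hb : BddBelow {r | ∃ w, ContDiff ℝ (⊤ : ℕ∞) w ∧ HasCompactSupport w ∧ tsupport w ⊆ Ω ∧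
        w ≠ 0 ∧ r = Ray Ω q w} := by
      refine ⟨0, ?_⟩
      rintro r ⟨w, -, -, -, -, rfl⟩
      unfold Ray
      have h1 : 0 ≤ ∫ x in Ω, ‖gradient w x‖ ^ 2 := integral_nonneg fun x => sq_nonneg _
      have h2 : 0 ≤ ∫ x in Ω, |w x| ^ q := integral_nonneg fun x => rpow_nonneg (abs_nonneg _) _
      positivity
    refine (csInf_le hb ⟨w, hw, hwc, hwΩ, hne, rfl⟩).trans (le_of_eq ?_)
    simp only [Ray, norm_gradient]

lemma Lam_le_C1 {Ω : Set Plane} (hΩ : IsOpen Ω) (hfin : volume Ω ≠ ⊤) {q : ℝ} (hq : 0 < q)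
    {g : Plane → ℝ} (hg : ContDiff ℝ 1 g) (hgc : HasCompactSupport g) (hgΩ : tsupport g ⊆ Ω) :
    Lam Ω q * (∫ x in Ω, |g x| ^ q) ^ (2 / q) ≤ ∫ x in Ω, ‖fderiv ℝ g x‖ ^ 2 := by
  obtain ⟨G, hG, ⟨C, hC⟩, hl⟩ := exists_mollify hΩ hg hgc hgΩ
  have : IsFiniteMeasure ((volume : Measure Plane).restrict Ω) :=
    isFiniteMeasure_restrict.mpr hfin
  have hGm : ∀ᶠ n in atTop, Continuous (G n) ∧ Continuous (fderiv ℝ (G n)) := by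
    filter_upwards [hG] with n hn
    exact ⟨hn.1.continuous, hn.1.continuous_fderiv (by simp)⟩
  have l1 : Tendsto (fun n => ∫ x in Ω, |G n x| ^ q) atTop (𝓝 (∫ x in Ω, |g x| ^ q)) := by
    refine tendsto_integral_filter_of_dominated_convergence (fun _ => C ^ q) ?_ ?_
      (integrable_const _) (ae_of_all _ fun x => ((hl x).1.abs).rpow_const (Or.inr hq.le))
    · filter_upwards [hGm] with n hn
      exact (hn.1.abs.rpow_const fun x => Or.inr hq.le).aestronglyMeasurable
    · refine Eventually.of_forall fun n => ae_of_all _ fun x => ?_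
      rw [Real.norm_of_nonneg (rpow_nonneg (abs_nonneg _) _)]
      exact rpow_le_rpow (abs_nonneg _) (hC n x).1 hq.le
  have l2 : Tendsto (fun n => ∫ x in Ω, ‖fderiv ℝ (G n) x‖ ^ 2) atTop
      (𝓝 (∫ x in Ω, ‖fderiv ℝ g x‖ ^ 2)) := by
    refine tendsto_integral_filter_of_dominated_convergence (fun _ => C ^ 2) ?_ ?_
      (integrable_const _) (ae_of_all _ fun x => ((hl x).2.norm).pow 2)
    · filter_upwards [hGm] with n hn
      exact (hn.2.norm.pow 2).aestronglyMeasurable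
    · refine Eventually.of_forall fun n => ae_of_all _ fun x => ?_
      rw [Real.norm_of_nonneg (sq_nonneg _)]
      exact pow_le_pow_left₀ (norm_nonneg _) (hC n x).2 2
  refine le_of_tendsto_of_tendsto ((l1.rpow_const (Or.inr (by positivity))).const_mul _) l2 ?_
  filter_upwards [hG] with n hn using Lam_le_smooth hn.1 hn.2.1 hn.2.2 hq

lemma exists_truncation : ∃ φ : ℕ → ℝ → ℝ, (∀ n, ContDiff ℝ 1 (φ n)) ∧
    (∀ n t, 0 ≤ φ n t ∧ φ n t ≤ max t 0) ∧ (∀ n t, |deriv (φ n) t| ≤ 1) ∧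
    (∀ n, ∃ s > 0, ∀ t ≤ s, φ n t = 0) ∧ ∀ t, Tendsto (fun n => φ n t) atTop (𝓝 (max t 0)) := by
  let χ : ℕ → ℝ → ℝ := fun n => ramp (1 / ((n : ℝ) + 1)) ((n + 1) ^ 2)
  let φ : ℕ → ℝ → ℝ := fun n t => ∫ r in (1 / ((n : ℝ) + 1))..t, χ n r
  have hχc : ∀ n, Continuous (χ n) := fun n => continuous_ramp _ _
  have hχ0 : ∀ (n : ℕ) (t : ℝ), t ≤ 1 / ((n : ℝ) + 1) → χ n t = 0 := fun n t ht => ramp_of_le _ ht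
  have hf := fun n => primitive_facts (hχc n) (hχ0 n)
  have hspos : ∀ n : ℕ, 0 < 1 / ((n : ℝ) + 1) := fun n => by positivity
  have hφ0 : ∀ n t, φ n t = ∫ r in (0 : ℝ)..t, χ n r := fun n t => by
    have h1 := intervalIntegral.integral_add_adjacent_intervals (μ := volume)
      ((hχc n).intervalIntegrable 0 (1 / ((n : ℝ) + 1)))
      ((hχc n).intervalIntegrable (1 / ((n : ℝ) + 1)) t)
    have h2 : ∫ r in (0 : ℝ)..(1 / ((n : ℝ) + 1)), χ n r = 0 := by
      rw [intervalIntegral.integral_of_le (hspos n).le]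
      exact setIntegral_eq_zero_of_forall_eq_zero fun x hx => hχ0 n x hx.2
    rw [h2, zero_add] at h1
    exact h1
  have hneg : ∀ n t, t ≤ 0 → φ n t = 0 := fun n t ht => (hf n).2.2 t (ht.trans (hspos n).le)
  refine ⟨φ, fun n => (hf n).1, fun n t => ?_, fun n t => ?_, fun n => ⟨_, hspos n, (hf n).2.2⟩,
    fun t => ?_⟩
  · rcases le_total t 0 with ht | ht
    · rw [hneg n t ht, max_eq_right ht]
      exact ⟨le_rfl, le_rfl⟩
    · rw [hφ0, max_eq_left ht]
      refine ⟨intervalIntegral.integral_nonneg ht fun r _ => ramp_nonneg _ _ _, ?_⟩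
      have := intervalIntegral.integral_mono_on (μ := volume) ht ((hχc n).intervalIntegrable 0 t)
        (intervalIntegrable_const (c := (1 : ℝ))) fun r _ => ramp_le_one _ _ _
      simpa using this
  · rw [(hf n).2.1, abs_of_nonneg (ramp_nonneg _ _ _)]
    exact ramp_le_one _ _ _
  · rcases le_total t 0 with ht | ht
    · simp_rw [hneg _ t ht, max_eq_right ht]
      exact tendsto_const_nhds
    · simp_rw [hφ0, max_eq_left ht]
      have e : ∫ _ in (0 : ℝ)..t, (1 : ℝ) = t := by simp
      nth_rewrite 2 [← e]
      refine intervalIntegral.tendsto_integral_filter_of_dominated_convergence (fun _ => 1)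
        (Eventually.of_forall fun n => (hχc n).aestronglyMeasurable)
        (Eventually.of_forall fun n => ae_of_all _ fun r _ => ?_) intervalIntegrable_const
        (ae_of_all _ fun r hr => ?_)
      · rw [Real.norm_of_nonneg (ramp_nonneg _ _ _)]
        exact ramp_le_one _ _ _
      · rw [uIoc_of_le ht] at hr
        have hr0 : 0 < r := hr.1
        refine tendsto_const_nhds.congr' ?_
        obtain ⟨N, hN⟩ := exists_nat_gt (2 / r)
        filter_upwards [eventually_ge_atTop N] with n hn
        have hn1 : (N : ℝ) ≤ n := by exact_mod_cast hn
        have h2 : 2 ≤ ((n : ℝ) + 1) * r := by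
          rw [div_lt_iff₀ hr0] at hN
          nlinarith
        have h3 : (0 : ℝ) ≤ n := n.cast_nonneg
        simp only [χ, ramp]
        rw [min_eq_left]
        refine le_max_of_le_right ?_
        push_cast
        have e : ((n : ℝ) + 1) ^ 2 * (r - 1 / ((n : ℝ) + 1)) = ((n : ℝ) + 1) * (((n : ℝ) + 1) * r - 1) := by
          field_simp
        rw [e]
        nlinarith

lemma SuperH.Lam_le {Ω : Set Plane} {u : Plane → ℝ} (h : SuperH Ω u) {q : ℝ} (hq : 0 < q)
    {E : ℝ} (hE : 0 ≤ E)
    (hu : ∫⁻ x in Ω ∩ {x | 0 < u x}, ENNReal.ofReal (‖fderiv ℝ u x‖ ^ 2) ≤ ENNReal.ofReal E) :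
    Lam Ω q * (∫ x in Ω, max (u x) 0 ^ q) ^ (2 / q) ≤ E := by
  obtain ⟨φ, hφ1, hφb, hφd, hφs, hφl⟩ := exists_truncation
  have hfin : volume Ω ≠ ⊤ := h.bdd.measure_lt_top.ne
  have : IsFiniteMeasure ((volume : Measure Plane).restrict Ω) :=
    isFiniteMeasure_restrict.mpr hfin
  obtain ⟨B, hB⟩ := h.exists_bound
  have l1 : Tendsto (fun n => ∫ x in Ω, |φ n (u x)| ^ q) atTop
      (𝓝 (∫ x in Ω, max (u x) 0 ^ q)) := by
    refine tendsto_integral_filter_of_dominated_convergence (fun _ => max B 0 ^ q) ?_ ?_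
      (integrable_const _) (ae_of_all _ fun x => ?_)
    · refine Eventually.of_forall fun n => ?_
      exact (((hφ1 n).continuous.measurable.comp h.meas).norm.pow_const q).aestronglyMeasurable
    · refine Eventually.of_forall fun n => ?_
      filter_upwards [ae_restrict_mem h.isOpen.measurableSet] with x hx
      rw [Real.norm_of_nonneg (rpow_nonneg (abs_nonneg _) _), abs_of_nonneg (hφb n _).1]
      exact rpow_le_rpow (hφb n _).1
        ((hφb n _).2.trans (max_le_max_right _ (hB x hx))) hq.le
    · have := ((hφl (u x)).abs).rpow_const (p := q) (Or.inr hq.le)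
      rwa [abs_of_nonneg (le_max_right (u x) 0)] at this
  refine le_of_tendsto ((l1.rpow_const (Or.inr (by positivity))).const_mul _)
    (Eventually.of_forall fun n => ?_)
  obtain ⟨s, hs, hs0⟩ := hφs n
  have hz : ∀ x ∈ Ω, x ∉ Ω ∩ {x | s ≤ u x} → φ n (u x) = 0 := fun x hx hxK => by
    refine hs0 _ (le_of_lt ?_)
    by_contra hc
    exact hxK ⟨hx, not_lt.mp hc⟩
  obtain ⟨g1, g2, g3⟩ := contDiff_indicator h.isOpen (h.isCompact_superlevel hs) inter_subset_left
    ((hφ1 n).comp_contDiffOn (h.smooth.of_le (by norm_num))) hz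
  have key := Lam_le_C1 h.isOpen hfin hq g1 g2 (g3.trans inter_subset_left)
  have e1 : ∫ x in Ω, |Ω.indicator (φ n ∘ u) x| ^ q = ∫ x in Ω, |φ n (u x)| ^ q :=
    setIntegral_congr_fun h.isOpen.measurableSet fun x hx => by
      simp only [indicator_of_mem hx, Function.comp]
  rw [e1] at key
  refine key.trans ?_
  rw [integral_eq_lintegral_of_nonneg_ae (ae_of_all _ fun x => sq_nonneg _)
    ((g1.continuous_fderiv one_ne_zero).norm.pow 2).aestronglyMeasurable]
  refine ENNReal.toReal_le_of_le_ofReal hE (le_trans ?_ hu)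
  rw [← lintegral_indicator h.isOpen.measurableSet,
    ← lintegral_indicator (h.measurableSet_superlevel 0)]
  refine lintegral_mono fun x => ?_
  by_cases hx : x ∈ Ω
  swap
  · simp [indicator_of_notMem hx]
  rw [indicator_of_mem hx]
  have hnh := h.isOpen.mem_nhds hx
  have hux : DifferentiableAt ℝ u x := (h.smooth.contDiffAt hnh).differentiableAt (by norm_num)
  have h2 : HasFDerivAt (φ n ∘ u) (deriv (φ n) (u x) • fderiv ℝ u x) x :=
    ((hφ1 n).differentiable one_ne_zero _).hasDerivAt.comp_hasFDerivAt x hux.hasFDerivAt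
  have h3 : Ω.indicator (φ n ∘ u) =ᶠ[𝓝 x] φ n ∘ u := by
    filter_upwards [hnh] with y hy using indicator_of_mem hy _
  rw [h3.fderiv_eq, h2.fderiv, norm_smul, Real.norm_eq_abs]
  by_cases hx0 : 0 < u x
  · rw [indicator_of_mem (show x ∈ Ω ∩ {x | 0 < u x} from ⟨hx, hx0⟩)]
    refine ENNReal.ofReal_le_ofReal (pow_le_pow_left₀ (by positivity) ?_ 2)
    exact mul_le_of_le_one_left (norm_nonneg _) (hφd n _)
  · have : φ n =ᶠ[𝓝 (u x)] fun _ => 0 := by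
      filter_upwards [Iio_mem_nhds ((not_lt.mp hx0).trans_lt hs)] with r hr using hs0 r (le_of_lt hr)
    rw [this.deriv_eq, deriv_const]
    simp

lemma lam0_facts {Ω : Set Plane} {p lam I : ℝ} (hp : 1 ≤ p) (hl : 0 < lam) (hI : 0 < I)
    (hR : Lam Ω (p + 1) ≤ lam * I ^ ((p - 1) / (p + 1))) (hJ : 8 * π * I ≤ (p + 1) * lam) :
    lam0 Ω p ≤ lam ∧ (lam = lam0 Ω p ↔ Lam Ω (p + 1) = lam * I ^ ((p - 1) / (p + 1)) ∧
      (p = 1 ∨ 8 * π * I = (p + 1) * lam)) := by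
  have hΛ := Lam_nonneg Ω (p + 1)
  set θ := (p - 1) / (2 * p) with hθ
  set κ := (p + 1) / (2 * p) with hκ
  set R := lam * I ^ ((p - 1) / (p + 1)) with hRdef
  set K := 8 * π * I / (p + 1) with hK
  have hκ0 : 0 < κ := by positivity
  have hθ0 : 0 ≤ θ := div_nonneg (by linarith) (by linarith)
  have hsum : θ + κ = 1 := by rw [hθ, hκ]; field_simp; ring
  have hR0 : 0 < R := by positivity
  have hRκ : (8 * π / (p + 1)) ^ θ * R ^ κ = K ^ θ * lam ^ κ := by
    rw [hRdef, mul_rpow hl.le (by positivity), ← rpow_mul hI.le,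
      show (p - 1) / (p + 1) * κ = θ by rw [hθ, hκ]; field_simp,
      show K = 8 * π / (p + 1) * I by rw [hK]; ring, mul_rpow (by positivity) hI.le]
    ring
  have hlam : lam ^ θ * lam ^ κ = lam := by rw [← rpow_add hl, hsum, rpow_one]
  have hKl : K ≤ lam := by rw [hK, div_le_iff₀ (by linarith)]; linarith
  have hK0 : 0 < K := by positivity
  have hc : 0 < (8 * π / (p + 1)) ^ θ := by positivity
  have hlκ : 0 < lam ^ κ := by positivity
  have s1 : lam0 Ω p ≤ K ^ θ * lam ^ κ := by
    rw [← hRκ]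
    exact mul_le_mul_of_nonneg_left (rpow_le_rpow hΛ hR hκ0.le) hc.le
  have s2 : K ^ θ * lam ^ κ ≤ lam := by
    nth_rewrite 2 [← hlam]
    exact mul_le_mul_of_nonneg_right (rpow_le_rpow hK0.le hKl hθ0) hlκ.le
  refine ⟨s1.trans s2, fun he => ⟨?_, ?_⟩, fun ⟨h1, h2⟩ => ?_⟩
  · by_contra hne
    have hlt := lt_of_le_of_ne hR hne
    have : lam0 Ω p < K ^ θ * lam ^ κ := by
      rw [← hRκ]
      exact mul_lt_mul_of_pos_left (rpow_lt_rpow hΛ hlt hκ0) hc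
    linarith
  · by_contra! hne
    have hθ1 : 0 < θ := div_pos (by linarith [lt_of_le_of_ne hp (Ne.symm hne.1)]) (by linarith)
    have hK1 : K < lam := by
      refine lt_of_le_of_ne hKl fun hc => hne.2 ?_
      rw [← hc, hK]
      field_simp
    have : K ^ θ * lam ^ κ < lam := by
      nth_rewrite 2 [← hlam]
      exact mul_lt_mul_of_pos_right (rpow_lt_rpow hK0.le hK1 hθ1) hlκ
    linarith
  · have e1 : lam0 Ω p = K ^ θ * lam ^ κ := by rw [← hRκ, ← h1]; rfl
    rw [e1]
    nth_rewrite 1 [← hlam]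
    congr 1
    rcases h2 with h2 | h2
    · rw [hθ, h2]; simp
    · rw [hK, h2, mul_div_cancel_left₀ _ (by linarith)]

namespace Sol
open SuperH
variable {Ω : Set Plane} {u : Plane → ℝ} {p lam : ℝ}

lemma En_pos (h : Sol Ω u p lam) : 0 < En Ω u p := by
  have hp := h.one_le
  refine lt_of_le_of_ne (En_nonneg _ _ _) fun h0 => ?_
  have h1 := h.ofReal_En
  rw [← h0, ENNReal.ofReal_zero, eq_comm,
    lintegral_eq_zero_iff (h.measurable_pow _).ennreal_ofReal] at h1
  have h2 := h.constr
  rw [lintegral_congr_ae (g := fun _ => 0)] at h2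
  · simp at h2
  · filter_upwards [h1] with x hx
    have hx1 : max (u x) 0 ^ (p + 1) = 0 :=
      le_antisymm (ENNReal.ofReal_eq_zero.mp hx) (pow_nonneg u _ x)
    rw [(rpow_eq_zero (le_max_right _ _) (by linarith)).mp hx1, zero_rpow (by linarith),
      ENNReal.ofReal_zero]

lemma Lam_le_ratio (h : Sol Ω u p lam) :
    Lam Ω (p + 1) ≤ lam * En Ω u p ^ ((p - 1) / (p + 1)) := by
  have hp := h.one_le
  have hl := h.lam_pos
  have hI := h.En_pos
  have h1 := h.Lam_le (q := p + 1) (by linarith) (E := lam * En Ω u p) (by positivity) h.energy.le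
  change Lam Ω (p + 1) * En Ω u p ^ (2 / (p + 1)) ≤ _ at h1
  have h2 : En Ω u p = En Ω u p ^ ((p - 1) / (p + 1)) * En Ω u p ^ (2 / (p + 1)) := by
    rw [← rpow_add hI, ← add_div, show p - 1 + 2 = p + 1 by ring, div_self (by linarith), rpow_one]
  nth_rewrite 2 [h2] at h1
  rw [← mul_assoc] at h1
  exact le_of_mul_le_mul_right h1 (by positivity)

lemma shift (h : Sol Ω u p lam) {δ : ℝ} (hδ : ∀ x ∈ frontier Ω, u x ≤ -δ) :
    SuperH Ω fun x => u x + δ where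
  isOpen := h.isOpen
  meas := h.meas.add_const δ
  bdd := h.bdd
  contOn := h.contOn.add continuousOn_const
  smooth := h.smooth.add contDiffOn_const
  bdry x hx := by linarith [hδ x hx]
  super x hx := by
    have : lap (fun x => u x + δ) = lap u := by
      ext x; simp [lap, fderiv_add_const]
    rw [this]
    exact h.super x hx

lemma En_shift_le (h : Sol Ω u p lam) {δ : ℝ} (hδ : 0 ≤ δ) :
    En Ω u p + (p + 1) * δ ≤ ∫ x in Ω, max (u x + δ) 0 ^ (p + 1) := by
  have hp := h.one_le
  have i1 := h.integrableOn_pow (q := p + 1) (by linarith)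
  have i2 := h.integrableOn_pow (q := p) (by linarith)
  have i3 : IntegrableOn (fun x => max (u x + δ) 0 ^ (p + 1)) Ω := by
    have hK := isCompact_of_isClosed_isBounded isClosed_closure h.bdd.closure
    refine (ContinuousOn.integrableOn_compact hK ?_).mono_set subset_closure
    exact ((h.contOn.add continuousOn_const).sup continuousOn_const).rpow_const
      fun x _ => Or.inr (by linarith)
  have e : ∫ x in Ω, max (u x) 0 ^ p = 1 := by
    rw [integral_eq_lintegral_of_nonneg_ae (ae_of_all _ fun x => pow_nonneg u _ x)
      (h.measurable_pow p).aestronglyMeasurable, h.constr, ENNReal.toReal_one]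
  have e2 : En Ω u p + (p + 1) * δ =
      ∫ x in Ω, (max (u x) 0 ^ (p + 1) + (p + 1) * δ * max (u x) 0 ^ p) := by
    rw [integral_add i1 (i2.const_mul _), integral_const_mul, e, mul_one, En]
  rw [e2]
  refine setIntegral_mono (i1.add (i2.const_mul _)) i3 fun x => ?_
  by_cases hx : 0 < u x
  · simp only
    rw [max_eq_left hx.le, max_eq_left (by linarith)]
    have hb := one_add_mul_self_le_rpow_one_add (s := δ / u x) (p := p + 1)
      (by have : 0 ≤ δ / u x := by positivity
          linarith) (by linarith)
    have h1 : u x + δ = u x * (1 + δ / u x) := by field_simp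
    rw [h1, mul_rpow hx.le (by positivity)]
    refine le_trans (le_of_eq ?_) (mul_le_mul_of_nonneg_left hb (by positivity))
    rw [rpow_add_one hx.ne']
    field_simp
  · simp only
    rw [max_eq_right (not_lt.mp hx), zero_rpow (by linarith), zero_rpow (by linarith), mul_zero,
      add_zero]
    positivity

lemma Lam_lt_ratio (h : Sol Ω u p lam) {ε : ℝ} (hε : 0 < ε) (hb : ∀ x ∈ frontier Ω, u x ≤ -ε) :
    Lam Ω (p + 1) < lam * En Ω u p ^ ((p - 1) / (p + 1)) := by
  have hp := h.one_le
  have hl := h.lam_pos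
  have hI := h.En_pos
  set I := En Ω u p with hIdef
  obtain ⟨δ, hδ0, hδε, hδI⟩ : ∃ δ, 0 < δ ∧ δ ≤ ε ∧ (p + 1) * (δ / I) / 2 < 1 := by
    refine ⟨min ε (I / (p + 1)), lt_min hε (by positivity), min_le_left _ _, ?_⟩
    have h1 : min ε (I / (p + 1)) / I ≤ 1 / (p + 1) := by
      rw [div_le_iff₀ hI]
      exact (min_le_right _ _).trans (le_of_eq (by ring))
    have h2 : (p + 1) * (min ε (I / (p + 1)) / I) ≤ 1 := by
      refine (mul_le_mul_of_nonneg_left h1 (by linarith)).trans (le_of_eq ?_)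
      field_simp
    linarith
  have hs := h.shift (δ := δ) fun x hx => (hb x hx).trans (by linarith)
  have h1 := hs.Lam_le (q := p + 1) (by linarith) (E := lam * (I + δ)) (by positivity)
    (by simpa only [fderiv_add_const] using (h.energy_shift hδ0.le hs).le)
  by_contra! hc
  set x := δ / I with hx
  have hx0 : 0 < x := by positivity
  have hδx : δ = I * x := by rw [hx]; field_simp
  have hE := h.En_shift_le hδ0.le
  rw [← hIdef] at hE
  have h2 : (I * (1 + (p + 1) * x)) ^ (2 / (p + 1)) ≤
      (∫ x in Ω, max (u x + δ) 0 ^ (p + 1)) ^ (2 / (p + 1)) := by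
    refine rpow_le_rpow (by positivity) (le_trans (le_of_eq ?_) hE) (by positivity)
    rw [hδx]; ring
  have h3 : lam * I ^ ((p - 1) / (p + 1)) * (I * (1 + (p + 1) * x)) ^ (2 / (p + 1)) ≤
      lam * (I + δ) :=
    (mul_le_mul hc h2 (by positivity) (Lam_nonneg _ _)).trans h1
  have hIe : I ^ ((p - 1) / (p + 1)) * I ^ (2 / (p + 1)) = I := by
    rw [← rpow_add hI, ← add_div, show p - 1 + 2 = p + 1 by ring, div_self (by linarith), rpow_one]
  rw [mul_rpow hI.le (by positivity)] at h3
  have h4 : lam * I * (1 + (p + 1) * x) ^ (2 / (p + 1)) ≤ lam * I * (1 + x) := by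
    calc _ = lam * (I ^ ((p - 1) / (p + 1)) * I ^ (2 / (p + 1))) *
          (1 + (p + 1) * x) ^ (2 / (p + 1)) := by rw [hIe]
      _ ≤ lam * (I + δ) := by linarith
      _ = _ := by rw [hδx]; ring
  have h5 := le_of_mul_le_mul_left h4 (by positivity)
  have h6 := rpow_le_rpow (by positivity) h5 (show 0 ≤ (p + 1) / 2 by linarith)
  rw [← rpow_mul (by positivity), show 2 / (p + 1) * ((p + 1) / 2) = 1 by field_simp,
    rpow_one] at h6
  have h7 : (1 + x) ^ ((p + 1) / 2) ≤ exp ((p + 1) * x / 2) := by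
    rw [show (p + 1) * x / 2 = x * ((p + 1) / 2) by ring, exp_mul]
    refine rpow_le_rpow (by positivity) ?_ (by linarith)
    linarith [add_one_le_exp x]
  set y := (p + 1) * x / 2 with hy
  have hy0 : 0 < y := by positivity
  have h8 := (abs_le.mp (abs_exp_sub_one_sub_id_le (x := y) (by rw [abs_of_pos hy0]; exact hδI.le))).2
  nlinarith

end Sol

lemma ContDiffAt.differentiableAt_fderiv_two {f : Plane → ℝ} {x : Plane} (hf : ContDiffAt ℝ 2 f x) :
    DifferentiableAt ℝ (fderiv ℝ f) x :=
  (hf.fderiv_right (m := 1) (by norm_num)).differentiableAt one_ne_zero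

lemma lap_eq_sum {f : Plane → ℝ} {x : Plane} (hf : ContDiffAt ℝ 2 f x) :
    lap f x = ∑ i : Fin 2, fderiv ℝ (fderiv ℝ f) x (EuclideanSpace.single i 1)
      (EuclideanSpace.single i 1) := by
  unfold lap
  refine Finset.sum_congr rfl fun i _ => ?_
  have h1 := hf.differentiableAt_fderiv_two.hasFDerivAt.clm_apply
    (hasFDerivAt_const (EuclideanSpace.single i (1 : ℝ) : Plane) x)
  rw [h1.fderiv]
  simp

lemma lap_eq_laplacian {f : Plane → ℝ} {x : Plane} (hf : ContDiffAt ℝ 2 f x) :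
    lap f x = Laplacian.laplacian f x := by
  rw [lap_eq_sum hf, InnerProductSpace.laplacian_eq_iteratedFDeriv_orthonormalBasis f
    (EuclideanSpace.basisFun (Fin 2) ℝ)]
  refine Finset.sum_congr rfl fun i _ => ?_
  rw [iteratedFDeriv_two_apply]
  simp

lemma lap_sub {f g : Plane → ℝ} {x : Plane} (hf : ContDiffAt ℝ 2 f x) (hg : ContDiffAt ℝ 2 g x) :
    lap (fun y => f y - g y) x = lap f x - lap g x := by
  rw [lap_eq_laplacian hf, lap_eq_laplacian hg, ← hf.laplacian_sub hg]
  exact lap_eq_laplacian (hf.sub hg)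

lemma lap_add {f g : Plane → ℝ} {x : Plane} (hf : ContDiffAt ℝ 2 f x) (hg : ContDiffAt ℝ 2 g x) :
    lap (fun y => f y + g y) x = lap f x + lap g x := by
  rw [lap_eq_laplacian hf, lap_eq_laplacian hg, ← hf.laplacian_add hg]
  exact lap_eq_laplacian (hf.add hg)

lemma lap_const_mul {f : Plane → ℝ} {x : Plane} (hf : ContDiffAt ℝ 2 f x) (c : ℝ) :
    lap (fun y => c * f y) x = c * lap f x := by
  rw [lap_eq_laplacian hf, lap_eq_laplacian (contDiffAt_const.mul hf)]
  exact InnerProductSpace.laplacian_smul c hf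

lemma lap_const (a : ℝ) (x : Plane) : lap (fun _ => a) x = 0 := by
  simp [lap]

lemma lap_norm_sq (c x : Plane) : lap (fun y => ‖y - c‖ ^ 2) x = 4 := by
  have h1 : ∀ y, HasFDerivAt (fun y : Plane => ‖y - c‖ ^ 2) (2 • innerSL ℝ (y - c)) y := fun y => by
    simpa using ((hasFDerivAt_id y).sub_const c).norm_sq
  unfold lap
  have h2 : ∀ i : Fin 2, fderiv ℝ (fun y => fderiv ℝ (fun y : Plane => ‖y - c‖ ^ 2) y
      (EuclideanSpace.single i 1)) x (EuclideanSpace.single i 1) = 2 := fun i => by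
    have : (fun y => fderiv ℝ (fun y : Plane => ‖y - c‖ ^ 2) y (EuclideanSpace.single i 1)) =
        fun y => 2 * (y i - c i) := by
      ext y
      rw [(h1 y).fderiv]
      simp [EuclideanSpace.inner_single_right]
    rw [this]
    have h3 : HasFDerivAt (fun y : Plane => 2 * (y i - c i))
        ((2 : ℝ) • (EuclideanSpace.proj i : Plane →L[ℝ] ℝ)) x :=
      (((EuclideanSpace.proj i : Plane →L[ℝ] ℝ).hasFDerivAt).sub_const (c i)).const_mul 2
    rw [h3.fderiv]
    simp
  simp_rw [h2]
  norm_num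

/-- Second derivative test at an interior minimum. -/
lemma IsLocalMin.lap_nonneg {v : Plane → ℝ} {x : Plane} (hv : ContDiffAt ℝ 2 v x)
    (hm : IsLocalMin v x) : 0 ≤ lap v x := by
  refine Finset.sum_nonneg fun i _ => ?_
  set e : Plane := EuclideanSpace.single i 1 with he
  set f : ℝ → ℝ := fun t => v (x + t • e) with hf
  have hl : ∀ t, HasDerivAt (fun t : ℝ => x + t • e) e t := fun t => by
    simpa using ((hasDerivAt_id t).smul_const e).const_add x
  have hcont : ContinuousAt (fun t : ℝ => x + t • e) 0 := (hl 0).continuousAt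
  have hx0 : x + (0 : ℝ) • e = x := by simp
  have hev : ∀ᶠ y in 𝓝 x, ContDiffAt ℝ 2 v y := hv.eventually (by simp)
  have htend : Tendsto (fun t : ℝ => x + t • e) (𝓝 0) (𝓝 x) := by
    simpa [ContinuousAt] using hcont
  have hd1 : ∀ᶠ t in 𝓝 (0 : ℝ), deriv f t = fderiv ℝ v (x + t • e) e := by
    filter_upwards [htend.eventually hev] with t ht
    exact ((ht.differentiableAt (by norm_num)).hasFDerivAt.comp_hasDerivAt t (hl t)).deriv
  have hg : DifferentiableAt ℝ (fun y => fderiv ℝ v y e) x :=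
    hv.differentiableAt_fderiv_two.clm_apply (differentiableAt_const _)
  have hd2 : deriv (deriv f) 0 = fderiv ℝ (fun y => fderiv ℝ v y e) x e := by
    rw [EventuallyEq.deriv_eq hd1]
    have : HasFDerivAt (fun y => fderiv ℝ v y e) (fderiv ℝ (fun y => fderiv ℝ v y e) x)
        (x + (0 : ℝ) • e) := by rw [hx0]; exact hg.hasFDerivAt
    exact (this.comp_hasDerivAt 0 (hl 0)).deriv
  rw [← hd2]
  by_contra! hneg
  have hfm : IsLocalMin f 0 := by
    have : IsLocalMin f 0 ↔ ∀ᶠ t in 𝓝 (0 : ℝ), v (x + (0 : ℝ) • e) ≤ v (x + t • e) := Iff.rfl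
    rw [this, hx0]
    exact htend.eventually hm
  have hfc : ContinuousAt f 0 := by
    have : ContinuousAt v (x + (0 : ℝ) • e) := by rw [hx0]; exact hv.continuousAt
    exact ContinuousAt.comp (f := fun t : ℝ => x + t • e) this hcont
  have hM := isLocalMax_of_deriv_deriv_neg hneg hfm.deriv_eq_zero hfc
  have heq : f =ᶠ[𝓝 0] fun _ => f 0 := by
    filter_upwards [hM, hfm] with t h1 h2 using le_antisymm h1 h2
  have h3 : deriv f =ᶠ[𝓝 0] fun _ => 0 := by
    filter_upwards [heq.eventuallyEq_nhds] with t ht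
    rw [ht.deriv_eq, deriv_const]
  rw [h3.deriv_eq, deriv_const] at hneg
  exact lt_irrefl _ hneg

/-- The weak minimum principle. -/
lemma min_principle {Ω : Set Plane} (hΩ : IsOpen Ω) (hb : Bornology.IsBounded Ω) {w : Plane → ℝ}
    (hc : ContinuousOn w (closure Ω)) (hs : ContDiffOn ℝ 2 w Ω) (hl : ∀ x ∈ Ω, lap w x ≤ 0)
    (hf : ∀ x ∈ frontier Ω, 0 ≤ w x) {x : Plane} (hx : x ∈ closure Ω) : 0 ≤ w x := by
  by_contra! hneg
  have hK := isCompact_of_isClosed_isBounded isClosed_closure hb.closure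
  obtain ⟨B, hB0, hB⟩ := hb.closure.exists_pos_norm_le
  set ε := -w x / (2 * B ^ 2) with hε
  have hε0 : 0 < ε := div_pos (by linarith) (by positivity)
  have hεB : ε * B ^ 2 = -w x / 2 := by rw [hε]; field_simp
  set v : Plane → ℝ := fun y => w y - ε * ‖y - 0‖ ^ 2 with hv
  have hvc : ContinuousOn v (closure Ω) := hc.sub (by fun_prop)
  obtain ⟨y, hy, hmin⟩ := hK.exists_isMinOn ⟨x, hx⟩ hvc
  have h1 : v y ≤ v x := hmin hx
  have h2 : v x ≤ w x := by simp only [hv]; nlinarith [sq_nonneg ‖x - 0‖]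
  have hyB : ‖y - 0‖ ^ 2 ≤ B ^ 2 := by
    rw [sub_zero]; exact pow_le_pow_left₀ (norm_nonneg _) (hB y hy) 2
  have hyw : w y < 0 := by
    have : ε * ‖y - 0‖ ^ 2 ≤ ε * B ^ 2 := by gcongr
    have : w y - ε * ‖y - 0‖ ^ 2 ≤ w x := h1.trans h2
    linarith
  have hyΩ : y ∈ Ω := by
    by_contra hc
    exact absurd (hf y ⟨hy, by rwa [hΩ.interior_eq]⟩) (not_le.mpr hyw)
  have hn := hΩ.mem_nhds hyΩ
  have hwd := hs.contDiffAt hn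
  have hnd : ContDiffAt ℝ 2 (fun y : Plane => ‖y - 0‖ ^ 2) y :=
    ((contDiff_id.sub contDiff_const).norm_sq ℝ).contDiffAt
  have hloc : IsLocalMin v y := by
    filter_upwards [hn] with z hz using hmin (subset_closure hz)
  have h3 := hloc.lap_nonneg (hwd.sub (contDiffAt_const.mul hnd))
  have h4 : lap v y = lap w y - ε * 4 := by
    rw [hv, lap_sub hwd (contDiffAt_const.mul hnd), lap_const_mul hnd, lap_norm_sq]
  linarith [hl y hyΩ]

lemma lap_congr {f g : Plane → ℝ} {x : Plane} (h : f =ᶠ[𝓝 x] g) : lap f x = lap g x := by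
  unfold lap
  refine Finset.sum_congr rfl fun i _ => ?_
  have : (fun y => fderiv ℝ f y (EuclideanSpace.single i 1)) =ᶠ[𝓝 x]
      fun y => fderiv ℝ g y (EuclideanSpace.single i 1) := by
    filter_upwards [h.eventuallyEq_nhds] with y hy
    rw [hy.fderiv_eq]
  rw [this.fderiv_eq]

/-- The plasma function `α + λψ`, extended by zero. -/
def plasma (Ω : Set Plane) (lam α : ℝ) (ψ : Plane → ℝ) : Plane → ℝ :=
  (closure Ω).indicator fun x => α + lam * ψ x

section
variable {Ω : Set Plane} {p lam α : ℝ} {ψ : Plane → ℝ}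

lemma plasma_eq {x : Plane} (hx : x ∈ closure Ω) : plasma Ω lam α ψ x = α + lam * ψ x :=
  indicator_of_mem hx _

lemma plasma_eventuallyEq (hΩ : IsOpen Ω) {x : Plane} (hx : x ∈ Ω) :
    plasma Ω lam α ψ =ᶠ[𝓝 x] fun x => α + lam * ψ x := by
  filter_upwards [hΩ.mem_nhds hx] with y hy using plasma_eq (subset_closure hy)

lemma IsSol.sol (hsol : IsSol Ω p lam α ψ) (hΩ : IsOpen Ω) (hb : Bornology.IsBounded Ω)
    (hp : 1 ≤ p) (hlam : 0 < lam) (hα : α ≤ 0) : Sol Ω (plasma Ω lam α ψ) p lam := by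
  have hc : ContinuousOn (fun x => α + lam * ψ x) (closure Ω) :=
    continuousOn_const.add (continuousOn_const.mul hsol.contOn)
  have hcu : ContinuousOn (plasma Ω lam α ψ) (closure Ω) := hc.congr fun x hx => plasma_eq hx
  have hpde : ∀ x ∈ Ω, -lap (plasma Ω lam α ψ) x = lam * max (plasma Ω lam α ψ x) 0 ^ p := by
    intro x hx
    have hψ := hsol.smooth.contDiffAt (hΩ.mem_nhds hx)
    rw [lap_congr (plasma_eventuallyEq hΩ hx), lap_add contDiffAt_const (contDiffAt_const.mul hψ),
      lap_const, lap_const_mul hψ, plasma_eq (subset_closure hx), ← hsol.pde x hx]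
    ring
  refine ⟨⟨hΩ, ?_, hb, hcu, ?_, ?_, ?_⟩, hp, hlam, hpde, ?_⟩
  · classical
    rw [plasma, ← piecewise_eq_indicator]
    exact hc.measurable_piecewise continuousOn_const isClosed_closure.measurableSet
  · exact (contDiffOn_const.add (contDiffOn_const.mul hsol.smooth)).congr
      fun x hx => plasma_eq (subset_closure hx)
  · intro x hx
    rw [plasma_eq hx.1, hsol.bdry x hx]
    linarith
  · intro x hx
    rw [hpde x hx]
    have := rpow_nonneg (le_max_right (plasma Ω lam α ψ x) 0) p
    positivity
  · have hi : IntegrableOn (fun x => max (α + lam * ψ x) 0 ^ p) Ω := by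
      by_contra hcon
      have h1 := hsol.constr
      rw [integral_undef hcon] at h1
      exact zero_ne_one h1
    have e : ∫⁻ x in Ω, ENNReal.ofReal (max (plasma Ω lam α ψ x) 0 ^ p) =
        ∫⁻ x in Ω, ENNReal.ofReal (max (α + lam * ψ x) 0 ^ p) :=
      setLIntegral_congr_fun hΩ.measurableSet fun x hx => by rw [plasma_eq (subset_closure hx)]
    rw [e, ← ofReal_integral_eq_lintegral_ofReal hi
      (ae_of_all _ fun x => rpow_nonneg (le_max_right _ _) _), hsol.constr, ENNReal.ofReal_one]

end

namespace Sol
open SuperH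
variable {Ω : Set Plane} {u : Plane → ℝ} {p lam : ℝ}

lemma nonneg (h : Sol Ω u p lam) (h0 : ∀ x ∈ frontier Ω, u x = 0) {x : Plane}
    (hx : x ∈ closure Ω) : 0 ≤ u x :=
  min_principle h.isOpen h.bdd h.contOn h.smooth (fun y hy => by linarith [h.super y hy])
    (fun y hy => (h0 y hy).ge) hx

lemma fderiv_eq_zero (h : Sol Ω u p lam) (h0 : ∀ x ∈ frontier Ω, u x = 0) {x : Plane}
    (hx : x ∈ Ω) (hux : u x = 0) : fderiv ℝ u x = 0 := by
  have : IsLocalMin u x := by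
    filter_upwards [h.isOpen.mem_nhds hx] with y hy
    rw [hux]
    exact h.nonneg h0 (subset_closure hy)
  exact this.fderiv_eq_zero

lemma integral_sq_fderiv (h : Sol Ω u p lam) (h0 : ∀ x ∈ frontier Ω, u x = 0) :
    ∫ x in Ω, ‖fderiv ℝ u x‖ ^ 2 = lam * En Ω u p := by
  have hl := h.lam_pos
  have hE := En_nonneg Ω u p
  rw [integral_eq_lintegral_of_nonneg_ae (ae_of_all _ fun x => sq_nonneg _)
    ((measurable_fderiv ℝ u).norm.pow_const 2).aestronglyMeasurable]
  have e : ∫⁻ x in Ω, ENNReal.ofReal (‖fderiv ℝ u x‖ ^ 2) =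
      ∫⁻ x in Ω ∩ {x | 0 < u x}, ENNReal.ofReal (‖fderiv ℝ u x‖ ^ 2) := by
    rw [← lintegral_indicator h.isOpen.measurableSet,
      ← lintegral_indicator (h.measurableSet_superlevel 0)]
    refine lintegral_congr fun x => ?_
    by_cases hx : x ∈ Ω
    · by_cases hx2 : 0 < u x
      · rw [indicator_of_mem hx, indicator_of_mem (show x ∈ Ω ∩ {x | 0 < u x} from ⟨hx, hx2⟩)]
      · have hz : u x = 0 := le_antisymm (not_lt.mp hx2) (h.nonneg h0 (subset_closure hx))
        rw [indicator_of_mem hx, indicator_of_notMem fun hc => hx2 hc.2, h.fderiv_eq_zero h0 hx hz]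
        simp
    · rw [indicator_of_notMem hx, indicator_of_notMem fun hc => hx hc.1]
  rw [e, h.energy, ENNReal.toReal_ofReal (by positivity)]

lemma Ray_eq (h : Sol Ω u p lam) (h0 : ∀ x ∈ frontier Ω, u x = 0) :
    Ray Ω (p + 1) u = lam * En Ω u p ^ ((p - 1) / (p + 1)) := by
  have hp := h.one_le
  have hI := h.En_pos
  have e : ∫ x in Ω, |u x| ^ (p + 1) = En Ω u p :=
    setIntegral_congr_fun h.isOpen.measurableSet fun x hx => by
      have := h.nonneg h0 (subset_closure hx)
      simp only [abs_of_nonneg this, max_eq_left this]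
  simp only [Ray, norm_gradient]
  rw [h.integral_sq_fderiv h0, e, div_eq_iff (by positivity), mul_assoc, ← rpow_add hI, ← add_div,
    show p - 1 + 2 = p + 1 by ring, div_self (by linarith), rpow_one]

end Sol

lemma Ray_congr {Ω : Set Plane} (hΩ : IsOpen Ω) {q : ℝ} {v w : Plane → ℝ}
    (h : ∀ x ∈ Ω, v x = w x) : Ray Ω q v = Ray Ω q w := by
  simp only [Ray, norm_gradient]
  have e1 : ∫ x in Ω, ‖fderiv ℝ v x‖ ^ 2 = ∫ x in Ω, ‖fderiv ℝ w x‖ ^ 2 :=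
    setIntegral_congr_fun hΩ.measurableSet fun x hx => by
      have : v =ᶠ[𝓝 x] w := by filter_upwards [hΩ.mem_nhds hx] with y hy using h y hy
      simp only [this.fderiv_eq]
  have e2 : ∫ x in Ω, |v x| ^ q = ∫ x in Ω, |w x| ^ q :=
    setIntegral_congr_fun hΩ.measurableSet fun x hx => by simp only [h x hx]
  rw [e1, e2]

/-- The comparison theorem, given the two facts relating disks and equality. -/
theorem comparison (Ω : Set Plane)
    (hdisk : ∀ (u : Plane → ℝ) (p lam : ℝ), Sol Ω u p lam → (∀ x ∈ frontier Ω, u x = 0) →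
      (8 * π * Sol.En Ω u p = (p + 1) * lam ↔ IsUnitDisk Ω))
    (hopen : IsOpen Ω) (hbdd : Bornology.IsBounded Ω) (p : ℝ) (hp : 1 ≤ p)
    (lam α : ℝ) (ψ : Plane → ℝ)
    (hlam : 0 < lam) (hsol : IsSol Ω p lam α ψ) (hα : α ≤ 0) :
    lam0 Ω p ≤ lam ∧
    (lam = lam0 Ω p ↔
      (α = 0 ∧ (p = 1 ∨ (1 < p ∧ IsUnitDisk Ω)) ∧
        Ray Ω (p + 1) (fun x => lam * ψ x) = Lam Ω (p + 1))) := by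
  have h := hsol.sol hopen hbdd hp hlam hα
  obtain ⟨hle, hiff⟩ := lam0_facts hp hlam h.En_pos h.Lam_le_ratio h.eight_pi_le
  refine ⟨hle, ?_⟩
  have hfr : ∀ x ∈ frontier Ω, plasma Ω lam α ψ x = α := fun x hx => by
    rw [plasma_eq hx.1, hsol.bdry x hx, mul_zero, add_zero]
  have hray : α = 0 → Ray Ω (p + 1) (fun x => lam * ψ x) =
      lam * Sol.En Ω (plasma Ω lam α ψ) p ^ ((p - 1) / (p + 1)) := fun h0 => by
    rw [← h.Ray_eq fun x hx => (hfr x hx).trans h0]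
    exact Ray_congr hopen fun x hx => by rw [plasma_eq (subset_closure hx), h0, zero_add]
  rw [hiff]
  constructor
  · rintro ⟨h1, h2⟩
    have hα0 : α = 0 := by
      by_contra hne
      have hneg := lt_of_le_of_ne hα hne
      exact (h.Lam_lt_ratio (ε := -α) (by linarith) fun x hx => by
        rw [hfr x hx, neg_neg]).ne h1
    refine ⟨hα0, ?_, (hray hα0).trans h1.symm⟩
    rcases hp.eq_or_lt with hp1 | hp1
    · exact Or.inl hp1.symm
    · exact Or.inr ⟨hp1, (hdisk _ _ _ h fun x hx => (hfr x hx).trans hα0).mp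
        (h2.resolve_left hp1.ne')⟩
  · rintro ⟨h0, h2, h3⟩
    refine ⟨by rw [← h3, hray h0], h2.imp_right fun h4 => ?_⟩
    exact (hdisk _ _ _ h fun x hx => (hfr x hx).trans h0).mpr h4.2

lemma continuousAt_measure_lt {α : Type*} [MeasurableSpace α] (κ : Measure α) [IsFiniteMeasure κ]
    {u : α → ℝ} (hu : Measurable u) {t : ℝ} (ht : κ {x | u x = t} = 0) :
    ContinuousAt (fun s => (κ {x | s < u x}).toReal) t := by
  have e : (fun s => (κ {x | s < u x}).toReal) =
      fun s => ∫ x, ({x | s < u x} : Set α).indicator (fun _ => (1 : ℝ)) x ∂κ := by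
    funext s
    rw [integral_indicator (measurableSet_lt measurable_const hu)]
    simp [Measure.real]
  rw [e]
  refine continuousAt_of_dominated (bound := fun _ => 1) ?_ ?_ (integrable_const _) ?_
  · exact Eventually.of_forall fun s => (measurable_const.indicator
      (measurableSet_lt measurable_const hu)).aestronglyMeasurable
  · refine Eventually.of_forall fun s => ae_of_all _ fun x => ?_
    by_cases hx : s < u x <;> simp [indicator, hx]
  · have : ∀ᵐ x ∂κ, u x ≠ t := by
      rw [ae_iff]
      simpa using ht
    filter_upwards [this] with x hx
    rcases lt_or_gt_of_ne hx with h | h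
    · refine (continuousAt_const (y := (0 : ℝ))).congr ?_
      filter_upwards [lt_mem_nhds h] with s hs
      simp [indicator, hs.le]
    · refine (continuousAt_const (y := (1 : ℝ))).congr ?_
      filter_upwards [gt_mem_nhds h] with s hs
      simp [indicator, hs]

lemma continuousWithinAt_measure_lt {α : Type*} [MeasurableSpace α] (κ : Measure α)
    [IsFiniteMeasure κ] {u : α → ℝ} (hu : Measurable u) (t : ℝ) :
    ContinuousWithinAt (fun s => (κ {x | s < u x}).toReal) (Ici t) t := by
  have e : (fun s => (κ {x | s < u x}).toReal) =
      fun s => ∫ x, ({x | s < u x} : Set α).indicator (fun _ => (1 : ℝ)) x ∂κ := by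
    funext s
    rw [integral_indicator (measurableSet_lt measurable_const hu)]
    simp [Measure.real]
  rw [e]
  refine continuousWithinAt_of_dominated (bound := fun _ => 1) ?_ ?_ (integrable_const _) ?_
  · exact Eventually.of_forall fun s => (measurable_const.indicator
      (measurableSet_lt measurable_const hu)).aestronglyMeasurable
  · refine Eventually.of_forall fun s => ae_of_all _ fun x => ?_
    by_cases hx : s < u x <;> simp [indicator, hx]
  · refine ae_of_all _ fun x => ?_
    rcases le_or_gt (u x) t with h | h
    · refine (continuousWithinAt_const (b := (0 : ℝ))).congr (fun s hs => ?_) ?_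
      · simp [indicator, h.trans hs]
      · simp [indicator, h]
    · refine ContinuousAt.continuousWithinAt ?_
      refine (continuousAt_const (y := (1 : ℝ))).congr ?_
      filter_upwards [gt_mem_nhds h] with s hs
      simp [indicator, hs]

namespace SuperH
variable {Ω : Set Plane} {u : Plane → ℝ}

lemma mu_eq (h : SuperH Ω u) :
    mu Ω u = fun s => ((volume.restrict Ω) {x | s < u x}).toReal := by
  funext s
  rw [Measure.restrict_apply (measurableSet_lt measurable_const h.meas), inter_comm, mu]

lemma isFiniteMeasure_restrict (h : SuperH Ω u) :
    IsFiniteMeasure ((volume : Measure Plane).restrict Ω) :=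
  ⟨by simpa using (h.volume_ne_top univ).lt_top⟩

lemma continuousAt_mu (h : SuperH Ω u) {t : ℝ} (ht : volume (Ω ∩ {x | u x = t}) = 0) :
    ContinuousAt (mu Ω u) t := by
  have := h.isFiniteMeasure_restrict
  rw [h.mu_eq]
  refine continuousAt_measure_lt _ h.meas ?_
  have hS : MeasurableSet {x | u x = t} := h.meas (measurableSet_singleton t)
  rwa [Measure.restrict_apply hS, inter_comm]

lemma continuousWithinAt_mu (h : SuperH Ω u) (t : ℝ) :
    ContinuousWithinAt (mu Ω u) (Ici t) t := by
  have := h.isFiniteMeasure_restrict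
  rw [h.mu_eq]
  exact continuousWithinAt_measure_lt _ h.meas t

lemma isOpen_superlevel (h : SuperH Ω u) (t : ℝ) : IsOpen (Ω ∩ {x | t < u x}) :=
  (h.contOn.mono subset_closure).isOpen_inter_preimage h.isOpen isOpen_Ioi

lemma mu_pos (h : SuperH Ω u) {t : ℝ} {x : Plane} (hx : x ∈ Ω) (ht : t < u x) : 0 < mu Ω u t :=
  ENNReal.toReal_pos ((h.isOpen_superlevel t).measure_pos volume ⟨x, hx, ht⟩).ne'
    (h.volume_ne_top _)

end SuperH

namespace Sol
open SuperH
variable {Ω : Set Plane} {u : Plane → ℝ} {p lam : ℝ}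

lemma exists_max (h : Sol Ω u p lam) : ∃ c ∈ Ω, 0 < u c ∧ ∀ x ∈ closure Ω, u x ≤ u c := by
  have hV : ∃ x ∈ Ω, 0 < u x := by
    by_contra! hcon
    have h1 := h.constr
    rw [setLIntegral_congr_fun (g := fun _ => 0) h.isOpen.measurableSet fun x hx => by
      have hp := h.one_le
      simp [max_eq_right (hcon x hx), zero_rpow (by linarith : p ≠ 0)]] at h1
    simp at h1
  obtain ⟨y, hy, hy0⟩ := hV
  obtain ⟨c, hc, hmax⟩ := h.bdd.isCompact_closure.exists_isMaxOn ⟨y, subset_closure hy⟩ h.contOn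
  have hc0 : 0 < u c := hy0.trans_le (hmax (subset_closure hy))
  refine ⟨c, ?_, hc0, fun x hx => hmax hx⟩
  by_contra hcΩ
  have : c ∈ frontier Ω := by
    rw [h.isOpen.frontier_eq]
    exact ⟨hc, hcΩ⟩
  linarith [h.bdry c this]

lemma mass_pos (h : Sol Ω u p lam) {t : ℝ} (ht : 0 < t) {x : Plane} (hx : x ∈ Ω) (hux : t < u x) :
    0 < mass Ω u p t := by
  have h1 := h.mul_mu_le_mass ht
  have h2 := h.mu_pos hx hux
  exact (mul_pos (rpow_pos_of_pos ht p) h2).trans_le h1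

lemma Pm_level (h : Sol Ω u p lam) (he : 8 * π * En Ω u p = (p + 1) * lam) (t : ℝ) :
    Pm Ω u p {x | u x = t} = 0 := by
  have := h.isProb
  have h2 := (h.eq_case he).2
  have h3 := measure_mono_null (s := {x | u x = t} ×ˢ {x | u x = t}) (fun z hz => by
    exact (hz.1 : u z.1 = t).trans (hz.2 : u z.2 = t).symm) h2
  rw [Measure.prod_prod] at h3
  exact mul_self_eq_zero.mp h3

lemma volume_level (h : Sol Ω u p lam) (he : 8 * π * En Ω u p = (p + 1) * lam) {t : ℝ}
    (ht : 0 < t) : volume (Ω ∩ {x | u x = t}) = 0 := by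
  have hS : MeasurableSet {x | u x = t} := h.meas (measurableSet_singleton t)
  have h1 := h.Pm_level he t
  rw [Pm, withDensity_apply _ hS, Measure.restrict_restrict hS,
    setLIntegral_congr_fun (g := fun _ => ENNReal.ofReal (t ^ p)) (hS.inter h.isOpen.measurableSet)
      (fun x hx => by
        have e : u x = t := hx.1
        simp [e, max_eq_left ht.le]), setLIntegral_const] at h1
  rw [inter_comm]
  refine (mul_eq_zero.mp h1).resolve_left ?_
  simpa using rpow_pos_of_pos ht p

lemma continuousAt_mass (h : Sol Ω u p lam) (he : 8 * π * En Ω u p = (p + 1) * lam) (t : ℝ) :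
    ContinuousAt (mass Ω u p) t := by
  have := h.isProb
  exact continuousAt_measure_lt _ h.meas (h.Pm_level he t)

/-- In the equality case, the gradient is constant on level sets. -/
lemma norm_fderiv_eq_ae (h : Sol Ω u p lam) (he : 8 * π * En Ω u p = (p + 1) * lam) {M : ℝ}
    (hM : ∃ c ∈ Ω, u c = M) :
    ∀ᵐ x ∂volume.restrict (Ω ∩ {x | 0 < u x ∧ u x < M}),
      √(4 * π * mu Ω u (u x)) * ‖fderiv ℝ u x‖ = lam * mass Ω u p (u x) := by
  have hl := h.lam_pos
  have h1 := (h.eq_case he).1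
  rw [lintegral_eq_zero_iff h.measurable_deficit.ennreal_ofReal] at h1
  have hsub : Ω ∩ {x | 0 < u x ∧ u x < M} ⊆ Ω ∩ {x | 0 < u x} := fun x hx => ⟨hx.1, hx.2.1⟩
  have hmeas : MeasurableSet (Ω ∩ {x | 0 < u x ∧ u x < M}) :=
    h.isOpen.measurableSet.inter ((measurableSet_lt measurable_const h.meas).inter
      (measurableSet_lt h.meas measurable_const))
  filter_upwards [ae_restrict_of_ae_restrict_of_subset hsub h1, ae_restrict_mem hmeas] with x hx hxm
  obtain ⟨c, hc, rfl⟩ := hM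
  have hm := h.mass_pos hxm.2.1 hc hxm.2.2
  have hu := rpow_pos_of_pos hxm.2.1 p
  simp only [Pi.zero_apply, ENNReal.ofReal_eq_zero] at hx
  have h3 : deficit Ω u p lam x = u x ^ p / (lam ^ 2 * mass Ω u p (u x)) *
    (√(4 * π * mu Ω u (u x)) * ‖fderiv ℝ u x‖ - lam * mass Ω u p (u x)) ^ 2 := rfl
  have h4 : 0 < u x ^ p / (lam ^ 2 * mass Ω u p (u x)) := by positivity
  rw [h3] at hx
  have h5 : (√(4 * π * mu Ω u (u x)) * ‖fderiv ℝ u x‖ - lam * mass Ω u p (u x)) ^ 2 ≤ 0 := by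
    by_contra! hcon
    exact absurd hx (not_le.mpr (mul_pos h4 hcon))
  have h6 := pow_eq_zero_iff (two_ne_zero) |>.mp (le_antisymm h5 (sq_nonneg _))
  linarith

lemma norm_fderiv_eq (h : Sol Ω u p lam) (he : 8 * π * En Ω u p = (p + 1) * lam) {c : Plane}
    (hc : c ∈ Ω) {x : Plane} (hx : x ∈ Ω) (hx0 : 0 < u x) (hxM : u x < u c) :
      √(4 * π * mu Ω u (u x)) * ‖fderiv ℝ u x‖ = lam * mass Ω u p (u x) := by
  set W := Ω ∩ {x | 0 < u x ∧ u x < u c} with hW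
  have hcu : ContinuousOn u Ω := h.contOn.mono subset_closure
  have hWo : IsOpen W := hcu.isOpen_inter_preimage h.isOpen isOpen_Ioo
  have hcuW : ContinuousOn u W := hcu.mono inter_subset_left
  refine Measure.eqOn_open_of_ae_eq (h.norm_fderiv_eq_ae he ⟨c, hc, rfl⟩) hWo ?_ ?_ ⟨hx, hx0, hxM⟩
  · refine ContinuousOn.mul ?_ ?_
    · refine ContinuousOn.sqrt (continuousOn_const.mul ?_)
      intro y hy
      exact (h.continuousAt_mu (h.volume_level he hy.2.1)).comp_continuousWithinAt (hcuW y hy)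
    · exact ((h.smooth.continuousOn_fderiv_of_isOpen h.isOpen (by norm_num)).mono
        inter_subset_left).norm
  · refine continuousOn_const.mul ?_
    intro y hy
    exact (h.continuousAt_mass he _).comp_continuousWithinAt (hcuW y hy)

end Sol

namespace Sol
open SuperH
variable {Ω : Set Plane} {u : Plane → ℝ} {p lam : ℝ}

lemma continuousOn_rate (h : Sol Ω u p lam) (he : 8 * π * En Ω u p = (p + 1) * lam) {c : Plane}
    (hc : c ∈ Ω) :
    ContinuousOn (fun τ => 4 * π * mu Ω u τ / (lam * mass Ω u p τ)) (Ioo 0 (u c)) := fun τ hτ =>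
  ((continuousAt_const.mul (h.continuousAt_mu (h.volume_level he hτ.1))).div
    (continuousAt_const.mul (h.continuousAt_mass he τ))
    (mul_pos h.lam_pos (h.mass_pos hτ.1 hc hτ.2)).ne').continuousWithinAt

lemma mu_sub (h : Sol Ω u p lam) (he : 8 * π * En Ω u p = (p + 1) * lam) {c : Plane}
    (hc : c ∈ Ω) {s t : ℝ} (hs : 0 < s) (hst : s ≤ t) (ht : t < u c) :
    mu Ω u s - mu Ω u t = ∫ τ in s..t, 4 * π * mu Ω u τ / (lam * mass Ω u p τ) := by
  have hl := h.lam_pos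
  have hS : MeasurableSet {x | s < u x ∧ u x ≤ t} :=
    (measurableSet_lt measurable_const h.meas).inter (measurableSet_le h.meas measurable_const)
  have key := h.lintegral_sq_fderiv h.lintegral_lap
    (a := (Ioc s t).indicator fun τ =>
      ENNReal.ofReal (4 * π * mu Ω u τ / (lam * mass Ω u p τ) ^ 2))
    (((measurable_const.mul h.measurable_mu).div
      ((measurable_const.mul h.measurable_mass).pow_const 2)).ennreal_ofReal.indicator
      measurableSet_Ioc)
  have e1 : ∫⁻ x in Ω ∩ {x | 0 < u x}, (Ioc s t).indicator (fun τ =>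
      ENNReal.ofReal (4 * π * mu Ω u τ / (lam * mass Ω u p τ) ^ 2)) (u x) *
        ENNReal.ofReal (‖fderiv ℝ u x‖ ^ 2) =
      ∫⁻ x in Ω ∩ {x | 0 < u x}, {x | s < u x ∧ u x ≤ t}.indicator (fun _ => 1) x := by
    refine setLIntegral_congr_fun (h.measurableSet_superlevel 0) fun x hx => ?_
    by_cases hxs : s < u x ∧ u x ≤ t
    · have hm := h.mass_pos (hs.trans hxs.1) hc (hxs.2.trans_lt ht)
      have hn := h.norm_fderiv_eq he hc hx.1 hx.2 (hxs.2.trans_lt ht)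
      have hmu := mu_nonneg Ω u (u x)
      have hq : 4 * π * mu Ω u (u x) * ‖fderiv ℝ u x‖ ^ 2 = (lam * mass Ω u p (u x)) ^ 2 := by
        rw [← hn, mul_pow, sq_sqrt (by positivity)]
      rw [indicator_of_mem (show u x ∈ Ioc s t from hxs),
        indicator_of_mem (show x ∈ {x | s < u x ∧ u x ≤ t} from hxs),
        ← ENNReal.ofReal_mul (by positivity), div_mul_eq_mul_div, hq, div_self (by positivity),
        ENNReal.ofReal_one]
    · rw [indicator_of_notMem (show u x ∉ Ioc s t from hxs),
        indicator_of_notMem (show x ∉ {x | s < u x ∧ u x ≤ t} from hxs), zero_mul]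
  have e2 : ∫⁻ τ in Ioi (0 : ℝ), (Ioc s t).indicator (fun τ =>
      ENNReal.ofReal (4 * π * mu Ω u τ / (lam * mass Ω u p τ) ^ 2)) τ * H Ω u τ =
      ∫⁻ τ in Ioc s t, ENNReal.ofReal (4 * π * mu Ω u τ / (lam * mass Ω u p τ)) := by
    rw [← lintegral_indicator measurableSet_Ioi, ← lintegral_indicator measurableSet_Ioc]
    refine lintegral_congr fun τ => ?_
    by_cases hτ : τ ∈ Ioc s t
    · have hm := h.mass_pos (hs.trans hτ.1) hc (hτ.2.trans_lt ht)
      have hmu := mu_nonneg Ω u τ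
      rw [indicator_of_mem (show τ ∈ Ioi 0 from hs.trans hτ.1), indicator_of_mem hτ,
        indicator_of_mem hτ, h.H_eq, ← ENNReal.ofReal_mul (by positivity)]
      congr 1
      field_simp
    · rw [indicator_of_notMem hτ]
      simp [indicator, hτ]
  have e3 : Ω ∩ {x | s < u x} = (Ω ∩ {x | t < u x}) ∪ (Ω ∩ {x | s < u x ∧ u x ≤ t}) := by
    ext x
    simp only [mem_inter_iff, mem_ofPred_eq, mem_union]
    constructor
    · rintro ⟨h1, h2⟩
      rcases lt_or_ge t (u x) with h3 | h3
      exacts [Or.inl ⟨h1, h3⟩, Or.inr ⟨h1, h2, h3⟩]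
    · rintro (⟨h1, h2⟩ | ⟨h1, h2, -⟩)
      exacts [⟨h1, hst.trans_lt h2⟩, ⟨h1, h2⟩]
  have e4 : volume (Ω ∩ {x | s < u x}) =
      volume (Ω ∩ {x | t < u x}) + volume (Ω ∩ {x | s < u x ∧ u x ≤ t}) := by
    rw [e3, measure_union _ (h.isOpen.measurableSet.inter hS)]
    refine Set.disjoint_left.mpr fun x hx hx' => ?_
    exact absurd hx.2 (not_lt.mpr hx'.2.2)
  have e5 : mu Ω u s - mu Ω u t = (volume (Ω ∩ {x | s < u x ∧ u x ≤ t})).toReal := by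
    rw [mu, mu, e4, ENNReal.toReal_add (h.volume_ne_top _) (h.volume_ne_top _)]
    ring
  rw [e1, e2, lintegral_indicator hS, Measure.restrict_restrict hS, setLIntegral_const,
    one_mul] at key
  have e6 : {x | s < u x ∧ u x ≤ t} ∩ (Ω ∩ {x | 0 < u x}) = Ω ∩ {x | s < u x ∧ u x ≤ t} := by
    ext x
    simp only [mem_inter_iff, mem_ofPred_eq]
    constructor
    · rintro ⟨h1, h2, -⟩
      exact ⟨h2, h1⟩
    · rintro ⟨h1, h2⟩
      exact ⟨h2, h1, hs.trans h2.1⟩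
  rw [e6] at key
  have hcont := (h.continuousOn_rate he hc).mono (Icc_subset_Ioo hs ht : Icc s t ⊆ _)
  rw [e5, key, intervalIntegral.integral_of_le hst, integral_eq_lintegral_of_nonneg_ae]
  · exact ae_of_all _ fun τ => div_nonneg (mul_nonneg (by positivity) (mu_nonneg _ _ _))
      (mul_nonneg hl.le (mass_nonneg _ _ _ _))
  · exact (hcont.mono Ioc_subset_Icc_self).aestronglyMeasurable measurableSet_Ioc

lemma hasDerivAt_mu (h : Sol Ω u p lam) (he : 8 * π * En Ω u p = (p + 1) * lam) {c : Plane}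
    (hc : c ∈ Ω) {t : ℝ} (ht : 0 < t) (htc : t < u c) :
    HasDerivAt (mu Ω u) (-(4 * π * mu Ω u t / (lam * mass Ω u p t))) t := by
  have hcont := h.continuousOn_rate he hc
  have hsub : Icc (t / 2) t ⊆ Ioo 0 (u c) := Icc_subset_Ioo (by linarith) htc
  have h1 := intervalIntegral.integral_hasDerivAt_right (a := t / 2) (b := t)
    (f := fun τ => 4 * π * mu Ω u τ / (lam * mass Ω u p τ))
    (by
      apply ContinuousOn.intervalIntegrable
      rw [uIcc_of_le (by linarith)]
      exact hcont.mono hsub)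
    (hcont.stronglyMeasurableAtFilter isOpen_Ioo _ ⟨ht, htc⟩)
    (hcont.continuousAt (Ioo_mem_nhds ht htc))
  refine (h1.const_sub (mu Ω u (t / 2))).congr_of_eventuallyEq ?_
  filter_upwards [Ioo_mem_nhds (by linarith : t / 2 < t) htc] with r hr
  rw [← h.mu_sub he hc (by linarith) hr.1.le hr.2]
  ring

/-- The radius of the disk whose area is that of the superlevel set. -/
def rad (Ω : Set Plane) (u : Plane → ℝ) (t : ℝ) : ℝ := √(mu Ω u t / π)

lemma hasDerivAt_rad (h : Sol Ω u p lam) (he : 8 * π * En Ω u p = (p + 1) * lam) {c : Plane}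
    (hc : c ∈ Ω) {t : ℝ} (ht : 0 < t) (htc : t < u c) :
    HasDerivAt (rad Ω u) (-(√(4 * π * mu Ω u t) / (lam * mass Ω u p t))) t := by
  have hm := h.mu_pos hc htc
  have hl := h.lam_pos
  have hmass := h.mass_pos ht hc htc
  have h1 := ((h.hasDerivAt_mu he hc ht htc).div_const π).sqrt (by positivity)
  refine h1.congr_deriv ?_
  have e1 : √(4 * π * mu Ω u t) = 2 * π * √(mu Ω u t / π) := by
    rw [show 4 * π * mu Ω u t = (2 * π) ^ 2 * (mu Ω u t / π) by field_simp; ring,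
      sqrt_mul (by positivity), sqrt_sq (by positivity)]
  have h2 : 0 < √(mu Ω u t / π) := by positivity
  have h3 : √(mu Ω u t / π) ^ 2 = mu Ω u t / π := sq_sqrt (by positivity)
  rw [e1]
  generalize √(mu Ω u t / π) = r at *
  have h4 : mu Ω u t = π * r ^ 2 := by rw [h3]; field_simp
  rw [h4]
  field_simp
  norm_num

lemma continuousAt_rad (h : Sol Ω u p lam) (he : 8 * π * En Ω u p = (p + 1) * lam) {t : ℝ}
    (ht : 0 < t) : ContinuousAt (rad Ω u) t :=
  ((h.continuousAt_mu (h.volume_level he ht)).div_const π).sqrt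

end Sol

namespace Sol
open SuperH
variable {Ω : Set Plane} {u : Plane → ℝ} {p lam : ℝ}

lemma rad_max {c : Plane} (hmax : ∀ x ∈ closure Ω, u x ≤ u c) : rad Ω u (u c) = 0 := by
  have : Ω ∩ {x | u c < u x} = ∅ := by
    ext x
    simp only [mem_inter_iff, mem_ofPred_eq, mem_empty_iff_false, iff_false, not_and, not_lt]
    exact fun hx => hmax x (subset_closure hx)
  simp [rad, mu, this]

/-- Along segments issuing from a maximum point, the radius grows at most at unit speed. -/
lemma rad_le (h : Sol Ω u p lam) (he : 8 * π * En Ω u p = (p + 1) * lam) {c : Plane}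
    (hc : c ∈ Ω) (hmax : ∀ x ∈ closure Ω, u x ≤ u c) {v : Plane}
    (hseg : ∀ t ∈ Icc (0 : ℝ) 1, c + t • v ∈ Ω ∩ {x | 0 < u x}) :
    rad Ω u (u (c + v)) ≤ ‖v‖ := by
  have hl := h.lam_pos
  have hcu : ContinuousOn u Ω := h.contOn.mono subset_closure
  have hγ : Continuous fun t : ℝ => c + t • v := by fun_prop
  have huγ : ContinuousOn (fun t : ℝ => u (c + t • v)) (Icc 0 1) :=
    hcu.comp hγ.continuousOn fun t ht => (hseg t ht).1
  have hφ : ContinuousOn (fun t : ℝ => rad Ω u (u (c + t • v))) (Icc 0 1) := fun t ht =>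
    ContinuousAt.comp_continuousWithinAt (g := rad Ω u) (f := fun t : ℝ => u (c + t • v))
      (h.continuousAt_rad he (hseg t ht).2) (huγ t ht)
  have hK : IsCompact (Icc (0 : ℝ) 1 ∩ (fun t : ℝ => u (c + t • v)) ⁻¹' {u c}) :=
    isCompact_Icc.of_isClosed_subset (huγ.preimage_isClosed_of_isClosed isClosed_Icc
      isClosed_singleton) inter_subset_left
  obtain ⟨s, ⟨hs, hsu⟩, hsmax⟩ := hK.exists_isGreatest ⟨0, ⟨le_rfl, zero_le_one⟩, by simp⟩
  have hsu' : u (c + s • v) = u c := hsu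
  have h1 : c + v = c + (1 : ℝ) • v := by rw [one_smul]
  rcases hs.2.eq_or_lt with rfl | hs1
  · rw [h1, hsu', rad_max hmax]
    exact norm_nonneg v
  have hlt : ∀ t ∈ Ioo s 1, u (c + t • v) < u c := fun t ht => by
    have ht' : t ∈ Icc (0 : ℝ) 1 := ⟨hs.1.trans ht.1.le, ht.2.le⟩
    refine lt_of_le_of_ne (hmax _ (subset_closure (hseg t ht').1)) fun e => ?_
    exact absurd (hsmax ⟨ht', e⟩) (not_le.mpr ht.1)
  have hd : ∀ t ∈ Ioo s 1, HasDerivAt (fun t : ℝ => rad Ω u (u (c + t • v)))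
      (-(√(4 * π * mu Ω u (u (c + t • v))) / (lam * mass Ω u p (u (c + t • v)))) *
        fderiv ℝ u (c + t • v) v) t := fun t ht => by
    have ht' : t ∈ Icc (0 : ℝ) 1 := ⟨hs.1.trans ht.1.le, ht.2.le⟩
    have hx := hseg t ht'
    have hdu : HasFDerivAt u (fderiv ℝ u (c + t • v)) (c + t • v) :=
      ((h.smooth.contDiffAt (h.isOpen.mem_nhds hx.1)).differentiableAt (by norm_num)).hasFDerivAt
    have hdγ : HasDerivAt (fun t : ℝ => c + t • v) v t := by
      simpa using ((hasDerivAt_id t).smul_const v).const_add c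
    exact HasDerivAt.comp (h₂ := rad Ω u) (h := fun t : ℝ => u (c + t • v)) t
      (h.hasDerivAt_rad he hc hx.2 (hlt t ht)) (hdu.comp_hasDerivAt t hdγ)
  obtain ⟨t, ht, hslope⟩ := exists_hasDerivAt_eq_slope _ _ hs1
    (hφ.mono (Icc_subset_Icc_left hs.1)) hd
  have ht' : t ∈ Icc (0 : ℝ) 1 := ⟨hs.1.trans ht.1.le, ht.2.le⟩
  have hx := hseg t ht'
  have hm := h.mass_pos hx.2 hc (hlt t ht)
  have hn := h.norm_fderiv_eq he hc hx.1 hx.2 (hlt t ht)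
  have hdv : ‖fderiv ℝ u (c + t • v) v‖ ≤ ‖fderiv ℝ u (c + t • v)‖ * ‖v‖ :=
    ContinuousLinearMap.le_opNorm _ _
  rw [hsu', rad_max hmax, sub_zero, eq_div_iff (by linarith), ← h1] at hslope
  rw [← hslope]
  have hb : -(√(4 * π * mu Ω u (u (c + t • v))) / (lam * mass Ω u p (u (c + t • v)))) *
        fderiv ℝ u (c + t • v) v ≤ ‖v‖ := by
    calc _ ≤ √(4 * π * mu Ω u (u (c + t • v))) / (lam * mass Ω u p (u (c + t • v))) *
          (‖fderiv ℝ u (c + t • v)‖ * ‖v‖) := by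
          rw [neg_mul, ← mul_neg]
          refine mul_le_mul_of_nonneg_left ?_ (by positivity)
          exact (neg_le_abs _).trans hdv
      _ = ‖v‖ := by
          rw [← mul_assoc, div_mul_eq_mul_div, hn, div_self (by positivity), one_mul]
  have hs0 := hs.1
  nlinarith [norm_nonneg v]

lemma ball_subset (h : Sol Ω u p lam) (he : 8 * π * En Ω u p = (p + 1) * lam) {c : Plane}
    (hc : c ∈ Ω) (hc0 : 0 < u c) (hmax : ∀ x ∈ closure Ω, u x ≤ u c) :
    ball c (rad Ω u 0) ⊆ Ω ∩ {x | 0 < u x} := by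
  intro x hx
  by_contra hxV
  have hγ : Continuous fun t : ℝ => c + t • (x - c) := by fun_prop
  set V := Ω ∩ {x | 0 < u x} with hV
  have hVo : IsOpen V := h.isOpen_superlevel 0
  have hK : IsCompact (Icc (0 : ℝ) 1 ∩ (fun t : ℝ => c + t • (x - c)) ⁻¹' Vᶜ) :=
    isCompact_Icc.inter_right (hVo.isClosed_compl.preimage hγ)
  obtain ⟨s, ⟨hs, hsV⟩, hsmin⟩ := hK.exists_isLeast ⟨1, ⟨zero_le_one, le_rfl⟩, by simpa using hxV⟩
  have hin : ∀ t ∈ Ico 0 s, c + t • (x - c) ∈ V := fun t ht => by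
    by_contra hcon
    exact absurd (hsmin ⟨⟨ht.1, ht.2.le.trans hs.2⟩, hcon⟩) (not_le.mpr ht.2)
  have hs0 : 0 < s := by
    refine lt_of_le_of_ne hs.1 fun e => hsV ?_
    rw [← e]
    simpa using ⟨hc, hc0⟩
  have hne : (𝓝[<] s).NeBot := inferInstance
  have hev : ∀ᶠ t in 𝓝[<] s, t ∈ Ico 0 s := by
    filter_upwards [self_mem_nhdsWithin, mem_nhdsWithin_of_mem_nhds (lt_mem_nhds hs0)] with t h1 h2
    exact ⟨le_of_lt h2, h1⟩
  have hcl : c + s • (x - c) ∈ closure Ω :=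
    mem_closure_of_tendsto (hγ.continuousAt.tendsto.mono_left nhdsWithin_le_nhds)
      (hev.mono fun t ht => (hin t ht).1)
  have hus : u (c + s • (x - c)) ≤ 0 := by
    by_cases hm : c + s • (x - c) ∈ Ω
    · exact not_lt.mp fun hcon => hsV ⟨hm, hcon⟩
    · exact h.bdry _ (by rw [h.isOpen.frontier_eq]; exact ⟨hcl, hm⟩)
  have hlim : Tendsto (fun t : ℝ => u (c + t • (x - c))) (𝓝[<] s)
      (𝓝 (u (c + s • (x - c)))) := by
    refine (h.contOn _ hcl).tendsto.comp (tendsto_nhdsWithin_iff.mpr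
      ⟨hγ.continuousAt.tendsto.mono_left nhdsWithin_le_nhds, ?_⟩)
    exact hev.mono fun t ht => subset_closure (hin t ht).1
  have hbound : ∀ t ∈ Ico 0 s, rad Ω u (u (c + t • (x - c))) ≤ ‖x - c‖ := fun t ht => by
    refine (h.rad_le he hc hmax fun r hr => ?_).trans (b := ‖t • (x - c)‖) ?_
    · rw [smul_smul]
      exact hin _ ⟨mul_nonneg hr.1 ht.1, (mul_le_of_le_one_left ht.1 hr.2).trans_lt ht.2⟩
    · rw [norm_smul, norm_of_nonneg ht.1]
      exact mul_le_of_le_one_left (norm_nonneg _) (ht.2.le.trans hs.2)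
  have hrad : ∀ δ > 0, rad Ω u δ ≤ ‖x - c‖ := fun δ hδ => by
    obtain ⟨t, ht, htδ⟩ := (hev.and (hlim.eventually (gt_mem_nhds (hus.trans_lt hδ)))).exists
    refine le_trans (sqrt_le_sqrt ?_) (hbound t ht)
    exact div_le_div_of_nonneg_right (h.mu_antitone htδ.le) pi_pos.le
  have hcontr : rad Ω u 0 ≤ ‖x - c‖ := by
    have h1 : Tendsto (rad Ω u) (𝓝[>] 0) (𝓝 (rad Ω u 0)) :=
      (((h.continuousWithinAt_mu 0).mono Ioi_subset_Ici_self).div_const π).sqrt.tendsto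
    exact le_of_tendsto h1 (by filter_upwards [self_mem_nhdsWithin] with δ hδ using hrad δ hδ)
  rw [mem_ball, dist_eq_norm] at hx
  linarith

lemma positive_eq (h : Sol Ω u p lam) (he : 8 * π * En Ω u p = (p + 1) * lam)
    (hconn : IsConnected Ω) (h0 : ∀ x ∈ frontier Ω, u x = 0) : Ω ∩ {x | 0 < u x} = Ω := by
  obtain ⟨c, hc, hc0, hmax⟩ := h.exists_max
  have hl := h.lam_pos
  set V := Ω ∩ {x | 0 < u x} with hV
  have hVo : IsOpen V := h.isOpen_superlevel 0
  refine inter_subset_left.antisymm (hconn.isPreconnected.subset_of_closure_inter_subset hVo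
    ⟨c, hc, hc, hc0⟩ ?_)
  rintro y ⟨hyV, hy⟩
  by_contra hcon
  have huy : u y = 0 := le_antisymm (not_lt.mp fun hpos => hcon ⟨hy, hpos⟩)
    (h.nonneg h0 (subset_closure hy))
  have hne : (𝓝[V] y).NeBot := mem_closure_iff_nhdsWithin_neBot.mp hyV
  have hdlim : Tendsto (fun x => ‖fderiv ℝ u x‖) (𝓝[V] y) (𝓝 0) := by
    have := ((h.smooth.continuousOn_fderiv_of_isOpen h.isOpen (by norm_num)).continuousAt
      (h.isOpen.mem_nhds hy)).norm
    rw [ContinuousAt, h.fderiv_eq_zero h0 hy huy, norm_zero] at this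
    exact this.mono_left nhdsWithin_le_nhds
  have hulim : Tendsto u (𝓝[V] y) (𝓝 0) := by
    have := ((h.contOn.mono subset_closure).continuousAt (h.isOpen.mem_nhds hy))
    rw [ContinuousAt, huy] at this
    exact this.mono_left nhdsWithin_le_nhds
  have hm : 0 < mass Ω u p (u c / 2) := h.mass_pos (by linarith) hc (by linarith)
  have hmu : 0 < mu Ω u 0 := h.mu_pos hc hc0
  have hq : 0 < lam * mass Ω u p (u c / 2) / √(4 * π * mu Ω u 0) := by positivity
  obtain ⟨x, ⟨hx1, hx2⟩, hx3⟩ := ((hdlim.eventually (gt_mem_nhds hq)).and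
    (hulim.eventually (gt_mem_nhds (by linarith : (0 : ℝ) < u c / 2)))).and
      self_mem_nhdsWithin |>.exists
  have hx0 : 0 < u x := hx3.2
  have hn := h.norm_fderiv_eq he hc hx3.1 hx0 (by linarith)
  rw [lt_div_iff₀ (by positivity)] at hx1
  have e1 : √(4 * π * mu Ω u (u x)) ≤ √(4 * π * mu Ω u 0) :=
    sqrt_le_sqrt (mul_le_mul_of_nonneg_left (h.mu_antitone hx0.le) (by positivity))
  have e2 : lam * mass Ω u p (u c / 2) ≤ lam * mass Ω u p (u x) :=
    mul_le_mul_of_nonneg_left (h.mass_antitone hx2.le) hl.le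
  have e3 := mul_le_mul_of_nonneg_right e1 (norm_nonneg (fderiv ℝ u x))
  linarith

theorem isUnitDisk (h : Sol Ω u p lam) (he : 8 * π * En Ω u p = (p + 1) * lam)
    (hconn : IsConnected Ω) (hvol : volume Ω = 1) (h0 : ∀ x ∈ frontier Ω, u x = 0) :
    IsUnitDisk Ω := by
  have hV := h.positive_eq he hconn h0
  obtain ⟨c, hc, hc0, hmax⟩ := h.exists_max
  have hb := h.ball_subset he hc hc0 hmax
  have hmu : mu Ω u 0 = 1 := by rw [mu, hV, hvol, ENNReal.toReal_one]
  rw [hV, rad, hmu, one_div] at hb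
  refine ⟨c, Subset.antisymm ?_ hb⟩
  have hbv : volume (ball c √π⁻¹) = 1 := by
    rw [EuclideanSpace.volume_ball_fin_two, ← ENNReal.ofReal_pow (sqrt_nonneg _),
      sq_sqrt (by positivity)]
    rw [← ENNReal.ofReal_one, ← inv_mul_cancel₀ pi_ne_zero, ENNReal.ofReal_mul (by positivity)]
  have hnull : volume (Ω \ ball c √π⁻¹) = 0 := by
    rw [measure_sdiff hb measurableSet_ball.nullMeasurableSet (hbv.trans_ne ENNReal.one_ne_top), hvol, hbv,
      tsub_self]
  have hsub : Ω ⊆ closedBall c √π⁻¹ := by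
    have ho : IsOpen (Ω \ closedBall c √π⁻¹) := h.isOpen.sdiff isClosed_closedBall
    have := (ho.measure_eq_zero_iff volume).mp (measure_mono_null
      (sdiff_subset_sdiff_right ball_subset_closedBall) hnull)
    exact sdiff_eq_empty.mp this
  have := h.isOpen.subset_interior_iff.mpr hsub
  rwa [interior_closedBall _ (by positivity)] at this

end Sol

/-- Rotation by a quarter turn. -/
def quarter : Plane →L[ℝ] Plane :=
  (EuclideanSpace.proj 0 : Plane →L[ℝ] ℝ).smulRight (EuclideanSpace.single 1 1) -
    (EuclideanSpace.proj 1 : Plane →L[ℝ] ℝ).smulRight (EuclideanSpace.single 0 1)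

lemma quarter_apply (y : Plane) :
    quarter y = y 0 • EuclideanSpace.single 1 1 - y 1 • EuclideanSpace.single 0 1 := rfl

lemma plane_norm_sq (y : Plane) : ‖y‖ ^ 2 = y 0 ^ 2 + y 1 ^ 2 := by
  rw [EuclideanSpace.norm_sq_eq, Fin.sum_univ_two, norm_eq_abs, norm_eq_abs, sq_abs, sq_abs]

lemma norm_quarter (y : Plane) : ‖quarter y‖ = ‖y‖ := by
  rw [← sq_eq_sq₀ (norm_nonneg _) (norm_nonneg _), plane_norm_sq, plane_norm_sq, quarter_apply]
  simp
  ring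

/-- The rotation of angle `θ` about the origin. -/
def rotL (θ : ℝ) : Plane →L[ℝ] Plane := cos θ • ContinuousLinearMap.id ℝ Plane + sin θ • quarter

lemma rotL_apply (θ : ℝ) (y : Plane) : rotL θ y = cos θ • y + sin θ • quarter y := rfl

lemma norm_rotL (θ : ℝ) (y : Plane) : ‖rotL θ y‖ = ‖y‖ := by
  rw [← sq_eq_sq₀ (norm_nonneg _) (norm_nonneg _), plane_norm_sq, plane_norm_sq, rotL_apply,
    quarter_apply]
  simp
  nlinarith [sin_sq_add_cos_sq θ]

/-- The rotation of angle `θ` about `c`. -/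
def rot (c : Plane) (θ : ℝ) (x : Plane) : Plane := c + rotL θ (x - c)

lemma norm_rot_sub (c : Plane) (θ : ℝ) (x : Plane) : ‖rot c θ x - c‖ = ‖x - c‖ := by
  rw [rot, add_sub_cancel_left, norm_rotL]

lemma hasFDerivAt_rot (c : Plane) (θ : ℝ) (x : Plane) : HasFDerivAt (rot c θ) (rotL θ) x := by
  have := ((rotL θ).hasFDerivAt.comp x ((hasFDerivAt_id x).sub_const c)).const_add c
  rwa [ContinuousLinearMap.comp_id] at this

lemma contDiff_rot (c : Plane) (θ : ℝ) : ContDiff ℝ 2 (rot c θ) :=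
  contDiff_const.add ((rotL θ).contDiff.comp (contDiff_id.sub contDiff_const))

lemma hasDerivAt_rot (c x : Plane) (θ : ℝ) :
    HasDerivAt (fun θ => rot c θ x) (rotL θ (quarter (x - c))) θ := by
  have h := (((hasDerivAt_cos θ).smul_const (x - c)).add
    ((hasDerivAt_sin θ).smul_const (quarter (x - c)))).const_add c
  refine h.congr_deriv ?_
  rw [rotL_apply]
  ext i
  fin_cases i <;> simp [quarter_apply] <;> ring

lemma lap_comp_rot {f : Plane → ℝ} {c x : Plane} {θ : ℝ} (hf : ContDiffAt ℝ 2 f (rot c θ x)) :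
    lap (fun y => f (rot c θ y)) x = lap f (rot c θ x) := by
  have hev : ∀ᶠ y in 𝓝 x, ContDiffAt ℝ 2 f (rot c θ y) :=
    (hasFDerivAt_rot c θ x).continuousAt.eventually (hf.eventually (by norm_num))
  have h1 : ∀ e : Plane, fderiv ℝ (fun y => fderiv ℝ (fun y => f (rot c θ y)) y e) x e =
      fderiv ℝ (fderiv ℝ f) (rot c θ x) (rotL θ e) (rotL θ e) := fun e => by
    have e1 : (fun y => fderiv ℝ (fun y => f (rot c θ y)) y e) =ᶠ[𝓝 x]
        fun y => fderiv ℝ f (rot c θ y) (rotL θ e) := by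
      filter_upwards [hev] with y hy
      have := ((hy.differentiableAt (by norm_num)).hasFDerivAt.comp y (hasFDerivAt_rot c θ y)).fderiv
      rw [show (fun y => f (rot c θ y)) = f ∘ rot c θ from rfl, this]
      rfl
    rw [e1.fderiv_eq]
    have h2 := (hf.differentiableAt_fderiv_two.hasFDerivAt.comp x (hasFDerivAt_rot c θ x)).clm_apply
      (hasFDerivAt_const (rotL θ e) x)
    have h3 : HasFDerivAt (fun y => fderiv ℝ f (rot c θ y) (rotL θ e)) _ x := h2
    rw [h3.fderiv]
    simp
  have h4 : rotL θ (EuclideanSpace.single 0 1) =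
      cos θ • EuclideanSpace.single 0 1 + sin θ • EuclideanSpace.single 1 1 := by
    ext i
    fin_cases i <;> simp [rotL_apply, quarter_apply]
  have h5 : rotL θ (EuclideanSpace.single 1 1) =
      cos θ • EuclideanSpace.single 1 1 - sin θ • EuclideanSpace.single 0 1 := by
    ext i
    fin_cases i <;> simp [rotL_apply, quarter_apply]
  rw [lap_eq_sum hf, lap, Fin.sum_univ_two, Fin.sum_univ_two, h1, h1, h4, h5]
  simp only [map_add, map_sub, map_smul, _root_.add_apply, smul_eq_mul,
    _root_.sub_apply, _root_.smul_apply]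
  linear_combination (fderiv ℝ (fderiv ℝ f) (rot c θ x) (EuclideanSpace.single 0 1)
    (EuclideanSpace.single 0 1) + fderiv ℝ (fderiv ℝ f) (rot c θ x) (EuclideanSpace.single 1 1)
    (EuclideanSpace.single 1 1)) * sin_sq_add_cos_sq θ

lemma abs_rpow_sub_le {p M a b : ℝ} (hp : 1 ≤ p) (ha : a ∈ Icc 0 M) (hb : b ∈ Icc 0 M) :
    |a ^ p - b ^ p| ≤ p * M ^ (p - 1) * |a - b| := by
  have := (convex_Icc (0 : ℝ) M).norm_image_sub_le_of_norm_hasDerivWithin_le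
    (f := fun t => t ^ p) (f' := fun t => p * t ^ (p - 1)) (C := p * M ^ (p - 1))
    (fun t _ => (hasDerivAt_rpow_const (Or.inr hp)).hasDerivWithinAt) (fun t ht => by
      rw [norm_of_nonneg (mul_nonneg (by linarith) (rpow_nonneg ht.1 _))]
      exact mul_le_mul_of_nonneg_left (rpow_le_rpow ht.1 ht.2 (by linarith)) (by linarith)) hb ha
  simpa [norm_eq_abs] using this

namespace Sol
open SuperH
variable {c : Plane} {R : ℝ} {u : Plane → ℝ} {p lam : ℝ}

lemma rot_sub_le_barrier (h : Sol (ball c R) u p lam) (h0 : ∀ x ∈ frontier (ball c R), u x = 0)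
    {L S θ : ℝ}
    (hL : ∀ x ∈ ball c R, ∀ y ∈ ball c R, |u x ^ p - u y ^ p| ≤ L * |u x - u y|) (hL0 : 0 ≤ L)
    (hS : ∀ x ∈ closedBall c R, |u (rot c θ x) - u x| ≤ S) (hR : 0 < R) {x : Plane}
    (hx : x ∈ closedBall c R) :
    |u (rot c θ x) - u x| ≤ lam * L * S / 4 * (R ^ 2 - ‖x - c‖ ^ 2) := by
  have hl := h.lam_pos
  have hcl : closure (ball c R) = closedBall c R := closure_ball c hR.ne'
  have hrc : ∀ y ∈ closedBall c R, rot c θ y ∈ closedBall c R := fun y hy => by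
    rw [mem_closedBall, dist_eq_norm] at hy ⊢
    rwa [norm_rot_sub]
  have hrb : ∀ y ∈ ball c R, rot c θ y ∈ ball c R := fun y hy => by
    rw [mem_ball, dist_eq_norm] at hy ⊢
    rwa [norm_rot_sub]
  have hrf : ∀ y ∈ frontier (ball c R), rot c θ y ∈ frontier (ball c R) := fun y hy => by
    rw [frontier_ball c hR.ne', mem_sphere, dist_eq_norm] at hy ⊢
    rwa [norm_rot_sub]
  have hu2 : ∀ y ∈ ball c R, ContDiffAt ℝ 2 u y := fun y hy =>
    h.smooth.contDiffAt (isOpen_ball.mem_nhds hy)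
  have hv2 : ∀ y ∈ ball c R, ContDiffAt ℝ 2 (fun y => u (rot c θ y)) y := fun y hy =>
    (hu2 _ (hrb y hy)).comp y (contDiff_rot c θ).contDiffAt
  have hd2 : ∀ y ∈ ball c R, ContDiffAt ℝ 2 (fun y => u (rot c θ y) - u y) y := fun y hy =>
    (hv2 y hy).sub (hu2 y hy)
  have hn2 : ∀ y, ContDiffAt ℝ 2 (fun y : Plane => ‖y - c‖ ^ 2) y := fun y =>
    (contDiffAt_id.sub contDiffAt_const).norm_sq ℝ
  have hb2 : ∀ y, ContDiffAt ℝ 2 (fun y : Plane => R ^ 2 - ‖y - c‖ ^ 2) y := fun y =>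
    contDiffAt_const.sub (hn2 y)
  have hlap : ∀ y ∈ ball c R, |lap (fun y => u (rot c θ y) - u y) y| ≤ lam * L * S := fun y hy => by
    rw [lap_sub (hv2 y hy) (hu2 y hy), lap_comp_rot (hu2 _ (hrb y hy))]
    have e1 := h.pde y hy
    have e2 := h.pde _ (hrb y hy)
    rw [max_eq_left (h.nonneg h0 (subset_closure hy))] at e1
    rw [max_eq_left (h.nonneg h0 (subset_closure (hrb y hy)))] at e2
    have e3 : lap u (rot c θ y) - lap u y = -(lam * (u (rot c θ y) ^ p - u y ^ p)) := by linarith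
    rw [e3, abs_neg, abs_mul, abs_of_pos hl, mul_assoc]
    refine mul_le_mul_of_nonneg_left ((hL _ (hrb y hy) _ hy).trans ?_) hl.le
    exact mul_le_mul_of_nonneg_left (hS y (ball_subset_closedBall hy)) hL0
  have hdc : ContinuousOn (fun y => u (rot c θ y) - u y) (closedBall c R) := by
    have hcu := h.contOn
    rw [hcl] at hcu
    exact (hcu.comp (contDiff_rot c θ).continuous.continuousOn hrc).sub hcu
  have main : ∀ σ : ℝ, |σ| = 1 →
      0 ≤ lam * L * S / 4 * (R ^ 2 - ‖x - c‖ ^ 2) - σ * (u (rot c θ x) - u x) := fun σ hσ => by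
    refine min_principle (Ω := ball c R)
      (w := fun y => lam * L * S / 4 * (R ^ 2 - ‖y - c‖ ^ 2) - σ * (u (rot c θ y) - u y))
      isOpen_ball isBounded_ball ?_ ?_ ?_ ?_ (hcl ▸ hx)
    · rw [hcl]
      exact ContinuousOn.sub (by fun_prop) (continuousOn_const.mul hdc)
    · intro y hy
      exact ((contDiffAt_const.mul (hb2 y)).sub
        (contDiffAt_const.mul (hd2 y hy))).contDiffWithinAt
    · intro y hy
      rw [lap_sub (contDiffAt_const.mul (hb2 y)) (contDiffAt_const.mul (hd2 y hy)),
        lap_const_mul (hb2 y), lap_const_mul (hd2 y hy),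
        lap_sub contDiffAt_const (hn2 y), lap_const, lap_norm_sq]
      have h1 := (neg_le_abs (σ * lap (fun y => u (rot c θ y) - u y) y))
      rw [abs_mul, hσ, one_mul] at h1
      linarith [hlap y hy]
    · intro y hy
      rw [h0 y hy, h0 _ (hrf y hy)]
      rw [frontier_ball c hR.ne', mem_sphere, dist_eq_norm] at hy
      simp [hy]
  have m1 := main 1 (by simp)
  have m2 := main (-1) (by simp)
  rw [abs_le]
  constructor <;> linarith

end Sol

namespace Sol
open SuperH
variable {c : Plane} {R : ℝ} {u : Plane → ℝ} {p lam : ℝ}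

/-- The angular derivative of a solution on a disk vanishes linearly at the boundary. -/
lemma exists_angular_bound (h : Sol (ball c R) u p lam)
    (h0 : ∀ x ∈ frontier (ball c R), u x = 0) (hR : 0 < R) :
    ∃ C, 0 ≤ C ∧ ∀ x ∈ ball c R,
      |fderiv ℝ u x (quarter (x - c))| ≤ C * (R ^ 2 - ‖x - c‖ ^ 2) := by
  have hl := h.lam_pos
  have hp := h.one_le
  obtain ⟨m, -, hm0, hmax⟩ := h.exists_max
  have hcl : closure (ball c R) = closedBall c R := closure_ball c hR.ne'
  set L := p * u m ^ (p - 1) with hLdef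
  have hL0 : 0 ≤ L := mul_nonneg (by linarith) (rpow_nonneg hm0.le _)
  have hL : ∀ x ∈ ball c R, ∀ y ∈ ball c R, |u x ^ p - u y ^ p| ≤ L * |u x - u y| :=
    fun x hx y hy => abs_rpow_sub_le hp
      ⟨h.nonneg h0 (subset_closure hx), hmax x (subset_closure hx)⟩
      ⟨h.nonneg h0 (subset_closure hy), hmax y (subset_closure hy)⟩
  set K := lam * L / 4 with hK
  have hK0 : 0 ≤ K := by positivity
  set T : Set Plane := closedBall c R ∩ {x | 1 ≤ K * (R ^ 2 - ‖x - c‖ ^ 2)} with hT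
  have hTc : IsCompact T := (isCompact_closedBall c R).inter_right
    (isClosed_le continuous_const (by fun_prop))
  have hTb : T ⊆ ball c R := by
    rintro x ⟨-, hx⟩
    have hx' : 1 ≤ K * (R ^ 2 - ‖x - c‖ ^ 2) := hx
    rw [mem_ball, dist_eq_norm]
    by_contra! hcon
    have : R ^ 2 ≤ ‖x - c‖ ^ 2 := pow_le_pow_left₀ hR.le hcon 2
    nlinarith
  obtain ⟨B, hB⟩ := hTc.exists_bound_of_continuousOn
    ((h.smooth.continuousOn_fderiv_of_isOpen h.isOpen (by norm_num)).mono hTb)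
  have hrT : ∀ θ, ∀ x ∈ T, rot c θ x ∈ T := fun θ x hx => by
    obtain ⟨h1, h2⟩ := hx
    refine ⟨?_, ?_⟩
    · rw [mem_closedBall, dist_eq_norm] at h1 ⊢
      rwa [norm_rot_sub]
    · simpa only [mem_ofPred_eq, norm_rot_sub] using h2
  have hder : ∀ x ∈ ball c R, ∀ θ, HasDerivAt (fun θ => u (rot c θ x))
      (fderiv ℝ u (rot c θ x) (rotL θ (quarter (x - c)))) θ := fun x hx θ => by
    have hxr : rot c θ x ∈ ball c R := by
      rw [mem_ball, dist_eq_norm] at hx ⊢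
      rwa [norm_rot_sub]
    exact ((h.smooth.contDiffAt (isOpen_ball.mem_nhds hxr)).differentiableAt
      (by norm_num)).hasFDerivAt.comp_hasDerivAt θ (hasDerivAt_rot c x θ)
  have hrot0 : ∀ x, rot c 0 x = x := fun x => by simp [rot, rotL_apply]
  have hinner : ∀ θ, ∀ x ∈ T, |u (rot c θ x) - u x| ≤ |B| * R * |θ| := fun θ x hx => by
    have := convex_univ.norm_image_sub_le_of_norm_hasDerivWithin_le (C := |B| * R)
      (fun θ _ => (hder x (hTb hx) θ).hasDerivWithinAt) (fun θ _ => by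
        refine (ContinuousLinearMap.le_opNorm _ _).trans ?_
        rw [norm_rotL, norm_quarter]
        refine mul_le_mul ((hB _ (hrT θ x hx)).trans (le_abs_self B)) ?_ (norm_nonneg _)
          (abs_nonneg _)
        rw [← dist_eq_norm]
        exact hx.1) (mem_univ 0) (mem_univ θ)
    simpa [hrot0, norm_eq_abs] using this
  have hglob : ∀ θ, ∀ x ∈ closedBall c R,
      |u (rot c θ x) - u x| ≤ K * (|B| * R * |θ|) * (R ^ 2 - ‖x - c‖ ^ 2) := fun θ x hx => by
    have hrc : ∀ y ∈ closedBall c R, rot c θ y ∈ closedBall c R := fun y hy => by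
      rw [mem_closedBall, dist_eq_norm] at hy ⊢
      rwa [norm_rot_sub]
    have hcu := h.contOn
    rw [hcl] at hcu
    have hdc : ContinuousOn (fun y => |u (rot c θ y) - u y|) (closedBall c R) :=
      ((hcu.comp (contDiff_rot c θ).continuous.continuousOn hrc).sub hcu).abs
    obtain ⟨z, hz, hzmax⟩ := (isCompact_closedBall c R).exists_isMaxOn ⟨x, hx⟩ hdc
    have hbar : ∀ y ∈ closedBall c R, |u (rot c θ y) - u y| ≤
        K * |u (rot c θ z) - u z| * (R ^ 2 - ‖y - c‖ ^ 2) := fun y hy => by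
      have := h.rot_sub_le_barrier h0 hL hL0 (fun y hy => hzmax hy) hR hy
      rw [hK]
      linarith
    have hS : |u (rot c θ z) - u z| ≤ |B| * R * |θ| := by
      rcases (abs_nonneg (u (rot c θ z) - u z)).eq_or_lt with hS0 | hS0
      · rw [← hS0]
        positivity
      · refine hinner θ z ⟨hz, ?_⟩
        have := hbar z hz
        by_contra! hcon
        have hcon' : K * (R ^ 2 - ‖z - c‖ ^ 2) < 1 := not_le.mp hcon
        nlinarith
    refine (hbar x hx).trans ?_
    have hx2 : ‖x - c‖ ^ 2 ≤ R ^ 2 :=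
      pow_le_pow_left₀ (norm_nonneg _) (by rwa [mem_closedBall, dist_eq_norm] at hx) 2
    exact mul_le_mul_of_nonneg_right (mul_le_mul_of_nonneg_left hS hK0) (by linarith)
  refine ⟨K * (|B| * R), by positivity, fun x hx => ?_⟩
  have hx2 : ‖x - c‖ ^ 2 ≤ R ^ 2 :=
    pow_le_pow_left₀ (norm_nonneg _) (by rw [mem_ball, dist_eq_norm] at hx; exact hx.le) 2
  have hd := hder x hx 0
  rw [hrot0, rotL_apply, cos_zero, sin_zero, one_smul, zero_smul, add_zero] at hd
  have := hd.le_of_lip' (C := K * (|B| * R) * (R ^ 2 - ‖x - c‖ ^ 2))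
    (mul_nonneg (by positivity) (by linarith)) (Eventually.of_forall fun θ => by
      rw [hrot0, norm_eq_abs, norm_eq_abs, sub_zero]
      refine (hglob θ x (ball_subset_closedBall hx)).trans (le_of_eq ?_)
      ring)
  rwa [norm_eq_abs] at this

end Sol

section
variable {c : Plane} {R r : ℝ}

lemma sq_lt_of_notMem_closedBall (hr : 0 ≤ r) {x : Plane} (hx : x ∉ closedBall c r) :
    r ^ 2 < ‖x - c‖ ^ 2 := by
  rw [mem_closedBall, dist_eq_norm, not_le] at hx
  exact pow_lt_pow_left₀ hx hr two_ne_zero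

lemma integrableOn_cutoff (hr : 0 ≤ r) (hrR : r < R) {k : ℝ → ℝ} (hk : Continuous k)
    (hk0 : ∀ s, r ^ 2 < s → k s = 0) {f : Plane → ℝ} (hf : ContinuousOn f (ball c R)) :
    IntegrableOn (fun x => k (‖x - c‖ ^ 2) * f x) (ball c R) := by
  refine IntegrableOn.of_forall_sdiff_eq_zero (s := closedBall c r) ?_ measurableSet_ball ?_
  · refine ContinuousOn.integrableOn_compact (isCompact_closedBall c r) ?_
    exact (hk.comp (by fun_prop)).continuousOn.mul (hf.mono (closedBall_subset_ball hrR))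
  · intro x hx
    rw [hk0 _ (sq_lt_of_notMem_closedBall hr hx.2), zero_mul]

lemma deriv_cutoff {ζ : ℝ → ℝ} (hζ0 : ∀ s, r ^ 2 ≤ s → ζ s = 0) {s : ℝ} (hs : r ^ 2 < s) :
    deriv ζ s = 0 := by
  have : ζ =ᶠ[𝓝 s] fun _ => 0 := by
    filter_upwards [lt_mem_nhds hs] with t ht using hζ0 t ht.le
  rw [this.deriv_eq, deriv_const]

/-- The divergence theorem for a vector field on a disk multiplied by a radial cutoff. -/
lemma integral_cutoff_div (hr : 0 ≤ r) (hrR : r < R) {ζ : ℝ → ℝ} (hζ : ContDiff ℝ 1 ζ)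
    (hζ0 : ∀ s, r ^ 2 ≤ s → ζ s = 0) {Y : Fin 2 → Plane → ℝ}
    (hY : ∀ i, ContDiffOn ℝ 1 (Y i) (ball c R)) {D : Plane → ℝ}
    (hDc : ContinuousOn D (ball c R))
    (hD : ∀ x ∈ ball c R, ∑ i, fderiv ℝ (Y i) x (EuclideanSpace.single i 1) = D x) :
    ∫ x in ball c R, ζ (‖x - c‖ ^ 2) * D x =
      ∫ x in ball c R, -deriv ζ (‖x - c‖ ^ 2) * (2 * ∑ i, (x - c) i * Y i x) := by
  have hn : ∀ x, HasFDerivAt (fun y : Plane => ‖y - c‖ ^ 2) (2 • innerSL ℝ (x - c)) x := fun x => by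
    simpa using ((hasFDerivAt_id x).sub_const c).norm_sq
  have hn1 : ContDiff ℝ 1 (fun y : Plane => ‖y - c‖ ^ 2) :=
    (contDiff_id.sub contDiff_const).norm_sq ℝ
  let e : Fin 2 → Plane := fun i => EuclideanSpace.single i 1
  let X : Fin 2 → Plane → ℝ := fun i x => ζ (‖x - c‖ ^ 2) * Y i x
  have hX : ∀ i, ContDiffOn ℝ 1 (X i) (ball c R) := fun i =>
    (hζ.comp hn1).contDiffOn.mul (hY i)
  have hXi := fun i => contDiff_indicator isOpen_ball (isCompact_closedBall c r)
    (closedBall_subset_ball hrR) (hX i) (fun x hx hxK => by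
      simp [X, hζ0 _ (sq_lt_of_notMem_closedBall hr hxK).le])
  have hsum : ∑ i, ∫ x, fderiv ℝ ((ball c R).indicator (X i)) x (e i) = 0 :=
    Finset.sum_eq_zero fun i _ => integral_fderiv_eq_zero (hXi i).1 (hXi i).2.1 _
  rw [← integral_finsetSum] at hsum
  swap
  · exact fun i _ => (((hXi i).1.continuous_fderiv one_ne_zero).clm_apply
      continuous_const).integrable_of_hasCompactSupport ((hXi i).2.1.fderiv_apply ℝ _)
  have hpt : (fun x => ∑ i, fderiv ℝ ((ball c R).indicator (X i)) x (e i)) =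
      (ball c R).indicator (fun x => ζ (‖x - c‖ ^ 2) * D x -
        -deriv ζ (‖x - c‖ ^ 2) * (2 * ∑ i, (x - c) i * Y i x)) := by
    ext x
    by_cases hx : x ∈ ball c R
    · rw [indicator_of_mem hx, ← hD x hx]
      have hnh := isOpen_ball.mem_nhds hx
      have h1 : ∀ i, fderiv ℝ ((ball c R).indicator (X i)) x (e i) =
          ζ (‖x - c‖ ^ 2) * fderiv ℝ (Y i) x (e i) +
            deriv ζ (‖x - c‖ ^ 2) * (2 * ((x - c) i * Y i x)) := by
        intro i
        have : (ball c R).indicator (X i) =ᶠ[𝓝 x] X i := by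
          filter_upwards [hnh] with y hy using indicator_of_mem hy _
        rw [this.fderiv_eq]
        have h2 : HasFDerivAt (fun y => ζ (‖y - c‖ ^ 2))
            (deriv ζ (‖x - c‖ ^ 2) • 2 • innerSL ℝ (x - c)) x :=
          (hζ.differentiable one_ne_zero _).hasDerivAt.comp_hasFDerivAt x (hn x)
        have h3 : HasFDerivAt (Y i) (fderiv ℝ (Y i) x) x :=
          (((hY i).contDiffAt hnh).differentiableAt one_ne_zero).hasFDerivAt
        have h4 : HasFDerivAt (X i) _ x := h2.mul h3
        rw [h4.fderiv]
        simp [e, EuclideanSpace.inner_single_right]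
        ring
      simp_rw [h1]
      rw [Finset.sum_add_distrib, ← Finset.mul_sum, ← Finset.mul_sum, ← Finset.mul_sum]
      ring
    · rw [indicator_of_notMem hx]
      refine Finset.sum_eq_zero fun i _ => ?_
      have : x ∉ tsupport (fderiv ℝ ((ball c R).indicator (X i))) := fun hc =>
        hx (closedBall_subset_ball hrR ((hXi i).2.2 (tsupport_fderiv_subset ℝ hc)))
      rw [image_eq_zero_of_notMem_tsupport this]
      simp
  rw [hpt, integral_indicator measurableSet_ball, integral_sub, sub_eq_zero] at hsum
  · exact hsum
  · exact integrableOn_cutoff hr hrR hζ.continuous (fun s hs => hζ0 s hs.le) hDc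
  · refine integrableOn_cutoff hr hrR (hζ.continuous_deriv le_rfl).neg
      (fun s hs => by simp [deriv_cutoff hζ0 hs]) (continuousOn_const.mul ?_)
    refine continuousOn_finsetSum _ fun i _ => ?_
    exact ContinuousOn.mul (Continuous.continuousOn (by fun_prop)) (hY i).continuousOn

end

namespace Sol
open SuperH
variable {c : Plane} {R : ℝ} {u : Plane → ℝ} {p lam : ℝ}

/-- The Pohozaev vector field. -/
def pohoField (c : Plane) (u : Plane → ℝ) (p lam : ℝ) (i : Fin 2) (x : Plane) : ℝ :=
  (∑ j, (x - c) j * fderiv ℝ u x (EuclideanSpace.single j 1)) *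
      fderiv ℝ u x (EuclideanSpace.single i 1) -
    2⁻¹ * (∑ j, fderiv ℝ u x (EuclideanSpace.single j 1) ^ 2) * (x - c) i +
    lam / (p + 1) * u x ^ (p + 1) * (x - c) i

lemma contDiffOn_pohoField (h : Sol (ball c R) u p lam) (i : Fin 2) :
    ContDiffOn ℝ 1 (pohoField c u p lam i) (ball c R) := by
  have hp := h.one_le
  have hd : ∀ j : Fin 2, ContDiffOn ℝ 1
      (fun x => fderiv ℝ u x (EuclideanSpace.single j 1)) (ball c R) := fun j =>
    h.contDiffOn_fderiv.clm_apply contDiffOn_const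
  have hy : ∀ j : Fin 2, ContDiffOn ℝ 1 (fun x : Plane => (x - c) j) (ball c R) := fun j =>
    ((EuclideanSpace.proj j : Plane →L[ℝ] ℝ).contDiff.comp
      (contDiff_id.sub contDiff_const)).contDiffOn
  have hpow : ContDiffOn ℝ 1 (fun x => u x ^ (p + 1)) (ball c R) :=
    (contDiff_rpow_const_of_le (n := 1) (by simp; linarith)).comp_contDiffOn
      (h.smooth.of_le (by norm_num))
  unfold pohoField
  exact (((ContDiffOn.sum fun j _ => (hy j).mul (hd j)).mul (hd i)).sub
    ((contDiffOn_const.mul (ContDiffOn.sum fun j _ => (hd j).pow 2)).mul (hy i))).add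
    ((contDiffOn_const.mul hpow).mul (hy i))

lemma div_pohoField (h : Sol (ball c R) u p lam) (h0 : ∀ x ∈ frontier (ball c R), u x = 0)
    {x : Plane} (hx : x ∈ ball c R) :
    ∑ i, fderiv ℝ (pohoField c u p lam i) x (EuclideanSpace.single i 1) =
      2 * (lam / (p + 1) * u x ^ (p + 1)) := by
  have hp := h.one_le
  have hnh := isOpen_ball.mem_nhds hx
  have hc2 := h.smooth.contDiffAt hnh
  have hsymm := hc2.isSymmSndFDerivAt (by simp)
  have hd : ∀ j : Fin 2, HasFDerivAt (fun x => fderiv ℝ u x (EuclideanSpace.single j 1))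
      ((fderiv ℝ (fderiv ℝ u) x).flip (EuclideanSpace.single j 1)) x := fun j => by
    have := hc2.differentiableAt_fderiv_two.hasFDerivAt.clm_apply
      (hasFDerivAt_const (EuclideanSpace.single j (1 : ℝ)) x)
    simpa using this
  have hy : ∀ j : Fin 2, HasFDerivAt (fun x : Plane => (x - c) j)
      (EuclideanSpace.proj j : Plane →L[ℝ] ℝ) x := fun j =>
    (EuclideanSpace.proj j : Plane →L[ℝ] ℝ).hasFDerivAt.sub_const (c j)
  have hpow : HasFDerivAt (fun x => u x ^ (p + 1)) (((p + 1) * u x ^ (p + 1 - 1)) • fderiv ℝ u x) x :=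
    ((hasDerivAt_rpow_const (Or.inr (by linarith))).comp_hasFDerivAt x
      (hc2.differentiableAt (by norm_num)).hasFDerivAt)
  have hX : ∀ i, HasFDerivAt (pohoField c u p lam i) _ x := fun i =>
    (((HasFDerivAt.fun_sum fun j _ => (hy j).mul (hd j)).mul (hd i)).sub
      (((HasFDerivAt.fun_sum fun j _ => (hd j).pow 2).const_mul 2⁻¹).mul (hy i))).add
      ((hpow.const_mul (lam / (p + 1))).mul (hy i))
  have hlap := h.pde x hx
  rw [max_eq_left (h.nonneg h0 (subset_closure hx)), lap_eq_sum hc2, Fin.sum_univ_two] at hlap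
  have hs := hsymm (EuclideanSpace.single 0 1) (EuclideanSpace.single 1 1)
  have hF : lam / (p + 1) * ((p + 1) * u x ^ p) = lam * u x ^ p := by field_simp
  rw [Fin.sum_univ_two, (hX 0).fderiv, (hX 1).fderiv]
  simp [Fin.sum_univ_two]
  linear_combination (-((x 0 - c 0) * fderiv ℝ u x (EuclideanSpace.single 0 1) +
      (x 1 - c 1) * fderiv ℝ u x (EuclideanSpace.single 1 1))) * hlap +
    ((x 0 - c 0) * fderiv ℝ u x (EuclideanSpace.single 0 1) +
      (x 1 - c 1) * fderiv ℝ u x (EuclideanSpace.single 1 1)) * hF +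
    ((x 1 - c 1) * fderiv ℝ u x (EuclideanSpace.single 0 1) -
      (x 0 - c 0) * fderiv ℝ u x (EuclideanSpace.single 1 1)) * hs

end Sol

/-- A smooth antitone function equal to one up to `a` and vanishing after `b`. -/
lemma exists_antitone_cutoff {a b : ℝ} (hab : a < b) :
    ∃ ζ : ℝ → ℝ, ContDiff ℝ 1 ζ ∧ Antitone ζ ∧ (∀ s, s ≤ a → ζ s = 1) ∧ (∀ s, b ≤ s → ζ s = 0) := by
  have hpos : 0 < b - a := by linarith
  refine ⟨fun s => smoothTransition ((b - s) / (b - a)), ?_, ?_, fun s hs => ?_, fun s hs => ?_⟩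
  · exact (smoothTransition.contDiff (n := 1)).comp ((contDiff_const.sub contDiff_id).div_const _)
  · intro s t hst
    exact smoothTransition.monotone (by gcongr)
  · exact smoothTransition.one_of_one_le ((one_le_div hpos).2 (by linarith))
  · exact smoothTransition.zero_of_nonpos (div_nonpos_of_nonpos_of_nonneg (by linarith) hpos.le)

namespace Sol
open SuperH
variable {c : Plane} {R : ℝ} {u : Plane → ℝ} {p lam : ℝ}

lemma sum_mul_pohoField (x : Plane) :
    2 * ∑ i, (x - c) i * pohoField c u p lam i x =
      fderiv ℝ u x (x - c) ^ 2 - fderiv ℝ u x (quarter (x - c)) ^ 2 +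
        2 * (lam / (p + 1) * u x ^ (p + 1)) * ‖x - c‖ ^ 2 := by
  have e : x - c = (x - c) 0 • EuclideanSpace.single 0 1 + (x - c) 1 • EuclideanSpace.single 1 1 := by
    ext i
    fin_cases i <;> simp
  have e1 : fderiv ℝ u x (x - c) = (x - c) 0 * fderiv ℝ u x (EuclideanSpace.single 0 1) +
      (x - c) 1 * fderiv ℝ u x (EuclideanSpace.single 1 1) := by
    conv_lhs => rw [e]
    simp only [map_add, map_smul, smul_eq_mul]
  rw [e1, plane_norm_sq, quarter_apply]
  simp only [map_sub, map_smul, smul_eq_mul, pohoField, Fin.sum_univ_two]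
  ring

/-- A localized Pohozaev inequality on a disk of unit area. -/
lemma pohozaev_local (h : Sol (ball c R) u p lam) (h0 : ∀ x ∈ frontier (ball c R), u x = 0)
    (hvol : volume (ball c R) = 1) {C : ℝ} (hC0 : 0 ≤ C)
    (hC : ∀ x ∈ ball c R, |fderiv ℝ u x (quarter (x - c))| ≤ C * (R ^ 2 - ‖x - c‖ ^ 2))
    {t : ℝ} (ht : 0 ≤ t) {q : ℝ} (hq : 0 < q) (hqR : q < R) :
    t * lam * (Pm (ball c R) u p (closedBall c q)).toReal -
      (t ^ 2 + (C * (R ^ 2 - q ^ 2)) ^ 2) / q ^ 2 ≤ 2 * (lam / (p + 1)) * En (ball c R) u p := by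
  have hp := h.one_le
  have hl := h.lam_pos
  obtain ⟨r, hqr, hrR⟩ := exists_between hqR
  have hr : 0 ≤ r := (hq.trans hqr).le
  obtain ⟨ζ, hζ, hanti, hζ1, hζ0⟩ := exists_antitone_cutoff (pow_lt_pow_left₀ hqr hq.le two_ne_zero)
  have hζnn : ∀ s, 0 ≤ ζ s := fun s => by
    rw [← hζ0 (max s (r ^ 2)) (le_max_right _ _)]
    exact hanti (le_max_left _ _)
  have hζle : ∀ s, ζ s ≤ 1 := fun s => by
    rw [← hζ1 (min s (q ^ 2)) (min_le_right _ _)]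
    exact hanti (min_le_left _ _)
  have hk : Continuous fun s => -deriv ζ s := (hζ.continuous_deriv le_rfl).neg
  have hknn : ∀ s, 0 ≤ -deriv ζ s := fun s => neg_nonneg.2 hanti.deriv_nonpos
  have hk0 : ∀ s, r ^ 2 < s → -deriv ζ s = 0 := fun s hs => by simp [deriv_cutoff hζ0 hs]
  have hk1 : ∀ s, s < q ^ 2 → -deriv ζ s = 0 := fun s hs => by
    have : ζ =ᶠ[𝓝 s] fun _ => 1 := by
      filter_upwards [gt_mem_nhds hs] with t ht using hζ1 t ht.le
    rw [this.deriv_eq, deriv_const, neg_zero]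
  have hu : ∀ x ∈ ball c R, max (u x) 0 = u x := fun x hx =>
    max_eq_left (h.nonneg h0 (subset_closure hx))
  have hdu : ContinuousOn (fderiv ℝ u) (ball c R) := h.contDiffOn_fderiv.continuousOn
  have hcu : ContinuousOn u (ball c R) := h.smooth.continuousOn
  have hcp : ∀ a : ℝ, 0 ≤ a → ContinuousOn (fun x => u x ^ a) (ball c R) := fun a ha =>
    hcu.rpow_const fun _ _ => Or.inr ha
  have hy : ContinuousOn (fun x : Plane => x - c) (ball c R) := by fun_prop
  have hcw : ContinuousOn (fun x => fderiv ℝ u x (x - c)) (ball c R) := hdu.clm_apply hy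
  have hcτ : ContinuousOn (fun x => fderiv ℝ u x (quarter (x - c))) (ball c R) :=
    hdu.clm_apply (quarter.continuous.comp_continuousOn hy)
  have hcF : ContinuousOn (fun x => 2 * (lam / (p + 1) * u x ^ (p + 1))) (ball c R) :=
    continuousOn_const.mul (continuousOn_const.mul (hcp _ (by linarith)))
  have hcs : ContinuousOn (fun x : Plane => ‖x - c‖ ^ 2) (ball c R) := by fun_prop
  have P1 := integral_cutoff_div hr hrR hζ hζ0 h.contDiffOn_pohoField hcF
    fun x hx => h.div_pohoField h0 hx
  simp_rw [sum_mul_pohoField] at P1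
  have P2 := integral_cutoff_div hr hrR hζ hζ0
    (Y := fun i x => fderiv ℝ u x (EuclideanSpace.single i 1))
    (fun i => h.contDiffOn_fderiv.clm_apply contDiffOn_const) h.continuousOn_lap
    (fun x _ => rfl)
  have P3 := integral_cutoff_div (c := c) hr hrR hζ hζ0 (Y := fun i x => (x - c) i)
    (fun i => ((EuclideanSpace.proj i : Plane →L[ℝ] ℝ).contDiff.comp
      (contDiff_id.sub contDiff_const)).contDiffOn) (D := fun _ => 2) continuousOn_const
    (fun x _ => by
      have : ∀ i : Fin 2, HasFDerivAt (fun x : Plane => (x - c) i)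
        (EuclideanSpace.proj i : Plane →L[ℝ] ℝ) x := fun i =>
          (EuclideanSpace.proj i : Plane →L[ℝ] ℝ).hasFDerivAt.sub_const (c i)
      rw [Fin.sum_univ_two, (this 0).fderiv, (this 1).fderiv]
      norm_num)
  have e2 : ∀ x : Plane, ∑ i, (x - c) i * fderiv ℝ u x (EuclideanSpace.single i 1) =
      fderiv ℝ u x (x - c) := fun x => by
    have e : x - c = (x - c) 0 • EuclideanSpace.single 0 1 +
        (x - c) 1 • EuclideanSpace.single 1 1 := by
      ext i
      fin_cases i <;> simp
    conv_rhs => rw [e]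
    simp only [map_add, map_smul, smul_eq_mul, Fin.sum_univ_two]
  have e3 : ∀ x : Plane, ∑ i, (x - c) i * (x - c) i = ‖x - c‖ ^ 2 := fun x => by
    rw [plane_norm_sq, Fin.sum_univ_two]; ring
  simp_rw [e2] at P2
  simp_rw [e3] at P3
  set M := t ^ 2 + (C * (R ^ 2 - q ^ 2)) ^ 2 with hM
  have hMnn : 0 ≤ M := by positivity
  have hq2 : 0 < q ^ 2 := by positivity
  have key : -t * (∫ x in ball c R, ζ (‖x - c‖ ^ 2) * lap u x) -
      M / (2 * q ^ 2) * (∫ x in ball c R, ζ (‖x - c‖ ^ 2) * 2) ≤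
      ∫ x in ball c R, ζ (‖x - c‖ ^ 2) * (2 * (lam / (p + 1) * u x ^ (p + 1))) := by
    have i2 : IntegrableOn (fun x => -deriv ζ (‖x - c‖ ^ 2) * (2 * fderiv ℝ u x (x - c)))
      (ball c R) := integrableOn_cutoff hr hrR hk hk0 (continuousOn_const.mul hcw)
    have i3 : IntegrableOn (fun x => -deriv ζ (‖x - c‖ ^ 2) * (2 * ‖x - c‖ ^ 2))
      (ball c R) := integrableOn_cutoff hr hrR hk hk0 (continuousOn_const.mul hcs)
    rw [P1, P2, P3, ← integral_const_mul, ← integral_const_mul,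
      ← integral_sub (i2.const_mul _) (i3.const_mul _)]
    refine setIntegral_mono_on ((i2.const_mul _).sub (i3.const_mul _))
      (integrableOn_cutoff hr hrR hk hk0 (((hcw.pow 2).sub (hcτ.pow 2)).add (hcF.mul hcs)))
      measurableSet_ball fun x hx => ?_
    rcases lt_or_ge (‖x - c‖ ^ 2) (q ^ 2) with hs | hs
    · simp only [hk1 _ hs, zero_mul, mul_zero, sub_zero, le_refl]
    set s := ‖x - c‖ ^ 2
    have hsR : s ≤ R ^ 2 := by
      have : ‖x - c‖ < R := by rwa [mem_ball, dist_eq_norm] at hx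
      exact (pow_le_pow_left₀ (norm_nonneg _) this.le 2)
    have hτ : fderiv ℝ u x (quarter (x - c)) ^ 2 ≤ (C * (R ^ 2 - q ^ 2)) ^ 2 := by
      rw [← sq_abs]
      refine pow_le_pow_left₀ (abs_nonneg _) ((hC x hx).trans ?_) 2
      gcongr
    have hF : 0 ≤ 2 * (lam / (p + 1) * u x ^ (p + 1)) * s := by
      have : 0 ≤ u x ^ (p + 1) := rpow_nonneg (h.nonneg h0 (subset_closure hx)) _
      positivity
    have hMs : M ≤ M / (2 * q ^ 2) * (2 * s) := by
      rw [div_mul_eq_mul_div, le_div_iff₀ (by positivity)]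
      nlinarith
    have := mul_le_mul_of_nonneg_left (a := -deriv ζ s)
      (b := -t * (2 * fderiv ℝ u x (x - c)) - M / (2 * q ^ 2) * (2 * s))
      (c := fderiv ℝ u x (x - c) ^ 2 - fderiv ℝ u x (quarter (x - c)) ^ 2 +
        2 * (lam / (p + 1) * u x ^ (p + 1)) * s)
      (by nlinarith [sq_nonneg (fderiv ℝ u x (x - c) + t)]) (hknn s)
    linarith
  have b3 : ∫ x in ball c R, ζ (‖x - c‖ ^ 2) * 2 ≤ 2 := by
    have : ∫ x in ball c R, ζ (‖x - c‖ ^ 2) * 2 ≤ ∫ x in ball c R, (2 : ℝ) := by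
      refine setIntegral_mono_on (integrableOn_cutoff hr hrR hζ.continuous
        (fun s hs => hζ0 s hs.le) continuousOn_const) ?_ measurableSet_ball fun x _ => ?_
      · exact integrableOn_const (by simp [hvol])
      · linarith [hζle (‖x - c‖ ^ 2)]
    simpa [Measure.real, hvol] using this
  have b1 : ∫ x in ball c R, ζ (‖x - c‖ ^ 2) * (2 * (lam / (p + 1) * u x ^ (p + 1))) ≤
      2 * (lam / (p + 1)) * En (ball c R) u p := by
    rw [En, ← integral_const_mul]
    refine setIntegral_mono_on (integrableOn_cutoff hr hrR hζ.continuous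
        (fun s hs => hζ0 s hs.le) hcF) ((h.integrableOn_pow (by linarith)).const_mul _)
        measurableSet_ball fun x hx => ?_
    rw [hu x hx, ← mul_assoc 2]
    have : 0 ≤ u x ^ (p + 1) := rpow_nonneg (h.nonneg h0 (subset_closure hx)) _
    exact mul_le_of_le_one_left (by positivity) (hζle _)
  have b2 : lam * (Pm (ball c R) u p (closedBall c q)).toReal ≤
      -∫ x in ball c R, ζ (‖x - c‖ ^ 2) * lap u x := by
    have hsub : closedBall c q ⊆ ball c R := closedBall_subset_ball hqR
    rw [Pm_apply _ _ _ measurableSet_closedBall, inter_eq_self_of_subset_right hsub,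
      ← integral_eq_lintegral_of_nonneg_ae (ae_of_all _ fun x => pow_nonneg u p x)
        (h.measurable_pow p).aestronglyMeasurable, ← integral_const_mul, ← integral_neg]
    have i1 : IntegrableOn (fun x => -(ζ (‖x - c‖ ^ 2) * lap u x)) (ball c R) :=
      (integrableOn_cutoff hr hrR hζ.continuous (fun s hs => hζ0 s hs.le) h.continuousOn_lap).neg
    have hpt : ∀ x ∈ ball c R, -(ζ (‖x - c‖ ^ 2) * lap u x) =
        ζ (‖x - c‖ ^ 2) * (lam * max (u x) 0 ^ p) := fun x hx => by
      rw [← h.pde x hx]; ring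
    refine le_trans ?_ (setIntegral_mono_set i1 ?_ hsub.eventuallyLE)
    · refine setIntegral_mono_on (((h.integrableOn_pow (by linarith)).mono_set hsub).const_mul _)
        (i1.mono_set hsub) measurableSet_closedBall fun x hx => ?_
      rw [hpt x (hsub hx), hζ1, one_mul]
      rw [mem_closedBall, dist_eq_norm] at hx
      exact pow_le_pow_left₀ (norm_nonneg _) hx 2
    · filter_upwards [ae_restrict_mem measurableSet_ball] with x hx
      rw [hpt x hx]
      exact mul_nonneg (hζnn _) (mul_nonneg hl.le (pow_nonneg u p x))
  have b3' := mul_le_mul_of_nonneg_left b3 (a := M / (2 * q ^ 2)) (by positivity)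
  have e : M / (2 * q ^ 2) * 2 = M / q ^ 2 := by field_simp
  nlinarith [mul_le_mul_of_nonneg_left b2 ht]

/-- On a disk of unit area the isoperimetric energy inequality is an equality. -/
theorem eight_pi_eq (h : Sol (ball c R) u p lam) (h0 : ∀ x ∈ frontier (ball c R), u x = 0)
    (hR : 0 < R) (hRπ : π * R ^ 2 = 1) (hvol : volume (ball c R) = 1) :
    8 * π * En (ball c R) u p = (p + 1) * lam := by
  have hp := h.one_le
  have hl := h.lam_pos
  refine le_antisymm h.eight_pi_le ?_
  obtain ⟨C, hC0, hC⟩ := h.exists_angular_bound h0 hR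
  have hprob := h.isProb
  set t := lam / (2 * π) with ht
  have ht0 : 0 ≤ t := by positivity
  obtain ⟨q, hqm, hqR, hqt⟩ := exists_seq_strictMono_tendsto' hR
  have hm : Tendsto (fun n => (Pm (ball c R) u p (closedBall c (q n))).toReal) atTop (𝓝 1) := by
    have hU : ⋃ n, closedBall c (q n) = ball c R := by
      ext x
      simp only [mem_iUnion, mem_closedBall, mem_ball]
      constructor
      · rintro ⟨n, hn⟩
        exact hn.trans_lt (hqR n).2
      · intro hx
        obtain ⟨n, hn⟩ := (hqt.eventually (lt_mem_nhds hx)).exists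
        exact ⟨n, hn.le⟩
    have h1 : Pm (ball c R) u p (ball c R) = 1 := by
      rw [Pm_apply _ _ _ measurableSet_ball, inter_self, h.constr]
    have := tendsto_measure_iUnion_atTop (μ := Pm (ball c R) u p)
      (s := fun n => closedBall c (q n)) fun m n hmn => closedBall_subset_closedBall (hqm.monotone hmn)
    rw [hU, h1] at this
    exact (ENNReal.tendsto_toReal ENNReal.one_ne_top).comp this
  have hlim : Tendsto (fun n => t * lam * (Pm (ball c R) u p (closedBall c (q n))).toReal -
      (t ^ 2 + (C * (R ^ 2 - q n ^ 2)) ^ 2) / q n ^ 2) atTop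
      (𝓝 (t * lam * 1 - (t ^ 2 + (C * (R ^ 2 - R ^ 2)) ^ 2) / R ^ 2)) :=
    (hm.const_mul _).sub ((((tendsto_const_nhds.sub (hqt.pow 2)).const_mul C).pow 2
      |>.const_add _).div (hqt.pow 2) (by positivity))
  have := le_of_tendsto' hlim fun n =>
    h.pohozaev_local h0 hvol hC0 hC ht0 (hqR n).1 (hqR n).2
  have hR2 : R ^ 2 = π⁻¹ := by field_simp; linarith
  rw [hR2, sub_self, mul_zero, zero_pow two_ne_zero, add_zero, div_inv_eq_mul, mul_one] at this
  have e : t * lam - t ^ 2 * π = lam ^ 2 / (4 * π) := by rw [ht]; field_simp; ring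
  rw [e, div_le_iff₀ (by positivity)] at this
  have e' : 2 * (lam / (p + 1)) * En (ball c R) u p * (4 * π) =
    lam * (8 * π * En (ball c R) u p) / (p + 1) := by field_simp; ring
  rw [e', le_div_iff₀ (by linarith)] at this
  nlinarith

end Sol


/-- Theorem 2.3: for `N = 2`, `|Ω| = 1` and a solution of `(P)_λ` with `α_λ ≤ 0` one has
`λ ≥ λ₀(Ω,p)`, with equality iff `α_λ = 0`, `p = 1` or (`p > 1` and `Ω` a unit-area disk),
and `ξ_λ = λψ_λ` is a minimizer of the quotient `R_{p+1}`. -/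
theorem statement5 (Ω : Set (EuclideanSpace ℝ (Fin 2)))
    (hopen : IsOpen Ω) (hconn : IsConnected Ω) (hbdd : Bornology.IsBounded Ω)
    (hvol : volume Ω = 1) (p : ℝ) (hp : 1 ≤ p)
    (lam α : ℝ) (ψ : EuclideanSpace ℝ (Fin 2) → ℝ)
    (hlam : 0 < lam) (hsol : IsSol Ω p lam α ψ) (hα : α ≤ 0) :
    lam0 Ω p ≤ lam ∧
    (lam = lam0 Ω p ↔
      (α = 0 ∧ (p = 1 ∨ (1 < p ∧ IsUnitDisk Ω)) ∧
        Ray Ω (p + 1) (fun x => lam * ψ x) = Lam Ω (p + 1))) := by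
  refine comparison Ω (fun u p lam h h0 => ⟨fun he => h.isUnitDisk he hconn hvol h0, ?_⟩)
    hopen hbdd p hp lam α ψ hlam hsol hα
  rintro ⟨c, rfl⟩
  refine h.eight_pi_eq h0 (by positivity) ?_ hvol
  rw [sq_sqrt (by positivity), mul_inv_cancel₀ pi_ne_zero]
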